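/- arXiv:2003.03643 — 2 statements merged into one kernel-verified Lean document; each statement's English description precedes it below -/
import Mathlib

section
/- Define A_ε(x) = ∫_{Ω_ε} (f(u_ε(y)) − f(u_0(y))) G_ε(x,y) dy. Then: (i) A_ε → 0 uniformly on Ω_ε as ε → 0 (along the sequence of the weak limit); (ii) for every family of points x = x_ε ∈ Ω_ε with |x−P|/ε → +∞ and |x−P| → 0, one has ∂A_ε(x)/∂x_i = o(1 + ε^{N−2}/|x−P|^{N−1}) if N ≥ 3 and ∂A_ε(x)/∂x_i = o(1 + 1/(|x−P|·|log ε|)) if N = 2, for each i. -/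
open Filter Set Topology Metric MeasureTheory

noncomputable section

/-- Euclidean space `ℝ^N`. -/
abbrev EN (N : ℕ) := EuclideanSpace ℝ (Fin N)

/-- Partial derivative `∂u/∂x_i`. -/
def pd {N : ℕ} (u : EN N → ℝ) (i : Fin N) (x : EN N) : ℝ :=
  fderiv ℝ u x (EuclideanSpace.single i 1)

/-- Second partial derivative `∂²u/∂x_i∂x_j`. -/
def pd2 {N : ℕ} (u : EN N → ℝ) (i j : Fin N) (x : EN N) : ℝ :=
  fderiv ℝ (fun y => pd u i y) x (EuclideanSpace.single j 1)

/-- The Laplacian `Δu`. -/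
def lap {N : ℕ} (u : EN N → ℝ) (x : EN N) : ℝ := ∑ i, pd2 u i i x

/-- The Hessian matrix of `u` at `x`. -/
def hess {N : ℕ} (u : EN N → ℝ) (x : EN N) : Matrix (Fin N) (Fin N) ℝ :=
  Matrix.of fun i j => pd2 u i j x

/-- `u` is a (classical, positive) solution of `-Δu = f(u)` in `D`, `u > 0` in `D`,
`u = 0` on `∂D`. -/
def IsSol {N : ℕ} (f : ℝ → ℝ) (D : Set (EN N)) (u : EN N → ℝ) : Prop :=
  ContDiffOn ℝ 2 u D ∧ (∀ x ∈ D, lap u x = - f (u x)) ∧ (∀ x ∈ D, 0 < u x) ∧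
    ContinuousOn u (closure D) ∧ (∀ x ∈ frontier D, u x = 0)

/-- `u ε → u₀` in `C²(K)` as `ε → 0⁺`: uniform convergence on `K` of the functions and of
their first and second partial derivatives. -/
def C2ConvOn {N : ℕ} (u : ℝ → EN N → ℝ) (u₀ : EN N → ℝ) (K : Set (EN N)) : Prop :=
  TendstoUniformlyOn (fun ε => u ε) u₀ (𝓝[>] (0:ℝ)) K ∧
    (∀ i, TendstoUniformlyOn (fun ε => pd (u ε) i) (pd u₀ i) (𝓝[>] (0:ℝ)) K) ∧
    (∀ i j, TendstoUniformlyOn (fun ε => pd2 (u ε) i j) (pd2 u₀ i j) (𝓝[>] (0:ℝ)) K)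

/-- The common setting of the paper: `Ω` a bounded domain, `P ∈ Ω`, `f` smooth, and for every
small `ε > 0`, `u ε` solves `-Δu = f(u)`, `u > 0` in `Ω_ε = Ω \ B(P,ε)`, `u = 0` on `∂Ω_ε`,
with a uniform bound `|u ε| ≤ C`, and `u₀` is the weak limit: a solution on `Ω` such that
`u ε → u₀` in `C²(K)` for every compact `K ⊆ Ω \ {P}`. -/
def Setting {N : ℕ} (Ω : Set (EN N)) (P : EN N) (f : ℝ → ℝ) (ε₀ C : ℝ)
    (u : ℝ → EN N → ℝ) (u₀ : EN N → ℝ) : Prop :=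
  IsOpen Ω ∧ Bornology.IsBounded Ω ∧ P ∈ Ω ∧ ContDiff ℝ (⊤ : ℕ∞) f ∧ 0 < ε₀ ∧
    (∀ ε ∈ Ioo (0:ℝ) ε₀, IsSol f (Ω \ closedBall P ε) (u ε)) ∧
    (∀ ε ∈ Ioo (0:ℝ) ε₀, ∀ x ∈ Ω \ closedBall P ε, |u ε x| ≤ C) ∧
    IsSol f Ω u₀ ∧
    (∀ K ⊆ Ω \ {P}, IsCompact K → C2ConvOn u u₀ K)

/-- `ω_N`: the volume of the unit ball of `ℝ^N`. -/
def omegaN (N : ℕ) : ℝ := (volume (ball (0 : EN N) 1)).toReal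

/-- The fundamental solution `S(x,y)` of `-Δ` in `ℝ^N`. -/
def fundS (N : ℕ) (x y : EN N) : ℝ :=
  if N = 2 then -(1 / (2 * Real.pi)) * Real.log ‖x - y‖
  else (1 / ((N:ℝ) * ((N:ℝ) - 2) * omegaN N)) * ‖x - y‖ ^ ((2:ℝ) - (N:ℝ))

/-- `H` is the regular part of the Dirichlet Green function of `-Δ` on `D` (relative to the
fundamental solution `S`): for `y ∈ D`, `H(·,y)` is harmonic in `D`, continuous up to the
boundary, and `G = S + H` vanishes on `∂D`. -/
def IsRegularPart {N : ℕ} (D : Set (EN N)) (S H : EN N → EN N → ℝ) : Prop :=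
  ∀ y ∈ D, ContDiffOn ℝ 2 (fun x => H x y) D ∧
    (∀ x ∈ D, lap (fun x' => H x' y) x = 0) ∧
    ContinuousOn (fun x => H x y) (closure D) ∧
    (∀ x ∈ frontier D, S x y + H x y = 0)

/-- Condition (★) of the paper: with `G = S + H` the Green function of `Ω`, for each `i`,
`∫_{Ω_ε} (f(u_ε) - f(u₀)) ∂G(x,y)/∂x_i dy = o(|x-P|) + o(ε^{N-2}/|x-P|^{N-1})`
(resp. `o(|x-P|) + o(1/(|x-P||log ε|))` for `N = 2`) as `|x-P| → 0`, `|x-P|/ε → ∞`. -/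
def StarCond {N : ℕ} (Ω : Set (EN N)) (P : EN N) (f : ℝ → ℝ)
    (u : ℝ → EN N → ℝ) (u₀ : EN N → ℝ) (H : EN N → EN N → ℝ) : Prop :=
  ∀ i : Fin N, ∀ δ > (0:ℝ), ∃ η > (0:ℝ), ∀ ε ∈ Ioo (0:ℝ) η, ∀ x : EN N,
    ‖x - P‖ ≤ η → ε ≤ η * ‖x - P‖ →
      |∫ y in Ω \ closedBall P ε,
          (f (u ε y) - f (u₀ y)) * pd (fun x' => fundS N x' y + H x' y) i x ∂volume|
        ≤ if N = 2 then δ * (‖x - P‖ + 1 / (‖x - P‖ * |Real.log ε|))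
          else δ * (‖x - P‖ + ε ^ (N - 2) / ‖x - P‖ ^ (N - 1))

/-- `A_ε(x) = ∫_{Ω_ε} (f(u_ε(y)) - f(u₀(y))) G_ε(x,y) dy`, with `G_ε = fundS + H_ε` the
Dirichlet Green function of `Ω_ε`. -/
def Aeps {N : ℕ} (Ω : Set (EN N)) (P : EN N) (f : ℝ → ℝ)
    (u : ℝ → EN N → ℝ) (u₀ : EN N → ℝ) (Heps : ℝ → EN N → EN N → ℝ)
    (ε : ℝ) (x : EN N) : ℝ :=
  ∫ y in Ω \ closedBall P ε,
    (f (u ε y) - f (u₀ y)) * (fundS N x y + Heps ε x y) ∂volume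

/-! ### The Laplacian and the maximum principle -/

lemma iteratedFDeriv_two_eq_of_line {N : ℕ} {f : EN N → ℝ} {x e : EN N} {φ' : ℝ → ℝ} {d : ℝ}
    (hf : ContDiffAt ℝ 2 f x)
    (h1 : ∀ᶠ t in 𝓝 (0:ℝ), HasDerivAt (fun t : ℝ => f (x + t • e)) (φ' t) t)
    (h2 : HasDerivAt φ' d 0) : iteratedFDeriv ℝ 2 f x ![e, e] = d := by
  have hline : ∀ t : ℝ, HasDerivAt (fun t : ℝ => x + t • e) e t := fun t => by
    simpa using ((hasDerivAt_id t).smul_const e).const_add x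
  have hx0 : x + (0:ℝ) • e = x := by simp
  have hcont : Tendsto (fun t : ℝ => x + t • e) (𝓝 0) (𝓝 x) := by
    simpa using (hline 0).continuousAt.tendsto
  have hdiff : ∀ᶠ y in 𝓝 x, DifferentiableAt ℝ f y := by
    filter_upwards [hf.eventually (by simp)] with y hy using hy.differentiableAt (by simp)
  have h3 : φ' =ᶠ[𝓝 0] fun t : ℝ => fderiv ℝ f (x + t • e) e := by
    filter_upwards [h1, hcont.eventually hdiff] with t ht htd
    exact ht.unique (htd.hasFDerivAt.comp_hasDerivAt t (hline t))
  have h4 : HasFDerivAt (fderiv ℝ f) (fderiv ℝ (fderiv ℝ f) x) (x + (0:ℝ) • e) := by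
    rw [hx0]
    exact ((hf.fderiv_right (m := 1) (by norm_num)).differentiableAt (by simp)).hasFDerivAt
  have h5 : HasDerivAt (fun t : ℝ => fderiv ℝ f (x + t • e) e)
      (fderiv ℝ (fderiv ℝ f) x e e) 0 := by
    have := h4.comp_hasDerivAt (0:ℝ) (hline 0)
    simpa using this.clm_apply (hasDerivAt_const (0:ℝ) e)
  rw [iteratedFDeriv_two_apply]
  exact h5.unique (h2.congr_of_eventuallyEq h3.symm)

lemma iteratedFDeriv_two_nonpos_of_isLocalMax {N : ℕ} {f : EN N → ℝ} {x : EN N} (e : EN N)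
    (hf : ContDiffAt ℝ 2 f x) (hmax : IsLocalMax f x) :
    iteratedFDeriv ℝ 2 f x ![e, e] ≤ 0 := by
  have hline : ∀ t : ℝ, HasDerivAt (fun t : ℝ => x + t • e) e t := fun t => by
    simpa using ((hasDerivAt_id t).smul_const e).const_add x
  have hcont : Tendsto (fun t : ℝ => x + t • e) (𝓝 0) (𝓝 x) := by
    simpa using (hline 0).continuousAt.tendsto
  set φ : ℝ → ℝ := fun t => f (x + t • e) with hφ
  have hdiff : ∀ᶠ y in 𝓝 x, DifferentiableAt ℝ f y := by
    filter_upwards [hf.eventually (by simp)] with y hy using hy.differentiableAt (by simp)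
  have hφc : ContDiffAt ℝ 2 φ 0 := by
    have : ContDiffAt ℝ 2 f (x + (0:ℝ) • e) := by simpa using hf
    exact this.comp (0:ℝ) (by fun_prop)
  have h1 : ∀ᶠ t in 𝓝 (0:ℝ), HasDerivAt φ (deriv φ t) t := by
    filter_upwards [hφc.eventually (by simp)] with t ht
    exact (ht.differentiableAt (by simp)).hasDerivAt
  have h2 : HasDerivAt (deriv φ) (deriv (deriv φ) 0) 0 := by
    have : ContDiffAt ℝ 1 (deriv φ) 0 := by
      have h := hφc.fderiv_right (m := 1) (by norm_num)
      have h' : deriv φ = fun t => fderiv ℝ φ t 1 := by ext t; simp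
      rw [h']
      exact h.clm_apply contDiffAt_const
    exact (this.differentiableAt (by simp)).hasDerivAt
  rw [iteratedFDeriv_two_eq_of_line hf h1 h2]
  by_contra! hpos
  have hm : IsLocalMax φ 0 := by
    have : ∀ᶠ t in 𝓝 (0:ℝ), f (x + t • e) ≤ f x := hcont.eventually hmax
    simpa [IsLocalMax, IsMaxFilter, hφ] using this
  have hmin := isLocalMin_of_deriv_deriv_pos hpos hm.deriv_eq_zero hφc.continuousAt
  have hc : φ =ᶠ[𝓝 0] fun _ => φ 0 := by
    filter_upwards [hm, hmin] with t h h' using le_antisymm h h'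
  have : deriv (deriv φ) 0 = 0 := by
    rw [hc.deriv.deriv_eq]; simp
  exact hpos.ne' this

lemma laplacian_eq_sum_single {N : ℕ} (f : EN N → ℝ) (x : EN N) :
    Laplacian.laplacian f x = ∑ i, iteratedFDeriv ℝ 2 f x
      ![EuclideanSpace.single i 1, EuclideanSpace.single i 1] := by
  have := congrFun (InnerProductSpace.laplacian_eq_iteratedFDeriv_orthonormalBasis f
    (EuclideanSpace.basisFun (Fin N) ℝ)) x
  simpa using this

lemma lap_eq_laplacian {N : ℕ} {f : EN N → ℝ} {x : EN N} (hf : ContDiffAt ℝ 2 f x) :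
    lap f x = Laplacian.laplacian f x := by
  rw [laplacian_eq_sum_single]
  refine Finset.sum_congr rfl fun i _ => ?_
  rw [iteratedFDeriv_two_apply]
  have h4 : DifferentiableAt ℝ (fderiv ℝ f) x :=
    (hf.fderiv_right (m := 1) (by norm_num)).differentiableAt (by simp)
  unfold pd2 pd
  rw [fderiv_clm_apply h4 (differentiableAt_const _)]
  simp

lemma laplacian_comp_isometry {N : ℕ} {f : EN N → ℝ} (A : EN N ≃ₗᵢ[ℝ] EN N) (c x : EN N)
    (hf : ContDiffAt ℝ 2 f (A x + c)) :
    ContDiffAt ℝ 2 (fun y => f (A y + c)) x ∧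
    Laplacian.laplacian (fun y => f (A y + c)) x = Laplacian.laplacian f (A x + c) := by
  have hc : ContDiffAt ℝ 2 (fun y => f (A y + c)) x := by
    refine ContDiffAt.comp (g := f) x hf ?_
    exact (A.contDiff.add contDiff_const).contDiffAt
  refine ⟨hc, ?_⟩
  have hb := congrFun (InnerProductSpace.laplacian_eq_iteratedFDeriv_orthonormalBasis f
    ((EuclideanSpace.basisFun (Fin N) ℝ).map A)) (A x + c)
  rw [hb, laplacian_eq_sum_single]
  refine Finset.sum_congr rfl fun i _ => ?_
  set e : EN N := EuclideanSpace.single i 1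
  have he : ((EuclideanSpace.basisFun (Fin N) ℝ).map A) i = A e := by simp [e]
  rw [he]
  set ψ : ℝ → ℝ := fun t => f ((A x + c) + t • A e)
  have hψc : ContDiffAt ℝ 2 ψ 0 := by
    have : ContDiffAt ℝ 2 f (A x + c + (0:ℝ) • A e) := by simpa using hf
    exact this.comp (0:ℝ) (by fun_prop)
  have h1 : ∀ᶠ t in 𝓝 (0:ℝ), HasDerivAt ψ (deriv ψ t) t := by
    filter_upwards [hψc.eventually (by simp)] with t ht
    exact (ht.differentiableAt (by simp)).hasDerivAt
  have h2 : HasDerivAt (deriv ψ) (deriv (deriv ψ) 0) 0 := by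
    have : ContDiffAt ℝ 1 (deriv ψ) 0 := by
      have h := hψc.fderiv_right (m := 1) (by norm_num)
      have h' : deriv ψ = fun t => fderiv ℝ ψ t 1 := by ext t; simp
      rw [h']
      exact h.clm_apply contDiffAt_const
    exact (this.differentiableAt (by simp)).hasDerivAt
  have hψ : ψ = fun t : ℝ => (fun y => f (A y + c)) (x + t • e) := by
    ext t; simp only [ψ, map_add, map_smul]; congr 1; abel
  rw [iteratedFDeriv_two_eq_of_line hf h1 h2]
  exact iteratedFDeriv_two_eq_of_line hc (φ' := deriv ψ) (by rw [hψ] at h1 ⊢; exact h1) h2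

/-- `(a + c ⟨x - P, τ⟩) F(|x - P|²)`: a family containing all the barriers below. -/
def barrier {N : ℕ} (P τ : EN N) (a c : ℝ) (F : ℝ → ℝ) (x : EN N) : ℝ :=
  (a + c * inner ℝ (x - P) τ) * F (‖x - P‖ ^ 2)

lemma barrier_contDiffAt {N : ℕ} {P τ : EN N} {a c : ℝ} {F : ℝ → ℝ} {x : EN N}
    (hF : ContDiffAt ℝ 2 F (‖x - P‖ ^ 2)) : ContDiffAt ℝ 2 (barrier P τ a c F) x := by
  unfold barrier
  refine ContDiffAt.mul ?_ ?_
  · exact contDiffAt_const.add (contDiffAt_const.mul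
      ((contDiffAt_id.sub contDiffAt_const).inner ℝ contDiffAt_const))
  · exact ContDiffAt.comp (g := F) x hF
      ((contDiffAt_id.sub contDiffAt_const).norm_sq ℝ)

lemma barrier_laplacian {N : ℕ} {P τ : EN N} {a c : ℝ} {F F' : ℝ → ℝ} {F'' : ℝ} {x : EN N}
    (hF : ContDiffAt ℝ 2 F (‖x - P‖ ^ 2))
    (h1 : ∀ᶠ q in 𝓝 (‖x - P‖ ^ 2), HasDerivAt F (F' q) q)
    (h2 : HasDerivAt F' F'' (‖x - P‖ ^ 2)) :
    Laplacian.laplacian (barrier P τ a c F) x =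
      4 * c * inner ℝ (x - P) τ * F' (‖x - P‖ ^ 2) + (a + c * inner ℝ (x - P) τ) *
        (4 * F'' * ‖x - P‖ ^ 2 + 2 * N * F' (‖x - P‖ ^ 2)) := by
  rw [laplacian_eq_sum_single]
  set z := x - P with hz
  have key : ∀ i : Fin N, iteratedFDeriv ℝ 2 (barrier P τ a c F) x
      ![EuclideanSpace.single i 1, EuclideanSpace.single i 1] =
      4 * c * (z i * τ i) * F' (‖z‖ ^ 2) + (a + c * inner ℝ z τ) *
        (4 * F'' * z i ^ 2 + 2 * F' (‖z‖ ^ 2)) := by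
    intro i
    set e : EN N := EuclideanSpace.single i 1 with he
    have hq : ∀ t : ℝ, ‖x + t • e - P‖ ^ 2 = ‖z‖ ^ 2 + 2 * z i * t + t ^ 2 := by
      intro t
      have : x + t • e - P = z + t • e := by rw [hz]; abel
      rw [this, norm_add_sq_real, inner_smul_right, norm_smul, he]
      simp [EuclideanSpace.inner_single_right]
      ring
    have hl : ∀ t : ℝ, inner ℝ (x + t • e - P) τ = inner ℝ z τ + t * τ i := by
      intro t
      have : x + t • e - P = z + t • e := by rw [hz]; abel
      rw [this, inner_add_left, inner_smul_left, he]
      simp [EuclideanSpace.inner_single_left]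
    have hQd : ∀ t : ℝ, HasDerivAt (fun t : ℝ => ‖z‖ ^ 2 + 2 * z i * t + t ^ 2)
        (2 * z i + 2 * t) t := by
      intro t
      have := (((hasDerivAt_id t).const_mul (2 * z i)).const_add (‖z‖ ^ 2)).add
        (hasDerivAt_pow 2 t)
      exact this.congr_deriv (by simp)
    have hLd : ∀ t : ℝ, HasDerivAt (fun t : ℝ => a + c * (inner ℝ z τ + t * τ i))
        (c * τ i) t := by
      intro t
      have := ((((hasDerivAt_id t).mul_const (τ i)).const_add (inner ℝ z τ)).const_mul c).const_add a
      simpa using this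
    have hQ0 : Tendsto (fun t : ℝ => ‖z‖ ^ 2 + 2 * z i * t + t ^ 2) (𝓝 0) (𝓝 (‖z‖ ^ 2)) := by
      have := (hQd 0).continuousAt.tendsto
      simpa using this
    set φ' : ℝ → ℝ := fun t => c * τ i * F (‖z‖ ^ 2 + 2 * z i * t + t ^ 2) +
      (a + c * (inner ℝ z τ + t * τ i)) *
        (F' (‖z‖ ^ 2 + 2 * z i * t + t ^ 2) * (2 * z i + 2 * t)) with hφ'
    refine iteratedFDeriv_two_eq_of_line (φ' := φ') (barrier_contDiffAt hF) ?_ ?_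
    · filter_upwards [hQ0.eventually h1] with t ht
      have := (hLd t).mul (HasDerivAt.comp t ht (hQd t))
      refine this.congr_of_eventuallyEq (Eventually.of_forall fun s => ?_)
      simp [barrier, hq, hl]
    · have h10 : HasDerivAt F (F' (‖z‖ ^ 2)) (‖z‖ ^ 2 + 2 * z i * 0 + 0 ^ 2) := by
        simpa using h1.self_of_nhds
      have h20 : HasDerivAt F' F'' (‖z‖ ^ 2 + 2 * z i * 0 + 0 ^ 2) := by
        simpa using h2
      have hd1 := (HasDerivAt.comp (0:ℝ) h10 (hQd 0)).const_mul (c * τ i)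
      have hlin : HasDerivAt (fun t : ℝ => 2 * z i + 2 * t) 2 0 := by
        simpa using ((hasDerivAt_id (0:ℝ)).const_mul 2).const_add (2 * z i)
      have hd2 := (hLd 0).mul ((HasDerivAt.comp (0:ℝ) h20 (hQd 0)).mul hlin)
      refine (hd1.add hd2).congr_deriv ?_
      simp only [mul_zero, add_zero, zero_mul, zero_pow, ne_eq, OfNat.ofNat_ne_zero,
        not_false_eq_true, Function.comp_apply, Pi.mul_apply]
      ring
  rw [Finset.sum_congr rfl fun i _ => key i, Finset.sum_add_distrib]
  have hin : (inner ℝ z τ : ℝ) = ∑ i, z i * τ i := by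
    rw [PiLp.inner_apply]; refine Finset.sum_congr rfl fun i _ => ?_
    simp [mul_comm]
  have hn : ‖z‖ ^ 2 = ∑ i, z i ^ 2 := EuclideanSpace.real_norm_sq_eq z
  have e1 : ∑ i, 4 * c * (z i * τ i) * F' (‖z‖ ^ 2) = 4 * c * inner ℝ z τ * F' (‖z‖ ^ 2) := by
    rw [hin, Finset.mul_sum, Finset.sum_mul]
  have e2 : ∑ i, (a + c * inner ℝ z τ) * (4 * F'' * z i ^ 2 + 2 * F' (‖z‖ ^ 2)) =
      (a + c * inner ℝ z τ) * (4 * F'' * ‖z‖ ^ 2 + 2 * N * F' (‖z‖ ^ 2)) := by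
    rw [← Finset.mul_sum, Finset.sum_add_distrib, ← Finset.mul_sum, ← hn]
    simp
    ring_nf
    simp
  rw [e1, e2]

/-- Weak maximum principle. -/
lemma le_of_laplacian_le {N : ℕ} (hN : 0 < N) {K U : Set (EN N)} {k B : EN N → ℝ}
    (hK : IsCompact K) (hU : IsOpen U) (hUK : U ⊆ K)
    (hk : ∀ x ∈ U, ContDiffAt ℝ 2 k x ∧ Laplacian.laplacian k x = 0)
    (hB : ∀ x ∈ U, ContDiffAt ℝ 2 B x ∧ Laplacian.laplacian B x ≤ 0)
    (hkc : ContinuousOn k K) (hBc : ContinuousOn B K) (hb : ∀ x ∈ K \ U, k x ≤ B x) :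
    ∀ x ∈ K, k x ≤ B x := by
  obtain ⟨R, hR⟩ := hK.isBounded.exists_norm_le
  have main : ∀ δ > (0:ℝ), ∀ x ∈ K, k x - B x + δ * ‖x‖ ^ 2 ≤ δ * R ^ 2 := by
    intro δ hδ x hx
    set w : EN N → ℝ := (k - B) + δ • barrier 0 0 1 0 id with hw
    have hwx : ∀ y, w y = k y - B y + δ * ‖y‖ ^ 2 := by intro y; simp [hw, barrier]
    have hwc : ContinuousOn w K := by
      have : ContinuousOn (fun y => k y - B y + δ * ‖y‖ ^ 2) K := by fun_prop
      exact this.congr fun y _ => hwx y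
    obtain ⟨m, hmK, hm⟩ := hK.exists_isMaxOn ⟨x, hx⟩ hwc
    have hmU : m ∉ U := by
      intro hmU
      have hbc : ContDiffAt ℝ 2 (barrier (0 : EN N) 0 1 0 id) m :=
        barrier_contDiffAt contDiffAt_id
      have hbl : Laplacian.laplacian (barrier (0 : EN N) 0 1 0 id) m = 2 * N := by
        rw [barrier_laplacian (F' := fun _ => 1) (F'' := 0) contDiffAt_id
          (Eventually.of_forall fun q => hasDerivAt_id q) (hasDerivAt_const _ _)]
        simp
      have hwC : ContDiffAt ℝ 2 w m := ((hk m hmU).1.sub (hB m hmU).1).add (hbc.const_smul δ)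
      have hwl : Laplacian.laplacian w m =
          Laplacian.laplacian k m - Laplacian.laplacian B m + δ * (2 * N) := by
        have e1 := ContDiffAt.laplacian_add (f₁ := k - B)
          (f₂ := δ • barrier (0 : EN N) 0 1 0 id) ((hk m hmU).1.sub (hB m hmU).1)
          (hbc.const_smul δ)
        have e2 := ContDiffAt.laplacian_sub (hk m hmU).1 (hB m hmU).1
        have e3 := InnerProductSpace.laplacian_smul δ hbc
        rw [hw, e1, e2, e3, hbl, smul_eq_mul]
      have hloc : IsLocalMax w m :=
        (hm.filter_mono (le_principal_iff.2 (mem_of_superset (hU.mem_nhds hmU) hUK)) :)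
      have hle : Laplacian.laplacian w m ≤ 0 := by
        rw [laplacian_eq_sum_single]
        exact Finset.sum_nonpos fun i _ => iteratedFDeriv_two_nonpos_of_isLocalMax _ hwC hloc
      have h1 := (hk m hmU).2
      have h2 := (hB m hmU).2
      have : (0:ℝ) < N := by exact_mod_cast hN
      have : 0 < δ * (2 * N) := by positivity
      linarith
    have h1 := hm hx
    simp only [mem_ofPred_eq, hwx] at h1
    have h2 := hb m ⟨hmK, hmU⟩
    have h3 : δ * ‖m‖ ^ 2 ≤ δ * R ^ 2 := by
      have := hR m hmK
      gcongr
    linarith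
  intro x hx
  by_contra! hlt
  have hpos : 0 < k x - B x := by linarith
  have hR1 : 0 < R ^ 2 + 1 := by positivity
  have := main ((k x - B x) / (2 * (R ^ 2 + 1))) (by positivity) x hx
  have h2 : (k x - B x) / (2 * (R ^ 2 + 1)) * R ^ 2 ≤ (k x - B x) / 2 := by
    rw [div_mul_eq_mul_div, div_le_div_iff₀ (by positivity) (by norm_num)]
    nlinarith
  have h3 : 0 ≤ (k x - B x) / (2 * (R ^ 2 + 1)) * ‖x‖ ^ 2 := by positivity
  linarith

/-! ### Interior and annular estimates for harmonic functions -/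

/-- `k` is of class `C²` and harmonic at each point of `U`. -/
def IsHarm {N : ℕ} (k : EN N → ℝ) (U : Set (EN N)) : Prop :=
  ∀ x ∈ U, ContDiffAt ℝ 2 k x ∧ Laplacian.laplacian k x = 0

lemma IsHarm.mono {N : ℕ} {k : EN N → ℝ} {U V : Set (EN N)} (h : IsHarm k U) (hV : V ⊆ U) :
    IsHarm k V := fun x hx => h x (hV hx)

lemma IsHarm.continuousOn {N : ℕ} {k : EN N → ℝ} {U : Set (EN N)} (h : IsHarm k U) :
    ContinuousOn k U := fun x hx => (h x hx).1.continuousAt.continuousWithinAt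

lemma IsHarm.add {N : ℕ} {k l : EN N → ℝ} {U : Set (EN N)} (h : IsHarm k U) (h' : IsHarm l U) :
    IsHarm (fun x => k x + l x) U := fun x hx => by
  refine ⟨(h x hx).1.add (h' x hx).1, ?_⟩
  have := ContDiffAt.laplacian_add (h x hx).1 (h' x hx).1
  rw [(h x hx).2, (h' x hx).2, add_zero] at this
  exact this

lemma IsHarm.neg {N : ℕ} {k : EN N → ℝ} {U : Set (EN N)} (h : IsHarm k U) :
    IsHarm (fun x => -k x) U := fun x hx => by
  refine ⟨(h x hx).1.neg, ?_⟩
  have := congrFun (InnerProductSpace.laplacian_neg (f := k)) x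
  rw [Pi.neg_apply, (h x hx).2, neg_zero] at this
  exact this

lemma IsHarm.sub {N : ℕ} {k l : EN N → ℝ} {U : Set (EN N)} (h : IsHarm k U) (h' : IsHarm l U) :
    IsHarm (fun x => k x - l x) U := by
  simpa only [sub_eq_add_neg] using h.add h'.neg

lemma isHarm_const {N : ℕ} (c : ℝ) (U : Set (EN N)) : IsHarm (fun _ => c) U := fun x _ =>
  ⟨contDiffAt_const, by simp⟩

lemma IsHarm.const_mul {N : ℕ} {k : EN N → ℝ} {U : Set (EN N)} (h : IsHarm k U) (c : ℝ) :
    IsHarm (fun x => c * k x) U := fun x hx => by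
  refine ⟨contDiffAt_const.mul (h x hx).1, ?_⟩
  have := InnerProductSpace.laplacian_smul c (h x hx).1
  rw [(h x hx).2, smul_zero] at this
  exact this

lemma IsHarm.comp_isometry {N : ℕ} {k : EN N → ℝ} {U V : Set (EN N)} (h : IsHarm k U)
    (A : EN N ≃ₗᵢ[ℝ] EN N) (c : EN N) (hV : ∀ x ∈ V, A x + c ∈ U) :
    IsHarm (fun x => k (A x + c)) V := fun x hx => by
  have := laplacian_comp_isometry A c x (h _ (hV x hx)).1
  exact ⟨this.1, by rw [this.2, (h _ (hV x hx)).2]⟩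

lemma quadratic_laplacian {N : ℕ} (P τ : EN N) (c₁ c₂ : ℝ) (x : EN N) :
    ContDiffAt ℝ 2 (fun z : EN N =>
      ‖z - P‖ ^ 2 + c₁ * inner ℝ (z - P) τ + c₂ * (inner ℝ (z - P) τ) ^ 2) x ∧
    Laplacian.laplacian (fun z : EN N =>
      ‖z - P‖ ^ 2 + c₁ * inner ℝ (z - P) τ + c₂ * (inner ℝ (z - P) τ) ^ 2) x =
      2 * N + 2 * c₂ * ‖τ‖ ^ 2 := by
  have hi : ContDiffAt ℝ 2 (fun z : EN N => (inner ℝ (z - P) τ : ℝ)) x :=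
    (contDiffAt_id.sub contDiffAt_const).inner ℝ contDiffAt_const
  have hC : ContDiffAt ℝ 2 (fun z : EN N =>
      ‖z - P‖ ^ 2 + c₁ * inner ℝ (z - P) τ + c₂ * (inner ℝ (z - P) τ) ^ 2) x :=
    (((contDiffAt_id.sub contDiffAt_const).norm_sq ℝ).add (contDiffAt_const.mul hi)).add
      (contDiffAt_const.mul (hi.pow 2))
  refine ⟨hC, ?_⟩
  rw [laplacian_eq_sum_single]
  set z := x - P with hz
  have key : ∀ i : Fin N, iteratedFDeriv ℝ 2 (fun z : EN N =>
      ‖z - P‖ ^ 2 + c₁ * inner ℝ (z - P) τ + c₂ * (inner ℝ (z - P) τ) ^ 2) x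
      ![EuclideanSpace.single i 1, EuclideanSpace.single i 1] = 2 + 2 * c₂ * (τ i) ^ 2 := by
    intro i
    set e : EN N := EuclideanSpace.single i 1 with he
    have hq : ∀ t : ℝ, ‖x + t • e - P‖ ^ 2 = ‖z‖ ^ 2 + 2 * z i * t + t ^ 2 := by
      intro t
      have : x + t • e - P = z + t • e := by rw [hz]; abel
      rw [this, norm_add_sq_real, inner_smul_right, norm_smul, he]
      simp [EuclideanSpace.inner_single_right]
      ring
    have hl : ∀ t : ℝ, inner ℝ (x + t • e - P) τ = inner ℝ z τ + t * τ i := by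
      intro t
      have : x + t • e - P = z + t • e := by rw [hz]; abel
      rw [this, inner_add_left, inner_smul_left, he]
      simp [EuclideanSpace.inner_single_left]
    refine iteratedFDeriv_two_eq_of_line (φ' := fun t => 2 * z i + 2 * t + c₁ * τ i +
      2 * c₂ * τ i * (inner ℝ z τ + t * τ i)) hC ?_ ?_
    · refine Eventually.of_forall fun t => ?_
      simp only [hq, hl]
      have h1 := (((hasDerivAt_id t).const_mul (2 * z i)).const_add (‖z‖ ^ 2)).add
        (hasDerivAt_pow 2 t)
      have h2 := ((hasDerivAt_id t).mul_const (τ i)).const_add (inner ℝ z τ)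
      refine ((h1.add (h2.const_mul c₁)).add ((h2.pow 2).const_mul c₂)).congr_deriv ?_
      simp
      ring
    · have h2 := ((hasDerivAt_id (0:ℝ)).mul_const (τ i)).const_add (inner ℝ z τ)
      have h1 := ((((hasDerivAt_id (0:ℝ)).const_mul 2).const_add (2 * z i)).add_const
        (c₁ * τ i)).add (h2.const_mul (2 * c₂ * τ i))
      refine h1.congr_deriv ?_
      simp
      ring
  rw [Finset.sum_congr rfl fun i _ => key i, Finset.sum_add_distrib, ← Finset.mul_sum,
    ← EuclideanSpace.real_norm_sq_eq τ]
  simp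
  ring

lemma reflection_eq {N : ℕ} (v z : EN N) (hv : v ≠ 0) :
    Submodule.reflection (Submodule.span ℝ {v})ᗮ z =
      z - (2 * (inner ℝ z (‖v‖⁻¹ • v) : ℝ)) • (‖v‖⁻¹ • v) := by
  have hn : ‖v‖ ≠ 0 := norm_ne_zero_iff.2 hv
  rw [Submodule.reflection_orthogonal_apply, Submodule.reflection_apply,
    Submodule.starProjection_singleton]
  rw [inner_smul_right, real_inner_comm v z]
  simp only [RCLike.ofReal_real_eq_id, id]
  rw [neg_sub, smul_smul]
  congr 1
  rw [← smul_assoc]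
  congr 1
  simp
  field_simp

/-- Interior Lipschitz estimate, by reflection and the maximum principle. -/
lemma two_point {N : ℕ} (hN : 0 < N) {k : EN N → ℝ} {z₀ v : EN N} {r σ : ℝ} (hr : 0 < r)
    (hk : IsHarm k (closedBall z₀ r)) (hσ : ∀ z ∈ closedBall z₀ r, |k z| ≤ σ) (hv : ‖v‖ ≤ r) :
    k (z₀ + v) - k (z₀ - v) ≤ 2 * N * σ * ‖v‖ / r := by
  have hσ0 : 0 ≤ σ := (abs_nonneg _).trans (hσ z₀ (mem_closedBall_self hr.le))
  rcases eq_or_ne v 0 with rfl | hv0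
  · simp
  have hvn : 0 < ‖v‖ := norm_pos_iff.2 hv0
  set τ : EN N := ‖v‖⁻¹ • v with hτ
  have hτ1 : ‖τ‖ = 1 := by rw [hτ, norm_smul]; simp [hvn.ne']
  set R := Submodule.reflection (Submodule.span ℝ {v})ᗮ with hR
  set c : EN N := z₀ - R z₀ with hc
  have hRz : ∀ z, R z + c = z - (2 * (inner ℝ (z - z₀) τ : ℝ)) • τ := by
    intro z
    have h1 : R z + c = R (z - z₀) + z₀ := by rw [hc, map_sub]; abel
    rw [h1, hR, reflection_eq v _ hv0]; abel
  have hRn : ∀ z, ‖R z + c - z₀‖ = ‖z - z₀‖ := by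
    intro z
    have h1 : R z + c - z₀ = R (z - z₀) := by rw [hc, map_sub]; abel
    rw [h1, LinearIsometryEquiv.norm_map]
  have hRK : ∀ z ∈ closedBall z₀ r, R z + c ∈ closedBall z₀ r := by
    intro z hz
    rw [mem_closedBall, dist_eq_norm] at hz ⊢
    rw [hRn]; exact hz
  set K : Set (EN N) := closedBall z₀ r ∩ {z | 0 ≤ (inner ℝ (z - z₀) τ : ℝ)} with hKdef
  set U : Set (EN N) := ball z₀ r ∩ {z | 0 < (inner ℝ (z - z₀) τ : ℝ)} with hUdef
  have hinc : Continuous fun z : EN N => (inner ℝ (z - z₀) τ : ℝ) := by fun_prop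
  have hUK : U ⊆ K := fun z hz => ⟨ball_subset_closedBall hz.1,
    show (0:ℝ) ≤ inner ℝ (z - z₀) τ from le_of_lt hz.2⟩
  have hKc : IsCompact K :=
    (isCompact_closedBall z₀ r).inter_right (isClosed_le continuous_const hinc)
  have hUo : IsOpen U := isOpen_ball.inter (isOpen_lt continuous_const hinc)
  have hq : IsHarm (fun z => k z - k (R z + c)) (closedBall z₀ r) :=
    hk.sub (hk.comp_isometry R c hRK)
  set Q : EN N → ℝ := fun z => ‖z - z₀‖ ^ 2 + (N * r) * inner ℝ (z - z₀) τ +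
    (-(N:ℝ)) * (inner ℝ (z - z₀) τ) ^ 2 with hQ
  have hQl := quadratic_laplacian z₀ τ (N * r) (-(N:ℝ))
  have hmain := le_of_laplacian_le hN (B := fun z => 2 * σ / r ^ 2 * Q z) hKc hUo hUK
    (hq.mono (hUK.trans inter_subset_left)) ?_
    (hq.continuousOn.mono inter_subset_left) ?_ ?_ (z₀ + v) ?_
  · have e1 : R (z₀ + v) + c = z₀ - v := by
      rw [hRz, add_sub_cancel_left, hτ, inner_smul_right, real_inner_self_eq_norm_sq, smul_smul]
      have : 2 * (‖v‖⁻¹ * ‖v‖ ^ 2) * ‖v‖⁻¹ = 2 := by field_simp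
      rw [this, two_smul]; abel
    have e2 : (inner ℝ v τ : ℝ) = ‖v‖ := by
      rw [hτ, inner_smul_right, real_inner_self_eq_norm_sq]; field_simp
    simp only [hQ, add_sub_cancel_left, e1, e2] at hmain
    refine hmain.trans ?_
    rw [div_mul_eq_mul_div, div_le_div_iff₀ (by positivity) hr]
    have hN1 : (1:ℝ) ≤ N := by exact_mod_cast hN
    have h5 : ‖v‖ ^ 2 + N * r * ‖v‖ + -(N:ℝ) * ‖v‖ ^ 2 ≤ N * r * ‖v‖ := by nlinarith [sq_nonneg ‖v‖]
    have := mul_le_mul_of_nonneg_left h5 (show 0 ≤ 2 * σ * r by positivity)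
    nlinarith
  · intro x _
    refine ⟨contDiffAt_const.mul (hQl x).1, ?_⟩
    have h1 := InnerProductSpace.laplacian_smul (2 * σ / r ^ 2) (hQl x).1
    have h2 : Laplacian.laplacian (fun z => 2 * σ / r ^ 2 * Q z : EN N → ℝ) x =
        2 * σ / r ^ 2 * (2 * N + 2 * (-(N:ℝ)) * ‖τ‖ ^ 2) := by
      rw [← (hQl x).2]; exact h1
    rw [h2, hτ1]; simp
  · have : Continuous (fun z => 2 * σ / r ^ 2 * Q z) := by
      simp only [hQ]; fun_prop
    exact this.continuousOn
  · rintro z ⟨⟨hzb, hz0⟩, hzU⟩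
    rcases eq_or_lt_of_le (show (0:ℝ) ≤ inner ℝ (z - z₀) τ from hz0) with h0 | h0
    · have : R z + c = z := by rw [hRz, ← h0]; simp
      have hσ0 : 0 ≤ σ := (abs_nonneg _).trans (hσ z hzb)
      simp only [this, sub_self, hQ, ← h0, mul_zero, add_zero, ne_eq, OfNat.ofNat_ne_zero,
        not_false_eq_true, zero_pow]
      positivity
    · have hzr : ‖z - z₀‖ = r := by
        by_contra hne
        refine hzU ⟨?_, h0⟩
        rw [mem_ball, dist_eq_norm]
        rw [mem_closedBall, dist_eq_norm] at hzb
        exact lt_of_le_of_ne hzb hne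
      have hle : (inner ℝ (z - z₀) τ : ℝ) ≤ r := by
        have := real_inner_le_norm (z - z₀) τ
        rwa [hzr, hτ1, mul_one] at this
      have h1 : k z - k (R z + c) ≤ 2 * σ := by
        have a1 := abs_le.1 (hσ z hzb)
        have a2 := abs_le.1 (hσ _ (hRK z hzb))
        linarith
      refine h1.trans ?_
      simp only [hQ, hzr]
      rw [div_mul_eq_mul_div, le_div_iff₀ (by positivity)]
      have h5 : r ^ 2 ≤ r ^ 2 + N * r * inner ℝ (z - z₀) τ +
          -(N:ℝ) * (inner ℝ (z - z₀) τ) ^ 2 := by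
        have : 0 ≤ (N:ℝ) * (inner ℝ (z - z₀) τ * (r - inner ℝ (z - z₀) τ)) := by
          have : 0 ≤ r - (inner ℝ (z - z₀) τ : ℝ) := by linarith
          positivity
        nlinarith
      exact mul_le_mul_of_nonneg_left h5 (by positivity)
  · refine ⟨?_, ?_⟩
    · rw [mem_closedBall, dist_eq_norm]; simpa using hv
    · change (0:ℝ) ≤ inner ℝ (z₀ + v - z₀) τ
      rw [add_sub_cancel_left, hτ, inner_smul_right, real_inner_self_eq_norm_sq]; positivity

lemma lipschitz_of_isHarm {N : ℕ} (hN : 0 < N) {k : EN N → ℝ} {x x' : EN N} {r σ : ℝ}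
    (hr : 0 < r) (hk : IsHarm k (closedBall (midpoint ℝ x x') r))
    (hσ : ∀ z ∈ closedBall (midpoint ℝ x x') r, |k z| ≤ σ) (hx : ‖x - x'‖ ≤ 2 * r) :
    k x - k x' ≤ N * σ * ‖x - x'‖ / r := by
  have h := two_point hN (v := (1 / 2 : ℝ) • (x - x')) hr hk hσ
    (by rw [norm_smul]; norm_num; linarith)
  have e1 : midpoint ℝ x x' + (1 / 2 : ℝ) • (x - x') = x := by
    rw [midpoint_eq_smul_add]; norm_num; module
  have e2 : midpoint ℝ x x' - (1 / 2 : ℝ) • (x - x') = x' := by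
    rw [midpoint_eq_smul_add]; norm_num; module
  rw [e1, e2, norm_smul] at h
  refine h.trans (le_of_eq ?_)
  norm_num
  ring

lemma sphere_lipschitz {N : ℕ} (hN : 0 < N) {k : EN N → ℝ} {z z' : EN N} {a κ : ℝ} (ha : 0 < a)
    (hk : IsHarm k {z | a / 2 ≤ ‖z‖ ∧ ‖z‖ ≤ 2 * a})
    (hκ : ∀ z, a / 2 ≤ ‖z‖ → ‖z‖ ≤ 2 * a → |k z| ≤ κ) (hz : ‖z‖ = a) (hz' : ‖z'‖ = a) :
    k z - k z' ≤ 4 * N * κ * ‖z - z'‖ / a := by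
  have b1 := abs_le.1 (hκ z (by linarith) (by linarith))
  have b2 := abs_le.1 (hκ z' (by linarith) (by linarith))
  have hκ0 : 0 ≤ κ := by linarith
  have hN1 : (1:ℝ) ≤ N := by exact_mod_cast hN
  rcases le_or_gt ‖z - z'‖ (a / 2) with h | h
  · have hm : ∀ w ∈ closedBall (midpoint ℝ z z') (a / 4), a / 2 ≤ ‖w‖ ∧ ‖w‖ ≤ 2 * a := by
      intro w hw
      rw [mem_closedBall, dist_eq_norm] at hw
      have e : z - midpoint ℝ z z' = (1 / 2 : ℝ) • (z - z') := by
        rw [midpoint_eq_smul_add]; norm_num; module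
      have h1 : ‖z - midpoint ℝ z z'‖ ≤ a / 4 := by
        rw [e, norm_smul]; norm_num; linarith
      have h2 : ‖z - w‖ ≤ a / 2 := by
        have : z - w = (z - midpoint ℝ z z') - (w - midpoint ℝ z z') := by abel
        rw [this]
        refine (norm_sub_le _ _).trans (by linarith)
      have h3 := abs_le.1 (abs_norm_sub_norm_le z w)
      constructor <;> linarith
    have := lipschitz_of_isHarm hN (σ := κ) (show 0 < a / 4 by positivity) (hk.mono hm)
      (fun w hw => hκ w (hm w hw).1 (hm w hw).2) (by linarith)
    refine this.trans (le_of_eq ?_)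
    field_simp
  · have h1 : k z - k z' ≤ 2 * κ := by linarith
    refine h1.trans ?_
    rw [le_div_iff₀ ha]
    have : κ * (a / 2) ≤ κ * ‖z - z'‖ := by gcongr
    have h3 : κ * ‖z - z'‖ ≤ N * (κ * ‖z - z'‖) := le_mul_of_one_le_left (by positivity) hN1
    nlinarith

/-- Oscillation on spheres of a harmonic function in an annulus. -/
lemma sphere_osc {N : ℕ} (hN : 0 < N) {k : EN N → ℝ} {a b κ σ ρ : ℝ} (ha : 0 < a)
    (hk : IsHarm k {z | a / 2 ≤ ‖z‖ ∧ ‖z‖ ≤ 2 * b})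
    (hκ : ∀ z, a / 2 ≤ ‖z‖ → ‖z‖ ≤ 2 * a → |k z| ≤ κ)
    (hσ : ∀ z, b / 2 ≤ ‖z‖ → ‖z‖ ≤ 2 * b → |k z| ≤ σ) (haρ : a ≤ ρ) (hρb : ρ ≤ b)
    {x x' : EN N} (hx : ‖x‖ = ρ) (hx' : ‖x'‖ = ρ) :
    k x - k x' ≤ 8 * N * (σ * ρ / b + κ * (a / ρ) ^ (N - 1)) := by
  have hρ : 0 < ρ := ha.trans_le haρ
  have hb : 0 < b := hρ.trans_le hρb
  have hex : ∀ r : ℝ, ‖(r / ρ) • x‖ = |r| := by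
    intro r; rw [norm_smul, hx, Real.norm_eq_abs, abs_div, abs_of_pos hρ]; field_simp
  have hκ0 : 0 ≤ κ := by
    have h := hex a
    rw [abs_of_pos ha] at h
    exact (abs_nonneg _).trans (hκ ((a / ρ) • x) (by linarith) (by linarith))
  have hσ0 : 0 ≤ σ := by
    have h := hex b
    rw [abs_of_pos hb] at h
    exact (abs_nonneg _).trans (hσ ((b / ρ) • x) (by linarith) (by linarith))
  rcases eq_or_ne x x' with rfl | hne
  · simp; positivity
  set v := x - x' with hv
  have hv0 : v ≠ 0 := sub_ne_zero.2 hne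
  have hvn : 0 < ‖v‖ := norm_pos_iff.2 hv0
  set τ : EN N := ‖v‖⁻¹ • v with hτ
  have hτ1 : ‖τ‖ = 1 := by rw [hτ, norm_smul]; simp [hvn.ne']
  set R := Submodule.reflection (Submodule.span ℝ {v})ᗮ with hR
  have hRz : ∀ z, R z = z - (2 * (inner ℝ z τ : ℝ)) • τ := fun z => reflection_eq v z hv0
  have hRn : ∀ z, ‖R z‖ = ‖z‖ := fun z => R.norm_map z
  have hRd : ∀ z, 0 ≤ (inner ℝ z τ : ℝ) → ‖z - R z‖ = 2 * inner ℝ z τ := by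
    intro z hz
    rw [hRz, sub_sub_cancel, norm_smul, hτ1, mul_one, Real.norm_eq_abs, abs_of_nonneg]
    positivity
  have hRx : R x = x' := Submodule.reflection_sub (by rw [hx, hx'])
  have hin : Continuous fun z : EN N => (inner ℝ z τ : ℝ) := by fun_prop
  set A : Set (EN N) := {z | a / 2 ≤ ‖z‖ ∧ ‖z‖ ≤ 2 * b} with hA
  set K : Set (EN N) := closedBall 0 b ∩ ({z | a ≤ ‖z‖} ∩ {z | 0 ≤ (inner ℝ z τ : ℝ)}) with hKdef
  set U : Set (EN N) := ball 0 b ∩ ({z | a < ‖z‖} ∩ {z | 0 < (inner ℝ z τ : ℝ)}) with hUdef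
  have hUK : U ⊆ K := fun z hz => ⟨ball_subset_closedBall hz.1,
    show a ≤ ‖z‖ from le_of_lt hz.2.1, show (0:ℝ) ≤ inner ℝ z τ from le_of_lt hz.2.2⟩
  have hKA : K ⊆ A := by
    rintro z ⟨h1, h2, -⟩
    rw [mem_closedBall_zero_iff] at h1
    replace h2 : a ≤ ‖z‖ := h2
    exact ⟨by linarith, by linarith⟩
  have hq : IsHarm (fun z => k z - k (R z + 0)) A :=
    hk.sub (hk.comp_isometry R 0 fun z hz => by
      simp only [hA, mem_ofPred_eq, add_zero, hRn]; exact hz)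
  simp only [add_zero] at hq
  set F : ℝ → ℝ := fun q => q ^ (-(N:ℝ) / 2) with hF
  have hFe : ∀ z : EN N, F (‖z‖ ^ 2) = (‖z‖ ^ N)⁻¹ := by
    intro z
    simp only [hF]
    rw [← Real.rpow_natCast ‖z‖ 2, ← Real.rpow_mul (norm_nonneg z),
      ← Real.rpow_natCast ‖z‖ N, ← Real.rpow_neg (norm_nonneg z)]
    congr 1; push_cast; ring
  set B : EN N → ℝ := fun z => barrier 0 τ 0 (8 * N * σ / b) (fun _ => 1) z +
    barrier 0 τ 0 (8 * N * κ * a ^ (N - 1)) F z with hB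
  have hBe : ∀ z, B z = inner ℝ z τ * (8 * N * (σ / b + κ * a ^ (N - 1) * (‖z‖ ^ N)⁻¹)) := by
    intro z; simp only [hB, barrier, sub_zero, zero_add, hFe]; ring
  have hharm : ∀ z ∈ A, ContDiffAt ℝ 2 B z ∧ Laplacian.laplacian B z = 0 := by
    intro z hz
    have hz0 : 0 < ‖z‖ := by have := hz.1; linarith
    have hz2 : 0 < ‖z - 0‖ ^ 2 := by rw [sub_zero]; positivity
    have c1 : ContDiffAt ℝ 2 (barrier 0 τ 0 (8 * N * σ / b) (fun _ => 1)) z :=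
      barrier_contDiffAt contDiffAt_const
    have l1 : Laplacian.laplacian (barrier 0 τ 0 (8 * N * σ / b) (fun _ => 1)) z = 0 := by
      rw [barrier_laplacian (F' := fun _ => 0) (F'' := 0) contDiffAt_const
        (Eventually.of_forall fun q => hasDerivAt_const _ _) (hasDerivAt_const _ _)]
      simp
    have hFc : ContDiffAt ℝ 2 F (‖z - 0‖ ^ 2) := Real.contDiffAt_rpow_const_of_ne hz2.ne'
    have c2 : ContDiffAt ℝ 2 (barrier 0 τ 0 (8 * N * κ * a ^ (N - 1)) F) z :=
      barrier_contDiffAt hFc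
    have l2 : Laplacian.laplacian (barrier 0 τ 0 (8 * N * κ * a ^ (N - 1)) F) z = 0 := by
      rw [barrier_laplacian (F' := fun q => (-(N:ℝ) / 2) * q ^ (-(N:ℝ) / 2 - 1))
        (F'' := (-(N:ℝ) / 2) * ((-(N:ℝ) / 2 - 1) * (‖z - 0‖ ^ 2) ^ (-(N:ℝ) / 2 - 1 - 1))) hFc]
      · have : (‖z - 0‖ ^ 2) ^ (-(N:ℝ) / 2 - 1) =
            (‖z - 0‖ ^ 2) ^ (-(N:ℝ) / 2 - 1 - 1) * ‖z - 0‖ ^ 2 := by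
          rw [← Real.rpow_add_one hz2.ne']; congr 1; ring
        rw [this]; ring
      · filter_upwards [lt_mem_nhds hz2] with q hq
        exact Real.hasDerivAt_rpow_const (Or.inl hq.ne')
      · exact (Real.hasDerivAt_rpow_const (Or.inl hz2.ne')).const_mul _
    refine ⟨c1.add c2, ?_⟩
    have := ContDiffAt.laplacian_add c1 c2
    rw [l1, l2, add_zero] at this
    exact this
  have hmain := le_of_laplacian_le hN (K := K) (U := U) (B := B) ?_ ?_ hUK
    (hq.mono (hUK.trans hKA)) (fun z hz => ⟨(hharm z (hKA (hUK hz))).1,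
      (hharm z (hKA (hUK hz))).2.le⟩) (hq.continuousOn.mono hKA)
    (fun z hz => (hharm z (hKA hz)).1.continuousAt.continuousWithinAt) ?_ x ?_
  · rw [hRx, hBe, hx] at hmain
    refine hmain.trans ?_
    have h1 : (inner ℝ x τ : ℝ) ≤ ρ := by
      have := real_inner_le_norm x τ
      rwa [hx, hτ1, mul_one] at this
    refine (mul_le_mul_of_nonneg_right h1 (by positivity)).trans (le_of_eq ?_)
    obtain ⟨n, rfl⟩ : ∃ n, N = n + 1 := ⟨N - 1, by omega⟩
    simp only [Nat.add_sub_cancel, div_pow]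
    field_simp
    ring
  · exact (isCompact_closedBall 0 b).inter_right
      ((isClosed_le continuous_const continuous_norm).inter (isClosed_le continuous_const hin))
  · exact isOpen_ball.inter
      ((isOpen_lt continuous_const continuous_norm).inter (isOpen_lt continuous_const hin))
  · rintro z ⟨⟨h1, h2, h3⟩, hzU⟩
    rw [mem_closedBall_zero_iff] at h1
    replace h2 : a ≤ ‖z‖ := h2
    replace h3 : (0:ℝ) ≤ inner ℝ z τ := h3
    rw [hBe]
    rcases eq_or_lt_of_le h3 with h0 | h0
    · have : R z = z := by rw [hRz, ← h0]; simp
      rw [this, ← h0]; simp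
    rcases eq_or_lt_of_le h1 with hb' | hb'
    · have := sphere_lipschitz hN (z := z) (z' := R z) hb
        (hk.mono fun w hw => ⟨by have := hw.1; linarith, hw.2⟩) hσ hb' (by rw [hRn, hb'])
      rw [hRd z h3] at this
      refine this.trans ?_
      have h5 : 0 ≤ inner ℝ z τ * (8 * N * (κ * a ^ (N - 1) * (‖z‖ ^ N)⁻¹)) := by positivity
      have h6 : 4 * N * σ * (2 * inner ℝ z τ) / b = inner ℝ z τ * (8 * N * (σ / b)) := by ring
      rw [h6]; nlinarith
    rcases eq_or_lt_of_le h2 with ha' | ha'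
    · have := sphere_lipschitz hN (z := z) (z' := R z) ha
        (hk.mono fun w hw => ⟨hw.1, by have := hw.2; linarith⟩) hκ ha'.symm (by rw [hRn, ha'])
      rw [hRd z h3] at this
      refine this.trans ?_
      have h5 : 0 ≤ inner ℝ z τ * (8 * N * (σ / b)) := by positivity
      have h6 : 4 * N * κ * (2 * inner ℝ z τ) / a =
          inner ℝ z τ * (8 * N * (κ * a ^ (N - 1) * (‖z‖ ^ N)⁻¹)) := by
        rw [← ha']
        obtain ⟨n, rfl⟩ : ∃ n, N = n + 1 := ⟨N - 1, by omega⟩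
        simp only [Nat.add_sub_cancel]
        field_simp
        ring
      rw [h6]; nlinarith
    · exact absurd ⟨mem_ball_zero_iff.2 hb', ha', h0⟩ hzU
  · refine ⟨by rw [mem_closedBall_zero_iff, hx]; exact hρb, ?_, ?_⟩
    · change a ≤ ‖x‖
      rw [hx]; exact haρ
    · change (0:ℝ) ≤ inner ℝ x τ
      have : 0 ≤ ‖x - R x‖ := norm_nonneg _
      have h1 : (inner ℝ x τ : ℝ) = ‖v‖ / 2 := by
        have h2 : (inner ℝ x v : ℝ) = ‖v‖ ^ 2 / 2 := by
          rw [hv, inner_sub_right, norm_sub_sq_real, real_inner_self_eq_norm_sq, hx, hx']; ring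
        rw [hτ, inner_smul_right, h2]; field_simp
      rw [h1]; positivity

/-! ### The radial profile of the fundamental solution -/

/-- The radial profile of the fundamental solution, up to a positive constant. -/
def radialS (N : ℕ) (r : ℝ) : ℝ := if N = 2 then -Real.log r else r ^ ((2:ℝ) - N)

/-- The normalising constant of the fundamental solution. -/
def constS (N : ℕ) : ℝ :=
  if N = 2 then 1 / (2 * Real.pi) else 1 / ((N:ℝ) * ((N:ℝ) - 2) * omegaN N)

lemma constS_pos {N : ℕ} (hN : 2 ≤ N) : 0 < constS N := by
  unfold constS
  split_ifs with h
  · positivity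
  · have h3 : (3:ℝ) ≤ N := by exact_mod_cast (show 3 ≤ N by omega)
    have hω : 0 < omegaN N :=
      ENNReal.toReal_pos (measure_ball_pos volume _ one_pos).ne' measure_ball_lt_top.ne
    have : (0:ℝ) < N - 2 := by linarith
    positivity

lemma fundS_eq {N : ℕ} (x y : EN N) : fundS N x y = constS N * radialS N ‖x - y‖ := by
  unfold fundS constS radialS
  split_ifs <;> ring

lemma radialS_hasDerivAt {N : ℕ} (hN : 2 ≤ N) {r : ℝ} (hr : 0 < r) :
    HasDerivAt (radialS N) (-((if N = 2 then 1 else (N:ℝ) - 2) * (r ^ (N - 1))⁻¹)) r := by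
  by_cases h : N = 2
  · subst h
    have : radialS 2 = fun r => -Real.log r := by funext r; simp [radialS]
    rw [this]
    exact (Real.hasDerivAt_log hr.ne').neg.congr_deriv (by simp)
  · have : radialS N = fun r => r ^ ((2:ℝ) - N) := by funext r; simp [radialS, h]
    rw [this, if_neg h]
    convert Real.hasDerivAt_rpow_const (p := (2:ℝ) - N) (Or.inl hr.ne') using 1
    have : r ^ ((2:ℝ) - N - 1) = (r ^ (N - 1))⁻¹ := by
      rw [← Real.rpow_natCast, ← Real.rpow_neg hr.le, Nat.cast_sub (by omega)]
      congr 1; push_cast; ring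
    rw [this]; ring

lemma radialS_coeff {N : ℕ} (hN : 2 ≤ N) :
    (1:ℝ) ≤ (if N = 2 then 1 else (N:ℝ) - 2) ∧ (if N = 2 then 1 else (N:ℝ) - 2) ≤ (N:ℝ) := by
  split_ifs with h
  · subst h; norm_num
  · have h3 : (3:ℝ) ≤ N := by exact_mod_cast (show 3 ≤ N by omega)
    constructor <;> linarith

lemma radialS_continuousOn {N : ℕ} (hN : 2 ≤ N) : ContinuousOn (radialS N) (Ioi 0) :=
  fun _ hr => (radialS_hasDerivAt hN hr).continuousAt.continuousWithinAt

lemma radialS_strictAntiOn {N : ℕ} (hN : 2 ≤ N) : StrictAntiOn (radialS N) (Ioi 0) := by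
  refine strictAntiOn_of_deriv_neg (convex_Ioi 0) (radialS_continuousOn hN) fun r hr => ?_
  rw [interior_Ioi] at hr
  rw [(radialS_hasDerivAt hN hr).deriv]
  have : (0:ℝ) < r ^ (N - 1) := pow_pos hr _
  have := (radialS_coeff hN).1
  rw [neg_lt_zero]; positivity

lemma radialS_lt {N : ℕ} (hN : 2 ≤ N) {r r' : ℝ} (hr : 0 < r) (h : r < r') :
    radialS N r' < radialS N r :=
  radialS_strictAntiOn hN hr (hr.trans h) h

lemma radialS_le {N : ℕ} (hN : 2 ≤ N) {r r' : ℝ} (hr : 0 < r) (h : r ≤ r') :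
    radialS N r' ≤ radialS N r :=
  (radialS_strictAntiOn hN).antitoneOn hr (hr.trans_le h) h

lemma radialS_sub_le {N : ℕ} (hN : 2 ≤ N) {r r' : ℝ} (hr : 0 < r) (h : r ≤ r') :
    radialS N r - radialS N r' ≤ N * (r ^ (N - 1))⁻¹ * (r' - r) := by
  have hb : ∀ x ∈ Icc r r', ‖(-((if N = 2 then 1 else (N:ℝ) - 2) * (x ^ (N - 1))⁻¹) : ℝ)‖
      ≤ N * (r ^ (N - 1))⁻¹ := by
    intro x hx
    have hx0 : 0 < x := hr.trans_le hx.1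
    obtain ⟨h1, h2⟩ := radialS_coeff hN
    rw [norm_neg, norm_mul, Real.norm_of_nonneg (by linarith), Real.norm_of_nonneg (by positivity)]
    gcongr
    exact hx.1
  have := Convex.norm_image_sub_le_of_norm_hasDerivWithin_le (f := radialS N) (s := Icc r r')
    (fun x hx => (radialS_hasDerivAt hN (hr.trans_le hx.1)).hasDerivWithinAt) hb
    (convex_Icc r r') (right_mem_Icc.2 h) (left_mem_Icc.2 h)
  rw [Real.norm_eq_abs, Real.norm_eq_abs, abs_sub_comm r, abs_of_nonneg (sub_nonneg.2 h)] at this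
  exact (le_abs_self _).trans this

lemma abs_radialS_sub_le {N : ℕ} (hN : 2 ≤ N) {r r' : ℝ} (hr : 0 < r) (hr' : 0 < r') :
    |radialS N r - radialS N r'| ≤ N * ((r ^ (N - 1))⁻¹ + (r' ^ (N - 1))⁻¹) * |r - r'| := by
  wlog h : r ≤ r' generalizing r r'
  · rw [abs_sub_comm, abs_sub_comm r, add_comm (r ^ (N - 1))⁻¹]
    exact this hr' hr (le_of_not_ge h)
  rw [abs_of_nonneg (sub_nonneg.2 (radialS_le hN hr h)), abs_sub_comm,
    abs_of_nonneg (sub_nonneg.2 h)]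
  refine (radialS_sub_le hN hr h).trans ?_
  have : 0 ≤ r' - r := sub_nonneg.2 h
  gcongr
  exact le_add_of_nonneg_right (by positivity)

lemma radialS_tendsto {N : ℕ} (hN : 2 ≤ N) : Tendsto (radialS N) (𝓝[>] 0) atTop := by
  by_cases h : N = 2
  · subst h
    have : radialS 2 = fun r => -Real.log r := by funext r; simp [radialS]
    rw [this]
    exact tendsto_neg_atBot_atTop.comp Real.tendsto_log_nhdsGT_zero
  · have : radialS N = fun r => r ^ ((2:ℝ) - N) := by funext r; simp [radialS, h]
    rw [this]
    have h3 : (3:ℝ) ≤ N := by exact_mod_cast (show 3 ≤ N by omega)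
    exact tendsto_rpow_neg_nhdsGT_zero (by linarith)

/-- On bounded sets the profile is controlled by `r^{1-N}`. -/
lemma abs_radialS_le {N : ℕ} (hN : 2 ≤ N) {D : ℝ} (hD : 0 < D) :
    ∃ C > 0, ∀ r, 0 < r → r ≤ D → |radialS N r| + 1 ≤ C * (r ^ (N - 1))⁻¹ := by
  refine ⟨N * D + (|radialS N D| + 1) * D ^ (N - 1), by positivity, fun r hr hrD => ?_⟩
  have h1 := radialS_sub_le hN hr hrD
  have h2 := radialS_le hN hr hrD
  have h0 : 0 ≤ (r ^ (N - 1))⁻¹ := by positivity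
  have h3 : N * (r ^ (N - 1))⁻¹ * (D - r) ≤ N * D * (r ^ (N - 1))⁻¹ := by
    have : 0 ≤ N * (r ^ (N - 1))⁻¹ := by positivity
    nlinarith
  have h4 : |radialS N r| ≤ |radialS N D| + (radialS N r - radialS N D) := by
    have := abs_add_le (radialS N D) (radialS N r - radialS N D)
    rwa [add_sub_cancel, abs_of_nonneg (sub_nonneg.2 h2)] at this
  have h5 : 1 ≤ D ^ (N - 1) * (r ^ (N - 1))⁻¹ := by
    rw [← div_eq_mul_inv, one_le_div (by positivity)]
    exact pow_le_pow_left₀ hr.le hrD _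
  have h6 := mul_le_mul_of_nonneg_left h5 (show 0 ≤ |radialS N D| + 1 by positivity)
  nlinarith

lemma isHarm_radialS {N : ℕ} (hN : 2 ≤ N) (P : EN N) :
    IsHarm (fun x => radialS N ‖x - P‖) {P}ᶜ := by
  intro x hx
  have hx0 : 0 < ‖x - P‖ := norm_pos_iff.2 (sub_ne_zero.2 hx)
  have hx2 : 0 < ‖x - P‖ ^ 2 := by positivity
  by_cases h : N = 2
  · subst h
    have e : (fun x => radialS 2 ‖x - P‖) = barrier P 0 1 0 (fun q => -(1 / 2) * Real.log q) := by
      funext z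
      simp [radialS, barrier, Real.log_pow]
    have hF : ContDiffAt ℝ 2 (fun q => -(1 / 2) * Real.log q) (‖x - P‖ ^ 2) :=
      contDiffAt_const.mul (contDiffAt_id.log hx2.ne')
    rw [e]
    refine ⟨barrier_contDiffAt hF, ?_⟩
    rw [barrier_laplacian (F' := fun q => -(1 / 2) * q⁻¹)
      (F'' := -(1 / 2) * -(((‖x - P‖ ^ 2) ^ 2)⁻¹)) hF]
    · push_cast; field_simp; ring
    · filter_upwards [lt_mem_nhds hx2] with q hq
      exact (Real.hasDerivAt_log hq.ne').const_mul _
    · exact (hasDerivAt_inv hx2.ne').const_mul _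
  · have h3 : (3:ℝ) ≤ N := by exact_mod_cast (show 3 ≤ N by omega)
    have e : (fun x => radialS N ‖x - P‖) =
        barrier P 0 1 0 (fun q => q ^ (((2:ℝ) - N) / 2)) := by
      funext z
      simp only [radialS, barrier, if_neg h, inner_zero_right, mul_zero, add_zero, one_mul]
      rw [← Real.rpow_natCast ‖z - P‖ 2, ← Real.rpow_mul (norm_nonneg _)]
      congr 1; push_cast; ring
    have hF : ContDiffAt ℝ 2 (fun q : ℝ => q ^ (((2:ℝ) - N) / 2)) (‖x - P‖ ^ 2) :=
      contDiffAt_id.rpow_const_of_ne hx2.ne'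
    rw [e]
    refine ⟨barrier_contDiffAt hF, ?_⟩
    rw [barrier_laplacian (F' := fun q => (((2:ℝ) - N) / 2) * q ^ (((2:ℝ) - N) / 2 - 1))
      (F'' := (((2:ℝ) - N) / 2) *
        ((((2:ℝ) - N) / 2 - 1) * (‖x - P‖ ^ 2) ^ (((2:ℝ) - N) / 2 - 1 - 1))) hF]
    · have : (‖x - P‖ ^ 2) ^ (((2:ℝ) - N) / 2 - 1) =
          (‖x - P‖ ^ 2) ^ (((2:ℝ) - N) / 2 - 1 - 1) * ‖x - P‖ ^ 2 := by
        rw [← Real.rpow_add_one hx2.ne']; congr 1; ring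
      rw [this]; simp only [inner_zero_right]; ring
    · filter_upwards [lt_mem_nhds hx2] with q hq
      exact Real.hasDerivAt_rpow_const (Or.inl hq.ne')
    · exact (Real.hasDerivAt_rpow_const (Or.inl hx2.ne')).const_mul _

/-- Comparison of a harmonic function with a radial one. -/
lemma radial_comparison {N : ℕ} (hN : 2 ≤ N) {P : EN N} {k : EN N → ℝ} {B t b : ℝ}
    {K U : Set (EN N)} (hK : IsCompact K) (hU : IsOpen U) (hUK : U ⊆ K) (hP : P ∉ K)
    (hkc : ContinuousOn k K) (hk : IsHarm k U)
    (hb : ∀ z ∈ K \ U, k z ≤ B + t * (radialS N ‖z - P‖ - radialS N b)) :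
    ∀ z ∈ K, k z ≤ B + t * (radialS N ‖z - P‖ - radialS N b) := by
  have hB : IsHarm (fun z => B + t * (radialS N ‖z - P‖ - radialS N b)) K :=
    (isHarm_const _ _).add ((((isHarm_radialS hN P).mono fun z hz h => by
      rw [mem_singleton_iff.1 h] at hz
      exact hP hz).sub (isHarm_const _ _)).const_mul _)
  exact le_of_laplacian_le (by omega) hK hU hUK hk
    (fun z hz => ⟨(hB z (hUK hz)).1, (hB z (hUK hz)).2.le⟩) hkc hB.continuousOn hb

/-- Comparison of a harmonic function on an annulus with a radial one. -/
lemma annulus_comparison {N : ℕ} (hN : 2 ≤ N) {k : EN N → ℝ} {a b A B : ℝ} (ha : 0 < a)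
    (hab : a < b) (hk : IsHarm k {z | a ≤ ‖z‖ ∧ ‖z‖ ≤ b}) (hA : ∀ z, ‖z‖ = a → k z ≤ A)
    (hB : ∀ z, ‖z‖ = b → k z ≤ B) {z : EN N} (haz : a ≤ ‖z‖) (hzb : ‖z‖ ≤ b) :
    k z ≤ B + (A - B) / (radialS N a - radialS N b) * (radialS N ‖z‖ - radialS N b) := by
  set K : Set (EN N) := closedBall 0 b ∩ {z | a ≤ ‖z‖} with hKdef
  set U : Set (EN N) := ball 0 b ∩ {z | a < ‖z‖} with hUdef
  have hUK : U ⊆ K := fun z hz => ⟨ball_subset_closedBall hz.1, show a ≤ ‖z‖ from le_of_lt hz.2⟩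
  have hKA : K ⊆ {z | a ≤ ‖z‖ ∧ ‖z‖ ≤ b} := fun z hz => ⟨hz.2, mem_closedBall_zero_iff.1 hz.1⟩
  have h := radial_comparison hN (P := 0) (k := k) (B := B)
    (t := (A - B) / (radialS N a - radialS N b)) (b := b)
    ((isCompact_closedBall 0 b).inter_right (isClosed_le continuous_const continuous_norm) :
      IsCompact K)
    (isOpen_ball.inter (isOpen_lt continuous_const continuous_norm) : IsOpen U) hUK
    (fun h0 => by
      have : a ≤ ‖(0 : EN N)‖ := h0.2
      rw [norm_zero] at this; linarith)
    (hk.mono hKA).continuousOn (hk.mono (hUK.trans hKA)) ?_ z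
    ⟨mem_closedBall_zero_iff.2 hzb, haz⟩
  · simpa using h
  · have hs := radialS_lt hN ha hab
    rintro w ⟨⟨h1, h2⟩, h3⟩
    rw [mem_closedBall_zero_iff] at h1
    replace h2 : a ≤ ‖w‖ := h2
    rw [sub_zero]
    rcases eq_or_lt_of_le h1 with h | h
    · rw [h, sub_self, mul_zero, add_zero]; exact hB w h
    rcases eq_or_lt_of_le h2 with h' | h'
    · rw [← h', div_mul_cancel₀ _ (sub_ne_zero.2 hs.ne'), add_sub_cancel]; exact hA w h'.symm
    · exact absurd ⟨mem_ball_zero_iff.2 h, h'⟩ h3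

lemma annulus_osc {N : ℕ} (hN : 2 ≤ N) {k : EN N → ℝ} {a b κ σ ρ : ℝ} (ha : 0 < a)
    (hk : IsHarm k {z | a / 2 ≤ ‖z‖ ∧ ‖z‖ ≤ 2 * b})
    (hκ : ∀ z, a / 2 ≤ ‖z‖ → ‖z‖ ≤ 2 * a → |k z| ≤ κ)
    (hσ : ∀ z, b / 2 ≤ ‖z‖ → ‖z‖ ≤ 2 * b → |k z| ≤ σ) (haρ : 2 * a ≤ ρ) (hρb : 2 * ρ ≤ b)
    {p x : EN N} (hp : ‖p‖ = 2 * ρ) (hx : ρ / 2 ≤ ‖x‖) (hx' : ‖x‖ ≤ 2 * ρ) :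
    k x - k p ≤ 8 * N * (σ * (2 * ρ) / b + κ * (a / (2 * ρ)) ^ (N - 1)) +
      2 * κ * ((radialS N (ρ / 2) - radialS N (2 * ρ)) / (radialS N a - radialS N (2 * ρ))) +
      σ * ((radialS N (ρ / 2) - radialS N (2 * ρ)) / (radialS N a - radialS N b)) := by
  have hρ : 0 < ρ := by linarith
  have hs1 := radialS_lt hN ha (show a < 2 * ρ by linarith)
  have hs2 := radialS_lt hN ha (show a < b by linarith)
  have hs3 := radialS_le hN (show 0 < 2 * ρ by linarith) hρb
  have hs4 := radialS_lt hN (show 0 < ρ / 2 by linarith) (show ρ / 2 < 2 * ρ by linarith)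
  have hs5 := radialS_le hN (show 0 < ρ / 2 by linarith) hx
  have hs6 := radialS_le hN (show 0 < ‖x‖ by linarith) hx'
  obtain ⟨e, he⟩ : ∃ e : EN N, ‖e‖ = 1 := ⟨EuclideanSpace.single ⟨0, by omega⟩ 1, by simp⟩
  have hex : ∀ r : ℝ, 0 ≤ r → ‖r • e‖ = r := fun r hr => by
    rw [norm_smul, he, mul_one, Real.norm_of_nonneg hr]
  have hκ0 : 0 ≤ κ := (abs_nonneg _).trans
    (hκ (a • e) (by rw [hex a ha.le]; linarith) (by rw [hex a ha.le]; linarith))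
  have hσ0 : 0 ≤ σ := (abs_nonneg _).trans
    (hσ (b • e) (by rw [hex b (by linarith)]; linarith) (by rw [hex b (by linarith)]; linarith))
  set θ := 8 * N * (σ * (2 * ρ) / b + κ * (a / (2 * ρ)) ^ (N - 1)) with hθ
  have hb : 0 < b := by linarith
  have hθ0 : 0 ≤ θ := by positivity
  set t := (radialS N a - radialS N (2 * ρ)) / (radialS N a - radialS N b) with ht
  have ht0 : 0 ≤ t := div_nonneg (by linarith) (by linarith)
  -- the value at `p`
  have hkp : -(k p) ≤ κ + σ * t := by
    have h1 := annulus_comparison hN (A := κ) (B := σ) ha (show a < b by linarith)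
      (hk.neg.mono fun z hz => ⟨by have := hz.1; linarith, by have := hz.2; linarith⟩)
      (fun z hz => (neg_le_abs _).trans (hκ z (by linarith) (by linarith)))
      (fun z hz => (neg_le_abs _).trans (hσ z (by linarith) (by linarith)))
      (z := p) (by linarith) (by linarith)
    rw [hp] at h1
    have e1 : σ + (κ - σ) / (radialS N a - radialS N b) * (radialS N (2 * ρ) - radialS N b) =
        κ * (1 - t) + σ * t := by
      rw [ht]
      have : radialS N a - radialS N b ≠ 0 := by linarith
      field_simp; ring
    rw [e1] at h1
    nlinarith [mul_nonneg hκ0 ht0]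
  have hmain := annulus_comparison hN (k := fun z => k z - k p) (A := 2 * κ + σ * t) (B := θ) ha
    (show a < 2 * ρ by linarith)
    ((hk.sub (isHarm_const _ _)).mono fun z hz =>
      ⟨by have := hz.1; linarith, by have := hz.2; linarith⟩)
    (fun z hz => by
      have := (le_abs_self _).trans (hκ z (by linarith) (by linarith))
      linarith)
    (fun z hz => sphere_osc (by omega) ha hk hκ hσ (by linarith) hρb hz hp)
    (z := x) (by linarith) hx'
  refine hmain.trans ?_
  have hd : 0 < radialS N a - radialS N (2 * ρ) := by linarith
  have h1 : (2 * κ + σ * t - θ) / (radialS N a - radialS N (2 * ρ)) *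
      (radialS N ‖x‖ - radialS N (2 * ρ)) ≤ (2 * κ + σ * t) / (radialS N a - radialS N (2 * ρ)) *
      (radialS N (ρ / 2) - radialS N (2 * ρ)) := by
    have h2 : 0 ≤ (2 * κ + σ * t) / (radialS N a - radialS N (2 * ρ)) := by positivity
    have h3 : (2 * κ + σ * t - θ) / (radialS N a - radialS N (2 * ρ)) ≤
      (2 * κ + σ * t) / (radialS N a - radialS N (2 * ρ)) := by gcongr; linarith
    exact mul_le_mul h3 (by linarith) (by linarith) h2
  have e2 : (2 * κ + σ * t) / (radialS N a - radialS N (2 * ρ)) *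
      (radialS N (ρ / 2) - radialS N (2 * ρ)) =
      2 * κ * ((radialS N (ρ / 2) - radialS N (2 * ρ)) / (radialS N a - radialS N (2 * ρ))) +
      σ * ((radialS N (ρ / 2) - radialS N (2 * ρ)) / (radialS N a - radialS N b)) := by
    rw [ht]
    have : radialS N a - radialS N b ≠ 0 := by linarith
    field_simp
  linarith

/-- Size of the gradient, at distance `ρ`, of a function harmonic in an annulus of radii `a`, `b`
which is bounded by `κ` near the inner and by `σ` near the outer sphere. -/
def annulusBound (N : ℕ) (a b κ σ ρ : ℝ) : ℝ :=
  σ / b + (if N = 2 then κ + σ / Real.log (b / a) else (κ + σ) * (a / ρ) ^ (N - 2)) / ρ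

lemma annulus_osc_le {N : ℕ} (hN : 2 ≤ N) {a b κ σ ρ : ℝ} (ha : 0 < a) (hκ0 : 0 ≤ κ)
    (hσ0 : 0 ≤ σ) (haρ : 2 * a ≤ ρ) (hρb : 2 * ρ ≤ b) :
    8 * N * (σ * (2 * ρ) / b + κ * (a / (2 * ρ)) ^ (N - 1)) +
      2 * κ * ((radialS N (ρ / 2) - radialS N (2 * ρ)) / (radialS N a - radialS N (2 * ρ))) +
      σ * ((radialS N (ρ / 2) - radialS N (2 * ρ)) / (radialS N a - radialS N b)) ≤
    (16 * N + 4 * 2 ^ N) * annulusBound N a b κ σ ρ * ρ := by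
  have hρ : 0 < ρ := by linarith
  have hb : 0 < b := by linarith
  by_cases h2 : N = 2
  · subst h2
    have hs : ∀ r, radialS 2 r = -Real.log r := fun r => by simp [radialS]
    have e1 : radialS 2 (ρ / 2) - radialS 2 (2 * ρ) = Real.log 4 := by
      rw [hs, hs, Real.log_div hρ.ne' two_ne_zero, Real.log_mul two_ne_zero hρ.ne',
        show (4:ℝ) = 2 * 2 by norm_num, Real.log_mul two_ne_zero two_ne_zero]; ring
    have e2 : radialS 2 a - radialS 2 (2 * ρ) = Real.log (2 * ρ / a) := by
      rw [hs, hs, Real.log_div (by positivity) ha.ne']; ring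
    have e3 : radialS 2 a - radialS 2 b = Real.log (b / a) := by
      rw [hs, hs, Real.log_div (by positivity) ha.ne']; ring
    have h4 : 0 < Real.log 4 := Real.log_pos (by norm_num)
    have h4' : Real.log 4 ≤ 4 := by
      have := Real.log_le_sub_one_of_pos (show (0:ℝ) < 4 by norm_num); linarith
    have h5 : Real.log 4 ≤ Real.log (2 * ρ / a) := by
      refine Real.log_le_log (by norm_num) ?_
      rw [le_div_iff₀ ha]; linarith
    have h6 : 0 < Real.log (b / a) := Real.log_pos (by rw [one_lt_div ha]; linarith)
    have h7 : Real.log 4 / Real.log (2 * ρ / a) ≤ 1 := div_le_one_of_le₀ h5 (by linarith)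
    have h8 : a / (2 * ρ) ≤ 1 := div_le_one_of_le₀ (by linarith) (by linarith)
    have h9 : Real.log 4 / Real.log (b / a) ≤ 4 / Real.log (b / a) := by gcongr
    rw [e1, e2, e3]
    have e4 : annulusBound 2 a b κ σ ρ * ρ = σ * ρ / b + (κ + σ / Real.log (b / a)) := by
      simp only [annulusBound, if_true]; field_simp
    rw [mul_assoc _ (annulusBound _ _ _ _ _ _), e4]
    have b1 := mul_le_mul_of_nonneg_left h7 hκ0
    have b2 := mul_le_mul_of_nonneg_left h8 hκ0
    have b3 := mul_le_mul_of_nonneg_left h9 hσ0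
    have e5 : σ * (2 * ρ) / b = 2 * (σ * ρ / b) := by ring
    have e6 : σ * (4 / Real.log (b / a)) = 4 * (σ / Real.log (b / a)) := by ring
    have p1 : 0 ≤ σ * ρ / b := by positivity
    have p2 : 0 ≤ σ / Real.log (b / a) := by positivity
    rw [e5]; rw [e6] at b3
    norm_num
    nlinarith
  · obtain ⟨n, rfl⟩ : ∃ n, N = n + 3 := ⟨N - 3, by omega⟩
    have hs : ∀ r, 0 < r → radialS (n + 3) r = (r ^ (n + 1))⁻¹ := fun r hr => by
      rw [radialS, if_neg h2, ← Real.rpow_natCast, ← Real.rpow_neg hr.le]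
      congr 1; push_cast; ring
    have hq : ∀ c, 2 * ρ ≤ c → (radialS (n + 3) (ρ / 2) - radialS (n + 3) (2 * ρ)) /
        (radialS (n + 3) a - radialS (n + 3) c) ≤ 2 * 2 ^ (n + 1) * (a / ρ) ^ (n + 1) := by
      intro c hc
      have hc0 : 0 < c := by linarith
      rw [hs _ (by linarith), hs _ (by linarith), hs _ ha, hs _ hc0]
      have i1 : (c ^ (n + 1))⁻¹ ≤ (a ^ (n + 1))⁻¹ / 2 := by
        rw [div_eq_mul_inv, ← mul_inv]
        gcongr
        calc a ^ (n + 1) * 2 ≤ a ^ (n + 1) * 2 ^ (n + 1) := by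
              gcongr
              exact le_self_pow₀ (by norm_num) (by omega)
          _ = (a * 2) ^ (n + 1) := (mul_pow _ _ _).symm
          _ ≤ c ^ (n + 1) := by gcongr; linarith
      have i2 : 0 < (a ^ (n + 1))⁻¹ := by positivity
      have i3 : 0 < ((2 * ρ) ^ (n + 1))⁻¹ := by positivity
      rw [div_le_iff₀ (by linarith)]
      have e1 : 2 * 2 ^ (n + 1) * (a / ρ) ^ (n + 1) * ((a ^ (n + 1))⁻¹ / 2) =
          ((ρ / 2) ^ (n + 1))⁻¹ := by
        rw [div_pow, div_pow]; field_simp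
      have i4 := mul_le_mul_of_nonneg_left
        (show (a ^ (n + 1))⁻¹ / 2 ≤ (a ^ (n + 1))⁻¹ - (c ^ (n + 1))⁻¹ by linarith)
        (show 0 ≤ 2 * 2 ^ (n + 1) * (a / ρ) ^ (n + 1) by positivity)
      rw [e1] at i4
      linarith
    have q1 := mul_le_mul_of_nonneg_left (hq (2 * ρ) le_rfl) (show 0 ≤ 2 * κ by positivity)
    have q2 := mul_le_mul_of_nonneg_left (hq b hρb) hσ0
    have q3 : (a / (2 * ρ)) ^ (n + 3 - 1) ≤ (a / ρ) ^ (n + 1) := by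
      have h8 : a / (2 * ρ) ≤ 1 := div_le_one_of_le₀ (by linarith) (by linarith)
      calc (a / (2 * ρ)) ^ (n + 3 - 1) ≤ (a / (2 * ρ)) ^ (n + 1) :=
            pow_le_pow_of_le_one (by positivity) h8 (by omega)
        _ ≤ _ := by gcongr; linarith
    have q4 := mul_le_mul_of_nonneg_left q3 hκ0
    have e4 : annulusBound (n + 3) a b κ σ ρ * ρ =
        σ * ρ / b + (κ + σ) * (a / ρ) ^ (n + 1) := by
      simp only [annulusBound, if_neg h2, show n + 3 - 2 = n + 1 by omega]; field_simp
    rw [mul_assoc _ (annulusBound _ _ _ _ _ _), e4]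
    have e5 : σ * (2 * ρ) / b = 2 * (σ * ρ / b) := by ring
    have p1 : 0 ≤ σ * ρ / b := by positivity
    have p2 : 0 ≤ (a / ρ) ^ (n + 1) := by positivity
    have p3 : (2:ℝ) ^ (n + 3) = 4 * 2 ^ (n + 1) := by ring
    have p4 : (0:ℝ) < 2 ^ (n + 1) := by positivity
    have p5 : (0:ℝ) ≤ ((n + 3 : ℕ) : ℝ) := Nat.cast_nonneg _
    rw [e5, p3]
    set X := (a / ρ) ^ (n + 1)
    set Y := σ * ρ / b
    set m := ((n + 3 : ℕ) : ℝ)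
    set T := (2:ℝ) ^ (n + 1)
    have r1 := mul_nonneg (mul_nonneg p5 hκ0) p2
    have r2 := mul_nonneg (mul_nonneg p5 hσ0) p2
    have r3 := mul_nonneg (mul_nonneg p4.le hκ0) p2
    have r4 := mul_nonneg (mul_nonneg p4.le hσ0) p2
    have r5 := mul_nonneg p4.le p1
    have r6 := mul_le_mul_of_nonneg_left q4 p5
    nlinarith

/-- Interior Lipschitz bound at intermediate scales for harmonic functions in an annulus. -/
lemma annulus_lipschitz {N : ℕ} (hN : 2 ≤ N) {P : EN N} {k : EN N → ℝ} {a b κ σ : ℝ}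
    (ha : 0 < a) (hk : IsHarm k {z | a / 2 ≤ ‖z - P‖ ∧ ‖z - P‖ ≤ 2 * b})
    (hκ : ∀ z, a / 2 ≤ ‖z - P‖ → ‖z - P‖ ≤ 2 * a → |k z| ≤ κ)
    (hσ : ∀ z, b / 2 ≤ ‖z - P‖ → ‖z - P‖ ≤ 2 * b → |k z| ≤ σ) {x₀ x x' : EN N}
    (haρ : 2 * a ≤ ‖x₀ - P‖) (hρb : 2 * ‖x₀ - P‖ ≤ b) (hx : ‖x - x₀‖ ≤ ‖x₀ - P‖ / 4)
    (hx' : ‖x' - x₀‖ ≤ ‖x₀ - P‖ / 4) :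
    k x - k x' ≤ 4 * N * (16 * N + 4 * 2 ^ N) * annulusBound N a b κ σ ‖x₀ - P‖ * ‖x - x'‖ := by
  set ρ := ‖x₀ - P‖ with hρdef
  have hρ : 0 < ρ := by linarith
  obtain ⟨e, he⟩ : ∃ e : EN N, ‖e‖ = 1 := ⟨EuclideanSpace.single ⟨0, by omega⟩ 1, by simp⟩
  have hex : ∀ r : ℝ, 0 ≤ r → ‖r • e‖ = r := fun r hr => by
    rw [norm_smul, he, mul_one, Real.norm_of_nonneg hr]
  have hκ0 : 0 ≤ κ := (abs_nonneg _).trans (hκ (a • e + P)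
    (by rw [add_sub_cancel_right, hex a ha.le]; linarith)
    (by rw [add_sub_cancel_right, hex a ha.le]; linarith))
  have hσ0 : 0 ≤ σ := (abs_nonneg _).trans (hσ (b • e + P)
    (by rw [add_sub_cancel_right, hex b (by linarith)]; linarith)
    (by rw [add_sub_cancel_right, hex b (by linarith)]; linarith))
  set l : EN N → ℝ := fun z => k (z + P) with hl
  have hlk : IsHarm l {z | a / 2 ≤ ‖z‖ ∧ ‖z‖ ≤ 2 * b} :=
    hk.comp_isometry (LinearIsometryEquiv.refl ℝ (EN N)) P fun z hz => by
      change a / 2 ≤ ‖z + P - P‖ ∧ ‖z + P - P‖ ≤ 2 * b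
      rw [add_sub_cancel_right]; exact hz
  have hlκ : ∀ z, a / 2 ≤ ‖z‖ → ‖z‖ ≤ 2 * a → |l z| ≤ κ := fun z h1 h2 =>
    hκ _ (by rwa [add_sub_cancel_right]) (by rwa [add_sub_cancel_right])
  have hlσ : ∀ z, b / 2 ≤ ‖z‖ → ‖z‖ ≤ 2 * b → |l z| ≤ σ := fun z h1 h2 =>
    hσ _ (by rwa [add_sub_cancel_right]) (by rwa [add_sub_cancel_right])
  set p : EN N := (2 * ρ) • e with hp
  have hpn : ‖p‖ = 2 * ρ := hex _ (by linarith)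
  have hE := annulus_osc_le hN (b := b) (κ := κ) (σ := σ) ha hκ0 hσ0 haρ hρb
  set E := (16 * N + 4 * 2 ^ N) * annulusBound N a b κ σ ρ * ρ with hEdef
  have hosc : ∀ z, ρ / 2 ≤ ‖z‖ → ‖z‖ ≤ 2 * ρ → |l z - l p| ≤ E := by
    intro z h1 h2
    have o1 := annulus_osc hN ha hlk hlκ hlσ haρ hρb hpn h1 h2
    have o2 := annulus_osc hN ha hlk.neg (fun z h h' => by rw [abs_neg]; exact hlκ z h h')
      (fun z h h' => by rw [abs_neg]; exact hlσ z h h') haρ hρb hpn h1 h2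
    rw [abs_le]
    constructor <;> linarith
  have hin : ∀ z ∈ closedBall (midpoint ℝ x x') (ρ / 4), ρ / 2 ≤ ‖z - P‖ ∧ ‖z - P‖ ≤ 2 * ρ := by
    intro z hz
    rw [mem_closedBall, dist_eq_norm] at hz
    have hm : ‖midpoint ℝ x x' - x₀‖ ≤ ρ / 4 := by
      have : midpoint ℝ x x' ∈ closedBall x₀ (ρ / 4) :=
        (convex_closedBall x₀ (ρ / 4)).midpoint_mem (mem_closedBall_iff_norm.2 hx)
          (mem_closedBall_iff_norm.2 hx')
      exact mem_closedBall_iff_norm.1 this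
    have h1 : ‖z - x₀‖ ≤ ρ / 2 := by
      have := norm_sub_le_norm_sub_add_norm_sub z (midpoint ℝ x x') x₀
      linarith
    have h2 := norm_sub_le_norm_sub_add_norm_sub z x₀ P
    have h3 := norm_sub_le_norm_sub_add_norm_sub x₀ z P
    rw [norm_sub_rev x₀ z] at h3
    constructor <;> linarith
  have hfin := lipschitz_of_isHarm (by omega) (k := fun z => k z - l p) (σ := E)
    (r := ρ / 4) (x := x) (x' := x') (by linarith)
    ((hk.sub (isHarm_const _ _)).mono fun z hz => by
      have := hin z hz
      exact ⟨by linarith, by linarith⟩)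
    (fun z hz => by
      have h := hosc (z - P) (hin z hz).1 (hin z hz).2
      simpa only [hl, sub_add_cancel] using h)
    (by
      have := norm_sub_le_norm_sub_add_norm_sub x x₀ x'
      rw [norm_sub_rev x₀ x'] at this
      linarith)
  have e1 : N * E * ‖x - x'‖ / (ρ / 4) =
      4 * N * (16 * N + 4 * 2 ^ N) * annulusBound N a b κ σ ρ * ‖x - x'‖ := by
    rw [hEdef]; field_simp
  rw [e1] at hfin
  linarith

/-! ### Bounds for the regular part of the Green function -/

section RegularPart

variable {N : ℕ} {D : Set (EN N)} {H : EN N → EN N → ℝ} {y : EN N}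

lemma IsRegularPart.isHarm (hH : IsRegularPart D (fundS N) H) (hD : IsOpen D) (hy : y ∈ D) :
    IsHarm (fun x => H x y) D := fun x hx => by
  have hc := (hH y hy).1.contDiffAt (hD.mem_nhds hx)
  exact ⟨hc, by rw [← lap_eq_laplacian hc]; exact (hH y hy).2.1 x hx⟩

lemma IsRegularPart.eq_of_mem_frontier (hH : IsRegularPart D (fundS N) H) (hy : y ∈ D)
    {z : EN N} (hz : z ∈ frontier D) : H z y = -(constS N * radialS N ‖z - y‖) := by
  have := (hH y hy).2.2.2 z hz
  rw [fundS_eq] at this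
  linarith

lemma norm_sub_pos_of_mem_frontier (hD : IsOpen D) (hy : y ∈ D) {z : EN N}
    (hz : z ∈ frontier D) : 0 < ‖z - y‖ := by
  rw [norm_pos_iff, sub_ne_zero]
  rintro rfl
  rw [hD.frontier_eq] at hz
  exact hz.2 hy

lemma IsRegularPart.le_of_norm_le (hN : 2 ≤ N) (hH : IsRegularPart D (fundS N) H) (hD : IsOpen D)
    (hDb : Bornology.IsBounded D) (hy : y ∈ D) {d : ℝ} (hd : ∀ z ∈ frontier D, ‖z - y‖ ≤ d)
    {x : EN N} (hx : x ∈ closure D) : H x y ≤ -(constS N * radialS N d) := by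
  refine le_of_laplacian_le (by omega) hDb.isCompact_closure hD subset_closure (hH.isHarm hD hy)
    (fun z hz => ⟨(isHarm_const (-(constS N * radialS N d)) D z hz).1,
      (isHarm_const (-(constS N * radialS N d)) D z hz).2.le⟩)
    (hH y hy).2.2.1 continuousOn_const (fun z hz => ?_) x hx
  rw [← hD.frontier_eq] at hz
  rw [hH.eq_of_mem_frontier hy hz, neg_le_neg_iff]
  exact mul_le_mul_of_nonneg_left (radialS_le hN (norm_sub_pos_of_mem_frontier hD hy hz) (hd z hz))
    (constS_pos hN).le

lemma IsRegularPart.ge_of_le_norm_frontier (hN : 2 ≤ N) (hH : IsRegularPart D (fundS N) H)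
    (hD : IsOpen D) (hDb : Bornology.IsBounded D) (hy : y ∈ D) {d : ℝ} (hd0 : 0 < d)
    (hd : ∀ z ∈ frontier D, d ≤ ‖z - y‖) {x : EN N} (hx : x ∈ closure D) :
    -(constS N * radialS N d) ≤ H x y := by
  have := le_of_laplacian_le (by omega) (k := fun _ => -(constS N * radialS N d))
    (B := fun x => H x y) hDb.isCompact_closure hD subset_closure (isHarm_const _ _)
    (fun z hz => ⟨(hH.isHarm hD hy z hz).1, (hH.isHarm hD hy z hz).2.le⟩)
    continuousOn_const (hH y hy).2.2.1 (fun z hz => ?_) x hx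
  · exact this
  rw [← hD.frontier_eq] at hz
  rw [hH.eq_of_mem_frontier hy hz, neg_le_neg_iff]
  exact mul_le_mul_of_nonneg_left (radialS_le hN hd0 (hd z hz)) (constS_pos hN).le

/-- The Green function is nonnegative. -/
lemma IsRegularPart.green_nonneg (hN : 2 ≤ N) (hH : IsRegularPart D (fundS N) H) (hD : IsOpen D)
    (hDb : Bornology.IsBounded D) (hy : y ∈ D) {x : EN N} (hx : x ∈ closure D) (hxy : x ≠ y) :
    0 ≤ constS N * radialS N ‖x - y‖ + H x y := by
  have hc := constS_pos hN
  have hxy0 : 0 < ‖x - y‖ := norm_pos_iff.2 (sub_ne_zero.2 hxy)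
  obtain ⟨M, hM⟩ := hDb.isCompact_closure.exists_bound_of_continuousOn (hH y hy).2.2.1
  obtain ⟨r₀, hr₀, hr₀D⟩ := nhds_basis_closedBall.mem_iff.1 (hD.mem_nhds hy)
  have hev : ∀ᶠ r in 𝓝[>] (0:ℝ), M / constS N ≤ radialS N r ∧ r < min r₀ ‖x - y‖ ∧ 0 < r :=
    ((radialS_tendsto hN).eventually_ge_atTop _).and
      (((eventually_lt_nhds (lt_min hr₀ hxy0)).filter_mono nhdsWithin_le_nhds).and
        self_mem_nhdsWithin)
  obtain ⟨r, hr1, hr2, hr0⟩ := hev.exists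
  have hrr := lt_min_iff.1 hr2
  set K := closure D \ ball y r with hK
  set U := D \ closedBall y r with hU
  have hUK : U ⊆ K := fun z hz => ⟨subset_closure hz.1, fun h => hz.2 (ball_subset_closedBall h)⟩
  have hKy : K ⊆ {y}ᶜ := fun z hz h => hz.2 (by rw [mem_singleton_iff.1 h]; exact mem_ball_self hr0)
  have hS : IsHarm (fun z => -(constS N * radialS N ‖z - y‖)) {y}ᶜ :=
    ((isHarm_radialS hN y).const_mul _).neg
  have := le_of_laplacian_le (by omega) (k := fun z => -(constS N * radialS N ‖z - y‖))
    (B := fun z => H z y) (K := K) (U := U) (hDb.isCompact_closure.diff isOpen_ball)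
    (hD.sdiff isClosed_closedBall) hUK (hS.mono (hUK.trans hKy))
    (fun z hz => ⟨(hH.isHarm hD hy z hz.1).1, (hH.isHarm hD hy z hz.1).2.le⟩)
    (hS.mono hKy).continuousOn ((hH y hy).2.2.1.mono sdiff_subset) (fun z hz => ?_) x
    ⟨hx, by rw [mem_ball, dist_eq_norm]; exact not_lt.2 hrr.2.le⟩
  · linarith
  · obtain ⟨⟨hz1, hz2⟩, hz3⟩ := hz
    rw [mem_ball, dist_eq_norm, not_lt] at hz2
    by_cases hzD : z ∈ D
    · have hzr : ‖z - y‖ = r := by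
        refine le_antisymm ?_ hz2
        by_contra hlt
        exact hz3 ⟨hzD, by rw [mem_closedBall, dist_eq_norm]; exact hlt⟩
      have h1 := abs_le.1 (hM z hz1)
      rw [div_le_iff₀ hc] at hr1
      rw [hzr]
      linarith [h1.1]
    · have hzf : z ∈ frontier D := by rw [hD.frontier_eq]; exact ⟨hz1, hzD⟩
      rw [hH.eq_of_mem_frontier hy hzf]

lemma IsRegularPart.ge_of_le_norm (hN : 2 ≤ N) (hH : IsRegularPart D (fundS N) H) (hD : IsOpen D)
    (hDb : Bornology.IsBounded D) (hy : y ∈ D) {x : EN N} (hx : x ∈ closure D) {d : ℝ}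
    (hd : 0 < d) (hxy : d ≤ ‖x - y‖) : -(constS N * radialS N d) ≤ H x y := by
  have h1 := hH.green_nonneg hN hD hDb hy hx (by rintro rfl; simp at hxy; linarith)
  have h2 := mul_le_mul_of_nonneg_left (radialS_le hN hd hxy) (constS_pos hN).le
  linarith

lemma IsRegularPart.sub_le (hN : 2 ≤ N) (hH : IsRegularPart D (fundS N) H) (hD : IsOpen D)
    (hDb : Bornology.IsBounded D) {y' : EN N} (hy : y ∈ D) (hy' : y' ∈ D) {r : ℝ} (hr : 0 < r)
    (hyr : ∀ z ∈ frontier D, r ≤ ‖z - y‖) (hyr' : ∀ z ∈ frontier D, r ≤ ‖z - y'‖) {x : EN N}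
    (hx : x ∈ closure D) :
    H x y - H x y' ≤ constS N * (2 * N * (r ^ (N - 1))⁻¹ * ‖y - y'‖) := by
  have hc := constS_pos hN
  set M := constS N * (2 * N * (r ^ (N - 1))⁻¹ * ‖y - y'‖) with hM
  refine le_of_laplacian_le (by omega) (k := fun x => H x y - H x y') (B := fun _ => M)
    hDb.isCompact_closure hD subset_closure ((hH.isHarm hD hy).sub (hH.isHarm hD hy'))
    (fun z hz => ⟨(isHarm_const M D z hz).1, (isHarm_const M D z hz).2.le⟩)
    ((hH y hy).2.2.1.sub (hH y' hy').2.2.1) continuousOn_const (fun z hz => ?_) x hx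
  rw [← hD.frontier_eq] at hz
  have h1 := hyr z hz
  have h2 := hyr' z hz
  rw [hH.eq_of_mem_frontier hy hz, hH.eq_of_mem_frontier hy' hz]
  have h3 := abs_radialS_sub_le hN (hr.trans_le h2) (hr.trans_le h1)
  have h4 : |‖z - y'‖ - ‖z - y‖| ≤ ‖y - y'‖ := by
    refine (abs_norm_sub_norm_le _ _).trans (le_of_eq ?_)
    congr 1; abel
  have h5 : ∀ t, r ≤ t → (t ^ (N - 1))⁻¹ ≤ (r ^ (N - 1))⁻¹ := fun t ht => by gcongr
  have h6 : N * ((‖z - y'‖ ^ (N - 1))⁻¹ + (‖z - y‖ ^ (N - 1))⁻¹) * |‖z - y'‖ - ‖z - y‖| ≤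
      N * ((r ^ (N - 1))⁻¹ + (r ^ (N - 1))⁻¹) * ‖y - y'‖ := by
    gcongr
  have h7 := (le_abs_self _).trans (h3.trans h6)
  have h8 := mul_le_mul_of_nonneg_left h7 hc.le
  rw [hM]
  calc _ = constS N * (radialS N ‖z - y'‖ - radialS N ‖z - y‖) := by ring
    _ ≤ _ := h8
    _ = _ := by ring

lemma IsRegularPart.continuousOn_right (hN : 2 ≤ N) (hH : IsRegularPart D (fundS N) H)
    (hD : IsOpen D) (hDb : Bornology.IsBounded D) {x : EN N} (hx : x ∈ closure D) :
    ContinuousOn (fun y => H x y) D := by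
  intro y hy
  obtain ⟨r, hr, hrD⟩ := nhds_basis_ball.mem_iff.1 (hD.mem_nhds hy)
  have hfar : ∀ y' ∈ ball y (r / 2), ∀ z ∈ frontier D, r / 2 ≤ ‖z - y'‖ := by
    intro y' hy' z hz
    by_contra hlt
    rw [hD.frontier_eq] at hz
    refine hz.2 (hrD ?_)
    rw [mem_ball, dist_eq_norm] at hy' ⊢
    have := norm_sub_le_norm_sub_add_norm_sub z y' y
    linarith
  refine ContinuousAt.continuousWithinAt ?_
  rw [Metric.continuousAt_iff]
  intro e he
  set L := constS N * (2 * N * ((r / 2) ^ (N - 1))⁻¹) with hL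
  have hL0 : 0 ≤ L := by have := constS_pos hN; positivity
  refine ⟨min (r / 2) (e / (L + 1)), by positivity, fun y' hy' => ?_⟩
  obtain ⟨h1, h2⟩ := lt_min_iff.1 hy'
  have hy'b : y' ∈ ball y (r / 2) := h1
  have hyb : y ∈ ball y (r / 2) := mem_ball_self (by positivity)
  have hy'D : y' ∈ D := hrD (ball_subset_ball (by linarith) hy'b)
  have a1 := hH.sub_le hN hD hDb hy hy'D (by positivity) (hfar y hyb) (hfar y' hy'b) hx
  have a2 := hH.sub_le hN hD hDb hy'D hy (by positivity) (hfar y' hy'b) (hfar y hyb) hx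
  rw [norm_sub_rev y y'] at a1
  rw [dist_eq_norm, lt_div_iff₀ (by linarith)] at h2
  have h3 : L * ‖y' - y‖ < e := by nlinarith [norm_nonneg (y' - y)]
  rw [← mul_assoc, ← hL] at a1 a2
  rw [Real.dist_eq, abs_lt]
  constructor <;> linarith

end RegularPart

/-! ### The regular part on a domain with a small hole -/

/-- `Ω` is a bounded open set of diameter at most `d` containing the closed ball of centre `P` and
radius `4 b`. -/
structure HoleDomain {N : ℕ} (Ω : Set (EN N)) (P : EN N) (b d : ℝ) : Prop where
  isOpen : IsOpen Ω
  isBounded : Bornology.IsBounded Ω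
  b_pos : 0 < b
  b_le : 4 * b ≤ d
  ball_subset : closedBall P (4 * b) ⊆ Ω
  norm_le : ∀ z ∈ closure Ω, ∀ y ∈ Ω, ‖z - y‖ ≤ d

section HoleDomain

variable {N : ℕ} {Ω : Set (EN N)} {P : EN N} {b d ε : ℝ} {H : EN N → EN N → ℝ} {x y : EN N}

lemma exists_holeDomain (hΩ : IsOpen Ω) (hb : Bornology.IsBounded Ω) (hP : P ∈ Ω) :
    ∃ b d : ℝ, HoleDomain Ω P b d := by
  obtain ⟨r, hr, hrΩ⟩ := nhds_basis_closedBall.mem_iff.1 (hΩ.mem_nhds hP)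
  obtain ⟨R, hR⟩ := hb.closure.exists_norm_le
  refine ⟨r / 4, max (2 * R) r, hΩ, hb, by positivity, ?_, ?_, fun z hz y hy => ?_⟩
  · rw [mul_div_cancel₀ _ (by norm_num)]; exact le_max_right _ _
  · rwa [mul_div_cancel₀ _ (by norm_num)]
  · have h1 := hR z hz
    have h2 := hR y (subset_closure hy)
    exact ((norm_sub_le z y).trans (by linarith)).trans (le_max_left _ _)

lemma HoleDomain.isOpen_diff (h : HoleDomain Ω P b d) : IsOpen (Ω \ closedBall P ε) :=
  h.isOpen.sdiff isClosed_closedBall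

lemma HoleDomain.isBounded_diff (h : HoleDomain Ω P b d) :
    Bornology.IsBounded (Ω \ closedBall P ε) := h.isBounded.subset sdiff_subset

lemma HoleDomain.d_pos (h : HoleDomain Ω P b d) : 0 < d := by linarith [h.b_pos, h.b_le]

lemma HoleDomain.mem_diff (h : HoleDomain Ω P b d) (h1 : ε < ‖x - P‖) (h2 : ‖x - P‖ ≤ 4 * b) :
    x ∈ Ω \ closedBall P ε :=
  ⟨h.ball_subset (mem_closedBall_iff_norm.2 h2), fun hx => by
    rw [mem_closedBall_iff_norm] at hx; linarith⟩

lemma lt_norm_of_mem_diff (hy : y ∈ Ω \ closedBall P ε) : ε < ‖y - P‖ := by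
  have := hy.2
  rwa [mem_closedBall_iff_norm, not_le] at this

lemma HoleDomain.norm_sub_center_le (h : HoleDomain Ω P b d) (hy : y ∈ Ω) : ‖y - P‖ ≤ d := by
  refine h.norm_le y (subset_closure hy) P (h.ball_subset (mem_closedBall_self ?_))
  linarith [h.b_pos]

lemma HoleDomain.frontier_cases (h : HoleDomain Ω P b d) {z : EN N}
    (hz : z ∈ frontier (Ω \ closedBall P ε)) : ‖z - P‖ ≤ ε ∨ 4 * b < ‖z - P‖ := by
  by_contra! hcon
  rw [h.isOpen_diff.frontier_eq] at hz
  exact hz.2 (h.mem_diff hcon.1 hcon.2)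

lemma mem_frontier_of_norm_eq (h : HoleDomain Ω P b d) (hε : 0 < ε) (hεb : ε < b)
    {z : EN N} (hz : ‖z - P‖ = ε) : z ∈ frontier (Ω \ closedBall P ε) := by
  rw [h.isOpen_diff.frontier_eq]
  refine ⟨?_, fun hz' => hz'.2 (mem_closedBall_iff_norm.2 hz.le)⟩
  have hlim : Tendsto (fun t : ℝ => P + t • (z - P)) (𝓝[>] 1) (𝓝 z) := by
    have : Continuous fun t : ℝ => P + t • (z - P) := by fun_prop
    have h1 := this.tendsto 1
    rw [one_smul, add_sub_cancel] at h1
    exact h1.mono_left nhdsWithin_le_nhds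
  refine mem_closure_of_tendsto hlim ?_
  filter_upwards [Ioo_mem_nhdsGT (show (1:ℝ) < 2 by norm_num)] with t ht
  have hn : ‖P + t • (z - P) - P‖ = t * ε := by
    rw [add_sub_cancel_left, norm_smul, hz, Real.norm_of_nonneg (by linarith [ht.1])]
  refine h.mem_diff ?_ ?_
  · rw [hn]; nlinarith [ht.1]
  · rw [hn]; nlinarith [ht.2]

lemma HoleDomain.regularPart_le (h : HoleDomain Ω P b d) (hN : 2 ≤ N)
    (hH : IsRegularPart (Ω \ closedBall P ε) (fundS N) H) (hy : y ∈ Ω \ closedBall P ε)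
    (hx : x ∈ closure (Ω \ closedBall P ε)) : H x y ≤ -(constS N * radialS N d) :=
  hH.le_of_norm_le hN h.isOpen_diff h.isBounded_diff hy
    (fun z hz => h.norm_le z (closure_mono sdiff_subset (frontier_subset_closure hz)) y hy.1) hx

lemma HoleDomain.regularPart_ge_inner (h : HoleDomain Ω P b d) (hN : 2 ≤ N) (hε : 0 < ε)
    (hεb : 16 * ε ≤ b) (hH : IsRegularPart (Ω \ closedBall P ε) (fundS N) H)
    (hy : y ∈ Ω \ closedBall P ε) (hx1 : 2 * ε ≤ ‖x - P‖) (hx2 : ‖x - P‖ ≤ 8 * ε) :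
    -(constS N * radialS N (‖y - P‖ / 32)) ≤ H x y := by
  have hx : x ∈ closure (Ω \ closedBall P ε) :=
    subset_closure (h.mem_diff (by linarith) (by linarith))
  have hyε := lt_norm_of_mem_diff hy
  have t1 := norm_sub_le_norm_sub_add_norm_sub y x P
  have t2 := norm_sub_le_norm_sub_add_norm_sub x y P
  rw [norm_sub_rev y x] at t1
  by_cases hfar : ‖y - P‖ / 32 ≤ ‖x - y‖
  · exact hH.ge_of_le_norm hN h.isOpen_diff h.isBounded_diff hy hx (by linarith) hfar
  · push Not at hfar
    refine hH.ge_of_le_norm_frontier hN h.isOpen_diff h.isBounded_diff hy (by linarith)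
      (fun z hz => ?_) hx
    have t3 := norm_sub_le_norm_sub_add_norm_sub y z P
    have t4 := norm_sub_le_norm_sub_add_norm_sub z y P
    rw [norm_sub_rev y z] at t3
    rcases h.frontier_cases hz with h1 | h1 <;> linarith

lemma HoleDomain.regularPart_ge_outer (h : HoleDomain Ω P b d) (hN : 2 ≤ N)
    (hεb : 16 * ε ≤ b) (hH : IsRegularPart (Ω \ closedBall P ε) (fundS N) H)
    (hy : y ∈ Ω \ closedBall P ε) (hx1 : b / 2 ≤ ‖x - P‖) (hx2 : ‖x - P‖ ≤ 2 * b) :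
    -(constS N * radialS N (b / 8)) ≤ H x y := by
  have hb := h.b_pos
  have hx : x ∈ closure (Ω \ closedBall P ε) :=
    subset_closure (h.mem_diff (by linarith) (by linarith))
  have t1 := norm_sub_le_norm_sub_add_norm_sub y x P
  have t2 := norm_sub_le_norm_sub_add_norm_sub x y P
  rw [norm_sub_rev y x] at t1
  by_cases hfar : b / 8 ≤ ‖x - y‖
  · exact hH.ge_of_le_norm hN h.isOpen_diff h.isBounded_diff hy hx (by linarith) hfar
  · push Not at hfar
    refine hH.ge_of_le_norm_frontier hN h.isOpen_diff h.isBounded_diff hy (by linarith)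
      (fun z hz => ?_) hx
    have t3 := norm_sub_le_norm_sub_add_norm_sub y z P
    have t4 := norm_sub_le_norm_sub_add_norm_sub z y P
    rw [norm_sub_rev y z] at t3
    rcases h.frontier_cases hz with h1 | h1 <;> linarith

/-- Near the hole and at unit distance from it, the regular part differs from minus the fundamental
solution with pole `P` by a multiple of `|y-P|^{1-N}`. -/
lemma HoleDomain.abs_regularPart_add_le (h : HoleDomain Ω P b d) (hN : 2 ≤ N) :
    ∃ C > 0, ∀ ε, 0 < ε → 16 * ε ≤ b → ∀ H : EN N → EN N → ℝ,
      IsRegularPart (Ω \ closedBall P ε) (fundS N) H → ∀ y ∈ Ω \ closedBall P ε, ∀ x,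
      (2 * ε ≤ ‖x - P‖ ∧ ‖x - P‖ ≤ 8 * ε) ∨ (b / 2 ≤ ‖x - P‖ ∧ ‖x - P‖ ≤ 2 * b) →
      |H x y + constS N * radialS N ‖y - P‖| ≤ C * (‖y - P‖ ^ (N - 1))⁻¹ := by
  obtain ⟨C, hC, hCs⟩ := abs_radialS_le hN h.d_pos
  have hc := constS_pos hN
  have hb := h.b_pos
  set M := |radialS N d| + |radialS N (b / 8)| with hM
  refine ⟨constS N * (32 ^ (N - 1) + M + 1) * C, by positivity, ?_⟩
  intro ε hε hεb H hH y hy x hx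
  have hyε := lt_norm_of_mem_diff hy
  have hy0 : 0 < ‖y - P‖ := hε.trans hyε
  have hyd := h.norm_sub_center_le hy.1
  have s1 := hCs _ hy0 hyd
  have s2 := hCs (‖y - P‖ / 32) (by linarith) (by linarith)
  have e2 : ((‖y - P‖ / 32) ^ (N - 1))⁻¹ = 32 ^ (N - 1) * (‖y - P‖ ^ (N - 1))⁻¹ := by
    rw [div_pow, inv_div]; ring
  rw [e2] at s2
  set w := (‖y - P‖ ^ (N - 1))⁻¹ with hw
  have hw0 : 0 < w := by positivity
  have hCw : 1 ≤ C * w := by linarith [abs_nonneg (radialS N ‖y - P‖)]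
  have hxcl : x ∈ closure (Ω \ closedBall P ε) := by
    refine subset_closure ?_
    rcases hx with hx | hx
    · exact h.mem_diff (by linarith [hx.1]) (by linarith [hx.2])
    · exact h.mem_diff (by linarith [hx.1]) (by linarith [hx.2])
  have u1 := h.regularPart_le hN hH hy hxcl
  have hMw : M ≤ M * (C * w) := le_mul_of_one_le_right (by positivity) hCw
  have hMc := mul_le_mul_of_nonneg_left hMw hc.le
  have a1 := abs_le.1 (le_refl |radialS N ‖y - P‖|)
  have a2 := abs_le.1 (le_refl |radialS N (‖y - P‖ / 32)|)
  have a3 := abs_le.1 (le_refl |radialS N d|)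
  have a4 := abs_le.1 (le_refl |radialS N (b / 8)|)
  have up : -(radialS N d) + radialS N ‖y - P‖ ≤ (32 ^ (N - 1) + M + 1) * C * w := by
    have : 0 ≤ 32 ^ (N - 1) * (C * w) := by positivity
    have := abs_nonneg (radialS N (b / 8))
    linarith
  have up' := mul_le_mul_of_nonneg_left up hc.le
  have low : -(constS N * ((32 ^ (N - 1) + M + 1) * C * w)) ≤
      H x y + constS N * radialS N ‖y - P‖ := by
    rcases hx with hx | hx
    · have l1 := h.regularPart_ge_inner hN hε hεb hH hy hx.1 hx.2
      have l2 : radialS N (‖y - P‖ / 32) - radialS N ‖y - P‖ ≤ (32 ^ (N - 1) + M + 1) * C * w := by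
        have : 0 ≤ M * (C * w) := by positivity
        linarith
      have l3 := mul_le_mul_of_nonneg_left l2 hc.le
      linarith
    · have l1 := h.regularPart_ge_outer hN hεb hH hy hx.1 hx.2
      have l2 : radialS N (b / 8) - radialS N ‖y - P‖ ≤ (32 ^ (N - 1) + M + 1) * C * w := by
        have : 0 ≤ 32 ^ (N - 1) * (C * w) := by positivity
        have := abs_nonneg (radialS N d)
        linarith
      have l3 := mul_le_mul_of_nonneg_left l2 hc.le
      linarith
  rw [abs_le]
  constructor <;> linarith

set_option maxHeartbeats 800000 in
/-- In dimension two the inner bound improves by a logarithm when `y` is far from the hole. -/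
lemma HoleDomain.abs_regularPart_add_le_two {Ω : Set (EN 2)} {P : EN 2} {b d : ℝ}
    (h : HoleDomain Ω P b d) :
    ∃ C > 0, ∃ ε₁ > 0, ∀ ε, 0 < ε → ε < ε₁ → ∀ H : EN 2 → EN 2 → ℝ,
      IsRegularPart (Ω \ closedBall P ε) (fundS 2) H → ∀ y ∈ Ω \ closedBall P ε,
      √ε ≤ ‖y - P‖ → ∀ x, 2 * ε ≤ ‖x - P‖ → ‖x - P‖ ≤ 8 * ε →
      |H x y + constS 2 * radialS 2 ‖y - P‖| ≤ C * ‖y - P‖⁻¹ / |Real.log ε| := by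
  obtain ⟨C, hC, hCs⟩ := abs_radialS_le (le_refl 2) h.d_pos
  have hc := constS_pos (le_refl 2)
  have hb := h.b_pos
  have hd := h.d_pos
  set q := b / (8 * d) with hq
  have hq0 : 0 < q := by positivity
  have hq32 : q ≤ 1 / 32 := by
    rw [hq, div_le_div_iff₀ (by positivity) (by norm_num)]; linarith [h.b_le]
  have hqd : q * d ≤ b := by rw [hq]; field_simp; linarith
  have hs : ∀ r, radialS 2 r = -Real.log r := fun r => by simp [radialS]
  set M := |radialS 2 d| with hM
  have hM0 : 0 ≤ M := abs_nonneg _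
  have hlog8 : 0 < Real.log 8 := Real.log_pos (by norm_num)
  refine ⟨constS 2 * ((M + 2) * C * 4 * Real.log 8 + 48), by positivity, q ^ 4,
    by positivity, ?_⟩
  intro ε hε hεq H hH y hy hyε x hx1 hx2
  have hsq0 : 0 < √ε := Real.sqrt_pos.2 hε
  have hsq : √ε * √ε = ε := Real.mul_self_sqrt hε.le
  have hsqq : √ε < q ^ 2 := by
    rw [Real.sqrt_lt' (by positivity)]; calc ε < q ^ 4 := hεq
      _ = _ := by ring
  have hsq1 : √ε ≤ q / 32 := by nlinarith
  set Y := ‖y - P‖ with hY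
  have hY0 : 0 < Y := hsq0.trans_le hyε
  have hYd : Y ≤ d := h.norm_sub_center_le hy.1
  have hRε : 8 * ε < q * Y := by nlinarith
  have hY16 : 16 * ε ≤ Y := by nlinarith
  have hRb : q * Y ≤ b := (mul_le_mul_of_nonneg_left hYd hq0.le).trans hqd
  have hRY : q * Y ≤ Y / 2 := by nlinarith
  have hεb : ε < b := by nlinarith
  have hlogε : Real.log ε < 4 * Real.log q := by
    have := Real.log_lt_log hε hεq
    rwa [Real.log_pow] at this
  have hlogq : Real.log q < 0 := Real.log_neg hq0 (by linarith)
  have hlog0 : Real.log ε < 0 := by linarith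
  rw [abs_of_neg hlog0]
  set L := -Real.log ε with hL
  have hL0 : 0 < L := by linarith
  have hlogR : L / 4 ≤ Real.log (q * Y) - Real.log ε := by
    have h1 : Real.log (√ε) = Real.log ε / 2 := Real.log_sqrt hε.le
    have h2 := Real.log_le_log hsq0 hyε
    rw [Real.log_mul hq0.ne' hY0.ne']
    linarith
  -- the Green function on the sphere of radius `q Y`
  have hCY : 1 ≤ C * Y⁻¹ := by
    have := hCs Y hY0 hYd
    simp only [Nat.add_one_sub_one, pow_one] at this
    linarith [abs_nonneg (radialS 2 Y)]
  have hm : radialS 2 (Y / 2) - radialS 2 d ≤ (M + 2) * C * Y⁻¹ := by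
    have h1 := hCs (Y / 2) (by linarith) (by linarith)
    simp only [Nat.add_one_sub_one, pow_one, inv_div] at h1
    have e : 2 / Y = 2 * Y⁻¹ := by ring
    rw [e] at h1
    have h2 : M ≤ M * (C * Y⁻¹) := le_mul_of_one_le_right hM0 hCY
    linarith [le_abs_self (radialS 2 (Y / 2)), neg_le_abs (radialS 2 d)]
  set m := constS 2 * ((M + 2) * C * Y⁻¹) with hmdef
  have hm0 : 0 < m := by positivity
  have hyD := h.isOpen_diff (ε := ε)
  set D := Ω \ closedBall P ε with hD
  set K : Set (EN 2) := closedBall P (q * Y) ∩ {z | ε ≤ ‖z - P‖} with hK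
  set U : Set (EN 2) := ball P (q * Y) ∩ {z | ε < ‖z - P‖} with hU
  have hcont : Continuous fun z : EN 2 => ‖z - P‖ := by fun_prop
  have hUK : U ⊆ K := fun z hz =>
    ⟨ball_subset_closedBall hz.1, show ε ≤ ‖z - P‖ from le_of_lt hz.2⟩
  have hKy : K ⊆ {y}ᶜ := fun z hz hzy => by
    have := hz.1
    rw [mem_singleton_iff.1 hzy, mem_closedBall_iff_norm] at this
    linarith
  have hUD : U ⊆ D := fun z hz => h.mem_diff hz.2 (by
    have := mem_ball_iff_norm.1 hz.1; linarith)
  have hKD : K ⊆ closure D := fun z hz => by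
    have h1 := mem_closedBall_iff_norm.1 hz.1
    rcases eq_or_lt_of_le (show ε ≤ ‖z - P‖ from hz.2) with h2 | h2
    · exact frontier_subset_closure (mem_frontier_of_norm_eq h hε hεb h2.symm)
    · exact subset_closure (h.mem_diff h2 (by linarith))
  have hS : IsHarm (fun z => constS 2 * radialS 2 ‖z - y‖) {y}ᶜ :=
    (isHarm_radialS le_rfl y).const_mul _
  have hxK : x ∈ K := ⟨mem_closedBall_iff_norm.2 (by linarith), by
    change ε ≤ ‖x - P‖; linarith⟩
  have hs1 : 0 < radialS 2 ε - radialS 2 (q * Y) := by rw [hs, hs]; linarith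
  have hG := radial_comparison le_rfl (P := P) (K := K) (U := U) (B := m)
    (t := (0 - m) / (radialS 2 ε - radialS 2 (q * Y))) (b := q * Y)
    (k := fun z => constS 2 * radialS 2 ‖z - y‖ + H z y)
    ((isCompact_closedBall P _).inter_right (isClosed_le continuous_const hcont))
    (isOpen_ball.inter (isOpen_lt continuous_const hcont)) hUK
    (fun hP => by
      have : ε ≤ ‖P - P‖ := hP.2
      rw [sub_self, norm_zero] at this; linarith)
    ((hS.mono hKy).continuousOn.add ((hH y hy).2.2.1.mono hKD))
    ((hS.mono (hUK.trans hKy)).add ((hH.isHarm hyD hy).mono hUD)) ?_ x hxK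
  swap
  · rintro z ⟨⟨h1, h2⟩, h3⟩
    rw [mem_closedBall_iff_norm] at h1
    replace h2 : ε ≤ ‖z - P‖ := h2
    rcases eq_or_lt_of_le h2 with hz | hz
    · rw [hH.eq_of_mem_frontier hy (mem_frontier_of_norm_eq h hε hεb hz.symm), ← hz,
        div_mul_cancel₀ _ hs1.ne']
      linarith
    rcases eq_or_lt_of_le h1 with hz' | hz'
    · rw [hz', sub_self, mul_zero, add_zero]
      have u1 := h.regularPart_le le_rfl hH hy (hKD ⟨mem_closedBall_iff_norm.2 h1, h2⟩)
      have t1 := norm_sub_le_norm_sub_add_norm_sub y z P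
      rw [norm_sub_rev y z] at t1
      have u2 := radialS_le le_rfl (show 0 < Y / 2 by linarith) (show Y / 2 ≤ ‖z - y‖ by linarith)
      have u3 := mul_le_mul_of_nonneg_left (show radialS 2 ‖z - y‖ - radialS 2 d ≤
        (M + 2) * C * Y⁻¹ by linarith) hc.le
      linarith
    · exact absurd ⟨mem_ball_iff_norm.2 hz', hz⟩ h3
  have hGx : constS 2 * radialS 2 ‖x - y‖ + H x y ≤ m * (4 * Real.log 8) / L := by
    refine hG.trans ?_
    have e1 : m + (0 - m) / (radialS 2 ε - radialS 2 (q * Y)) *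
        (radialS 2 ‖x - P‖ - radialS 2 (q * Y)) =
        m * ((Real.log ‖x - P‖ - Real.log ε) / (Real.log (q * Y) - Real.log ε)) := by
      rw [hs, hs, hs]
      have : Real.log (q * Y) - Real.log ε ≠ 0 := by linarith
      have : -Real.log ε - -Real.log (q * Y) ≠ 0 := by intro h0; apply this; linarith
      field_simp; ring
    have e2 : Real.log ‖x - P‖ - Real.log ε ≤ Real.log 8 := by
      have := Real.log_le_log (by linarith) hx2
      rw [Real.log_mul (by norm_num) hε.ne'] at this
      linarith
    have e3 : 0 ≤ Real.log 8 := Real.log_nonneg (by norm_num)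
    rw [e1, mul_div_assoc]
    refine mul_le_mul_of_nonneg_left ?_ hm0.le
    rw [div_le_div_iff₀ (by linarith) hL0]
    nlinarith
  have hxy : x ≠ y := fun hxy => hKy hxK hxy
  have hGx0 := hH.green_nonneg le_rfl hyD h.isBounded_diff hy (hKD hxK) hxy
  -- comparison of the two logarithms
  have t1 := norm_sub_le_norm_sub_add_norm_sub y x P
  have t2 := norm_sub_le_norm_sub_add_norm_sub x y P
  have t3 := norm_sub_le_norm_sub_add_norm_sub x P y
  rw [norm_sub_rev y x] at t1
  rw [norm_sub_rev P y] at t3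
  have hxy2 : Y / 2 ≤ ‖x - y‖ := by linarith
  have hdiff := abs_radialS_sub_le (le_refl 2) (show 0 < ‖x - y‖ by linarith) hY0
  have hdiff' : |radialS 2 ‖x - y‖ - radialS 2 Y| ≤ 48 * Y⁻¹ / L := by
    refine hdiff.trans ?_
    have i1 : ‖x - y‖⁻¹ ≤ 2 * Y⁻¹ := by
      rw [← inv_inv (2:ℝ), ← mul_inv]; gcongr; linarith
    have i2 : |‖x - y‖ - Y| ≤ 8 * ε := by rw [abs_le]; constructor <;> linarith
    have i3 : ε * L ≤ 1 := by
      have := Real.log_le_sub_one_of_pos (show 0 < ε⁻¹ by positivity)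
      rw [Real.log_inv] at this
      have := mul_le_mul_of_nonneg_left this hε.le
      rw [mul_sub, mul_inv_cancel₀ hε.ne'] at this
      linarith
    simp only [Nat.add_one_sub_one, pow_one]
    calc ((2:ℕ):ℝ) * (‖x - y‖⁻¹ + Y⁻¹) * |‖x - y‖ - Y| ≤ 2 * (2 * Y⁻¹ + Y⁻¹) * (8 * ε) := by
          push_cast; gcongr
      _ = 48 * Y⁻¹ * ε := by ring
      _ ≤ 48 * Y⁻¹ / L := by
          rw [le_div_iff₀ hL0, mul_assoc]
          exact mul_le_of_le_one_right (by positivity) i3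
  have hfin := mul_le_mul_of_nonneg_left hdiff' hc.le
  have hab := abs_le.1 (le_refl |radialS 2 ‖x - y‖ - radialS 2 Y|)
  have hab1 := mul_le_mul_of_nonneg_left hab.1 hc.le
  have hab2 := mul_le_mul_of_nonneg_left hab.2 hc.le
  have e5 : constS 2 * ((M + 2) * C * 4 * Real.log 8 + 48) * Y⁻¹ / L =
      m * (4 * Real.log 8) / L + constS 2 * (48 * Y⁻¹ / L) := by
    rw [hmdef]; ring
  have hp : 0 ≤ m * (4 * Real.log 8) / L := hGx0.trans hGx
  rw [e5, abs_le]
  constructor <;> linarith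

end HoleDomain

/-- Weight in the Lipschitz bound at distance `ρ` from the hole of the regular part with pole at
distance `t` from the centre of the hole. -/
def kernelWeight (N : ℕ) (ε ρ t : ℝ) : ℝ :=
  if N = 2 then 1 + 1 / (ρ * |Real.log ε|) + (if t < √ε then 1 / ρ else 0)
  else 1 + ε ^ (N - 2) / ρ ^ (N - 1)

section

variable {N : ℕ} {Ω : Set (EN N)} {P : EN N} {b d : ℝ}

lemma HoleDomain.sub_le_annulusBound (h : HoleDomain Ω P b d) (hN : 2 ≤ N) {ε κ σ : ℝ}
    (hε : 0 < ε) {H : EN N → EN N → ℝ}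
    (hH : IsRegularPart (Ω \ closedBall P ε) (fundS N) H) {y : EN N}
    (hy : y ∈ Ω \ closedBall P ε)
    (hκ : ∀ x, 2 * ε ≤ ‖x - P‖ → ‖x - P‖ ≤ 8 * ε →
      |H x y + constS N * radialS N ‖y - P‖| ≤ κ)
    (hσ : ∀ x, b / 2 ≤ ‖x - P‖ → ‖x - P‖ ≤ 2 * b →
      |H x y + constS N * radialS N ‖y - P‖| ≤ σ)
    {x₀ x x' : EN N} (h1 : 8 * ε ≤ ‖x₀ - P‖) (h2 : 2 * ‖x₀ - P‖ ≤ b)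
    (hx : ‖x - x₀‖ ≤ ‖x₀ - P‖ / 4) (hx' : ‖x' - x₀‖ ≤ ‖x₀ - P‖ / 4) :
    |H x y - H x' y| ≤ 4 * N * (16 * N + 4 * 2 ^ N) *
      annulusBound N (4 * ε) b κ σ ‖x₀ - P‖ * ‖x - x'‖ := by
  have hb := h.b_pos
  have hk : IsHarm (fun z => H z y + constS N * radialS N ‖y - P‖)
      {z | 4 * ε / 2 ≤ ‖z - P‖ ∧ ‖z - P‖ ≤ 2 * b} :=
    ((hH.isHarm h.isOpen_diff hy).mono fun z hz =>
      h.mem_diff (by linarith [hz.1]) (by linarith [hz.2])).add (isHarm_const _ _)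
  have key : ∀ x x' : EN N, ‖x - x₀‖ ≤ ‖x₀ - P‖ / 4 → ‖x' - x₀‖ ≤ ‖x₀ - P‖ / 4 →
      H x y - H x' y ≤ 4 * N * (16 * N + 4 * 2 ^ N) *
      annulusBound N (4 * ε) b κ σ ‖x₀ - P‖ * ‖x - x'‖ := by
    intro x x' hx hx'
    have := annulus_lipschitz hN (a := 4 * ε) (by linarith) hk
      (fun z hz hz' => hκ z (by linarith) (by linarith)) hσ (by linarith) h2 hx hx'
    linarith
  have k1 := key x x' hx hx'
  have k2 := key x' x hx' hx
  rw [norm_sub_rev x' x] at k2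
  rw [abs_le]
  constructor <;> linarith

/-- Lipschitz bound for the regular part away from the hole. -/
lemma HoleDomain.abs_regularPart_sub_le (h : HoleDomain Ω P b d) (hN : 2 ≤ N) :
    ∃ C > 0, ∃ ε₁ > 0, ∀ ε, 0 < ε → ε < ε₁ → ∀ H : EN N → EN N → ℝ,
      IsRegularPart (Ω \ closedBall P ε) (fundS N) H → ∀ y ∈ Ω \ closedBall P ε,
      ∀ x₀ x x' : EN N, 8 * ε ≤ ‖x₀ - P‖ → 2 * ‖x₀ - P‖ ≤ b → ‖x - x₀‖ ≤ ‖x₀ - P‖ / 4 →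
      ‖x' - x₀‖ ≤ ‖x₀ - P‖ / 4 →
      |H x y - H x' y| ≤
        C * ((‖y - P‖ ^ (N - 1))⁻¹ * kernelWeight N ε ‖x₀ - P‖ ‖y - P‖) * ‖x - x'‖ := by
  have hb := h.b_pos
  obtain ⟨C₁, hC₁, hK⟩ := h.abs_regularPart_add_le hN
  by_cases hN2 : N = 2
  · subst hN2
    obtain ⟨C₂, hC₂, ε₁, hε₁, hK₂⟩ := h.abs_regularPart_add_le_two
    refine ⟨4 * (2:ℕ) * (16 * (2:ℕ) + 4 * 2 ^ 2) * (C₁ / b + 3 * C₁ + C₂), by positivity,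
      min (min ε₁ (b / 16)) (min 1 ((b / 4) ^ 2)), by positivity, ?_⟩
    intro ε hε hεm H hH y hy x₀ x x' h1 h2 hx hx'
    obtain ⟨h3, h4⟩ := lt_min_iff.1 hεm
    obtain ⟨hεε, hεb⟩ := lt_min_iff.1 h3
    obtain ⟨hε1, hεb2⟩ := lt_min_iff.1 h4
    have hy0 : 0 < ‖y - P‖ := hε.trans (lt_norm_of_mem_diff hy)
    have hlog : Real.log ε < 0 := Real.log_neg hε hε1
    have hL0 : 0 < |Real.log ε| := abs_pos.2 hlog.ne
    have hlogb : |Real.log ε| / 2 ≤ Real.log (b / (4 * ε)) := by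
      have e1 := Real.log_lt_log hε hεb2
      rw [Real.log_pow] at e1
      rw [abs_of_neg hlog, show b / (4 * ε) = b / 4 / ε by field_simp,
        Real.log_div (by positivity) hε.ne']
      push_cast at e1
      linarith
    set ρ := ‖x₀ - P‖ with hρ
    have hρ0 : 0 < ρ := by linarith
    set w := ‖y - P‖⁻¹ with hw
    have hw0 : 0 < w := by positivity
    set κ := if ‖y - P‖ < √ε then C₁ * w else C₂ * w / |Real.log ε| with hκ
    have hmain := h.sub_le_annulusBound le_rfl (κ := κ) (σ := C₁ * w) hε hH hy
      (fun z hz hz' => by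
        rw [hκ]
        split_ifs with hlt
        · simpa using hK ε hε (by linarith) H hH y hy z (Or.inl ⟨hz, hz'⟩)
        · exact hK₂ ε hε hεε H hH y hy (not_lt.1 hlt) z hz hz')
      (fun z hz hz' => by simpa using hK ε hε (by linarith) H hH y hy z (Or.inr ⟨hz, hz'⟩))
      h1 h2 hx hx'
    refine hmain.trans ?_
    rw [mul_assoc _ (C₁ / b + 3 * C₁ + C₂)]
    refine mul_le_mul_of_nonneg_right (mul_le_mul_of_nonneg_left ?_ (by positivity))
      (norm_nonneg _)
    simp only [annulusBound, kernelWeight, if_true, Nat.add_one_sub_one, pow_one]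
    have i1 : C₁ * w / Real.log (b / (4 * ε)) ≤ C₁ * w * 2 / |Real.log ε| := by
      rw [div_le_div_iff₀ (by linarith) hL0]
      nlinarith [mul_pos hC₁ hw0]
    set l := 1 / |Real.log ε| with hl
    have hl0 : 0 < l := by positivity
    set χ : ℝ := if ‖y - P‖ < √ε then 1 else 0 with hχ
    have hχ0 : 0 ≤ χ := by rw [hχ]; split_ifs <;> norm_num
    have i2 : κ ≤ (C₁ + C₂) * w * (l + χ) := by
      rw [hκ, hχ]
      have p1 : 0 ≤ C₁ * w * l := by positivity
      have p2 : 0 ≤ C₂ * w * l := by positivity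
      have p3 : 0 ≤ C₂ * w := by positivity
      have e : C₂ * w / |Real.log ε| = C₂ * w * l := by rw [hl]; ring
      rw [e]
      split_ifs <;> nlinarith
    have i3 : (κ + C₁ * w / Real.log (b / (4 * ε))) / ρ ≤
        (3 * C₁ + C₂) * w * (l + χ) / ρ := by
      gcongr
      have e : C₁ * w * 2 / |Real.log ε| = 2 * C₁ * w * l := by rw [hl]; ring
      rw [e] at i1
      have : 0 ≤ C₁ * w * χ := by positivity
      nlinarith
    have e4 : 1 + 1 / (ρ * |Real.log ε|) + (if ‖y - P‖ < √ε then 1 / ρ else 0) =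
        1 + (l + χ) / ρ := by
      rw [hl, hχ]
      split_ifs
      · field_simp
        ring
      · field_simp
        ring
    rw [e4]
    have p5 : 0 ≤ (l + χ) / ρ := by positivity
    have e5 : (3 * C₁ + C₂) * w * (l + χ) / ρ = (3 * C₁ + C₂) * w * ((l + χ) / ρ) := by ring
    have e6 : C₁ * w / b = C₁ / b * w := by ring
    rw [e5] at i3
    rw [e6]
    have p6 : 0 ≤ C₁ / b * w * ((l + χ) / ρ) := by positivity
    have p7 : 0 ≤ (3 * C₁ + C₂) * w := by positivity
    linarith
  · obtain ⟨n, rfl⟩ : ∃ n, N = n + 3 := ⟨N - 3, by omega⟩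
    refine ⟨4 * (n + 3 : ℕ) * (16 * (n + 3 : ℕ) + 4 * 2 ^ (n + 3)) *
      (C₁ / b + 2 * C₁ * 4 ^ (n + 1)), by positivity, b / 16, by positivity, ?_⟩
    intro ε hε hεb H hH y hy x₀ x x' h1 h2 hx hx'
    have hy0 : 0 < ‖y - P‖ := hε.trans (lt_norm_of_mem_diff hy)
    set ρ := ‖x₀ - P‖ with hρ
    have hρ0 : 0 < ρ := by linarith
    set w := (‖y - P‖ ^ (n + 3 - 1))⁻¹ with hw
    have hw0 : 0 < w := by positivity
    have hmain := h.sub_le_annulusBound hN (κ := C₁ * w) (σ := C₁ * w) hε hH hy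
      (fun z hz hz' => hK ε hε (by linarith) H hH y hy z (Or.inl ⟨hz, hz'⟩))
      (fun z hz hz' => hK ε hε (by linarith) H hH y hy z (Or.inr ⟨hz, hz'⟩)) h1 h2 hx hx'
    refine hmain.trans ?_
    rw [mul_assoc _ (C₁ / b + 2 * C₁ * 4 ^ (n + 1))]
    refine mul_le_mul_of_nonneg_right (mul_le_mul_of_nonneg_left ?_ (by positivity))
      (norm_nonneg _)
    simp only [annulusBound, kernelWeight, if_neg hN2, show n + 3 - 2 = n + 1 by omega,
      show n + 3 - 1 = n + 2 by omega]
    have e1 : C₁ * w / b + (C₁ * w + C₁ * w) * (4 * ε / ρ) ^ (n + 1) / ρ =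
        C₁ / b * w + 2 * C₁ * 4 ^ (n + 1) * w * (ε ^ (n + 1) / ρ ^ (n + 2)) := by
      rw [div_pow, mul_pow]; field_simp; ring
    rw [e1]
    have p1 : 0 ≤ C₁ / b * w * (ε ^ (n + 1) / ρ ^ (n + 2)) := by positivity
    have p2 : 0 ≤ 2 * C₁ * 4 ^ (n + 1) * w := by positivity
    linarith

end

section RieszKernel

variable {N : ℕ} {D : Set (EN N)} {g : EN N → ℝ} {M r : ℝ}

lemma pow_smul_indicator_inv_pow (n : ℕ) (r : ℝ) {t : ℝ} (ht : t ∈ Ioi (0 : ℝ)) :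
    t ^ n • (Iio r).indicator (fun s => (s ^ n)⁻¹) t = (Iio r).indicator (fun _ => (1 : ℝ)) t := by
  have h : t ^ n ≠ 0 := pow_ne_zero _ (ne_of_gt ht)
  by_cases htr : t < r
  · simp [indicator, htr, h]
  · simp [indicator, htr]

lemma indicator_ball_inv_pow (x : EN N) (r : ℝ) (n : ℕ) :
    (ball x r).indicator (fun y => (‖x - y‖ ^ n)⁻¹) =
      fun y => (Iio r).indicator (fun s => (s ^ n)⁻¹) ‖y - x‖ := by
  ext y
  simp only [indicator, mem_ball_iff_norm, mem_Iio, norm_sub_rev x y]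

lemma integrableOn_ball_inv_pow (hN : 2 ≤ N) (x : EN N) (r : ℝ) :
    IntegrableOn (fun y => (‖x - y‖ ^ (N - 1))⁻¹) (ball x r) := by
  have : NeZero N := ⟨by omega⟩
  rw [← integrable_indicator_iff measurableSet_ball, indicator_ball_inv_pow]
  refine Integrable.comp_sub_right
    (f := fun z : EN N => (Iio r).indicator (fun s : ℝ => (s ^ (N - 1))⁻¹) ‖z‖) ?_ x
  rw [integrable_fun_norm_addHaar volume, finrank_euclideanSpace_fin,
    integrableOn_congr_fun (fun t ht => pow_smul_indicator_inv_pow (N - 1) r ht) measurableSet_Ioi,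
    integrableOn_indicator_iff measurableSet_Iio, Iio_inter_Ioi]
  exact integrableOn_const (by simp)

lemma setIntegral_ball_inv_pow (hN : 2 ≤ N) (x : EN N) (hr : 0 ≤ r) :
    ∫ y in ball x r, (‖x - y‖ ^ (N - 1))⁻¹ = N * volume.real (ball (0 : EN N) 1) * r := by
  have : NeZero N := ⟨by omega⟩
  rw [← integral_indicator measurableSet_ball, indicator_ball_inv_pow,
    integral_sub_right_eq_self
      (fun z : EN N => (Iio r).indicator (fun s : ℝ => (s ^ (N - 1))⁻¹) ‖z‖) x,
    integral_fun_norm_addHaar volume, finrank_euclideanSpace_fin,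
    setIntegral_congr_fun measurableSet_Ioi
      (fun t ht => pow_smul_indicator_inv_pow (N - 1) r ht),
    setIntegral_indicator measurableSet_Iio, Ioi_inter_Iio]
  simp [hr, mul_assoc]

lemma integrableOn_inv_pow (hN : 2 ≤ N) (hD : Bornology.IsBounded D) (x : EN N) :
    IntegrableOn (fun y => (‖x - y‖ ^ (N - 1))⁻¹) D := by
  obtain ⟨r, hr⟩ := hD.subset_ball x
  exact (integrableOn_ball_inv_pow hN x r).mono_set hr

lemma integrableOn_abs_mul_inv_pow (hN : 2 ≤ N) (hD : Bornology.IsBounded D)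
    (hDm : MeasurableSet D) (hg : ContinuousOn g D) (hM : ∀ y ∈ D, |g y| ≤ M) (x : EN N) :
    IntegrableOn (fun y => |g y| * (‖x - y‖ ^ (N - 1))⁻¹) D := by
  refine (integrableOn_inv_pow hN hD x).bdd_mul (c := M)
    (hg.abs.aestronglyMeasurable hDm) ?_
  filter_upwards [ae_restrict_mem hDm] with y hy
  simpa using hM y hy

lemma integrableOn_abs_of_continuousOn (hD : Bornology.IsBounded D) (hDm : MeasurableSet D)
    (hg : ContinuousOn g D) (hM : ∀ y ∈ D, |g y| ≤ M) : IntegrableOn (fun y => |g y|) D := by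
  refine IntegrableOn.of_bound hD.measure_lt_top (hg.abs.aestronglyMeasurable hDm) M ?_
  filter_upwards [ae_restrict_mem hDm] with y hy
  simpa using hM y hy

lemma setIntegral_abs_mul_inv_pow_le (hN : 2 ≤ N) (hD : Bornology.IsBounded D)
    (hDm : MeasurableSet D) (hg : ContinuousOn g D) (hM0 : 0 ≤ M) (hM : ∀ y ∈ D, |g y| ≤ M)
    (hr : 0 < r) (x : EN N) :
    ∫ y in D, |g y| * (‖x - y‖ ^ (N - 1))⁻¹ ≤
      M * (N * volume.real (ball (0 : EN N) 1) * r) + (r ^ (N - 1))⁻¹ * ∫ y in D, |g y| := by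
  have hI := integrableOn_abs_mul_inv_pow hN hD hDm hg hM x
  have hgi := integrableOn_abs_of_continuousOn hD hDm hg hM
  have hball := integrableOn_ball_inv_pow hN x r
  rw [← integrable_indicator_iff measurableSet_ball] at hball
  calc ∫ y in D, |g y| * (‖x - y‖ ^ (N - 1))⁻¹
      ≤ ∫ y in D, (M * (ball x r).indicator (fun y => (‖x - y‖ ^ (N - 1))⁻¹) y +
          (r ^ (N - 1))⁻¹ * |g y|) := by
        refine setIntegral_mono_on hI
          ((hball.integrableOn.const_mul M).add (hgi.const_mul _)) hDm fun y hy => ?_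
        by_cases hyr : y ∈ ball x r
        · rw [indicator_of_mem hyr]
          have := mul_le_mul_of_nonneg_right (hM y hy)
            (by positivity : 0 ≤ (‖x - y‖ ^ (N - 1))⁻¹)
          have : 0 ≤ (r ^ (N - 1))⁻¹ * |g y| := by positivity
          linarith
        · rw [indicator_of_notMem hyr, mul_zero, zero_add, mul_comm]
          rw [mem_ball_iff_norm, norm_sub_rev, not_lt] at hyr
          gcongr
    _ = M * (∫ y in D, (ball x r).indicator (fun y => (‖x - y‖ ^ (N - 1))⁻¹) y) +
          (r ^ (N - 1))⁻¹ * ∫ y in D, |g y| := by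
        rw [integral_add (hball.integrableOn.const_mul M) (hgi.const_mul _),
          integral_const_mul, integral_const_mul]
    _ ≤ _ := by
        gcongr
        rw [← setIntegral_ball_inv_pow hN x hr.le, ← integral_indicator measurableSet_ball]
        refine setIntegral_le_integral hball (Eventually.of_forall fun y => ?_)
        exact indicator_nonneg (fun _ _ => by positivity) y

end RieszKernel

section Setting

variable {N : ℕ} {Ω : Set (EN N)} {P : EN N} {f : ℝ → ℝ} {ε₀ C : ℝ}
  {u : ℝ → EN N → ℝ} {u₀ : EN N → ℝ}

lemma Setting.exists_abs_le (h : Setting Ω P f ε₀ C u u₀) :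
    ∃ R, (∀ x ∈ Ω, |u₀ x| ≤ R) ∧
      ∀ ε ∈ Ioo (0 : ℝ) ε₀, ∀ x ∈ Ω \ closedBall P ε, |u ε x| ≤ R := by
  obtain ⟨-, hb, -, -, -, -, hC, h₀, -⟩ := h
  obtain ⟨R, hR⟩ := hb.isCompact_closure.exists_bound_of_continuousOn h₀.2.2.2.1
  exact ⟨max R C, fun x hx => (hR x (subset_closure hx)).trans (le_max_left _ _),
    fun ε hε x hx => (hC ε hε x hx).trans (le_max_right _ _)⟩

lemma Setting.exists_abs_sub_le (h : Setting Ω P f ε₀ C u u₀) :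
    ∃ M > 0, ∀ ε ∈ Ioo (0 : ℝ) ε₀, ∀ y ∈ Ω \ closedBall P ε, |f (u ε y) - f (u₀ y)| ≤ M := by
  obtain ⟨R, hR₀, hR⟩ := h.exists_abs_le
  obtain ⟨-, -, -, hf, -⟩ := h
  obtain ⟨F, hF⟩ := (isCompact_Icc (a := -R) (b := R)).exists_bound_of_continuousOn
    hf.continuous.continuousOn
  refine ⟨2 * |F| + 1, by positivity, fun ε hε y hy => ?_⟩
  have h1 := hF _ (abs_le.1 (hR ε hε y hy))
  have h2 := hF _ (abs_le.1 (hR₀ y hy.1))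
  rw [Real.norm_eq_abs] at h1 h2
  linarith [abs_sub (f (u ε y)) (f (u₀ y)), le_abs_self F]

lemma Setting.continuousOn_sub (h : Setting Ω P f ε₀ C u u₀) {ε : ℝ} (hε : ε ∈ Ioo (0 : ℝ) ε₀) :
    ContinuousOn (fun y => f (u ε y) - f (u₀ y)) (Ω \ closedBall P ε) := by
  obtain ⟨-, -, -, hf, -, hu, -, h₀, -⟩ := h
  exact (hf.continuous.comp_continuousOn (hu ε hε).1.continuousOn).sub
    (hf.continuous.comp_continuousOn (h₀.1.continuousOn.mono sdiff_subset))

lemma Setting.eventually_abs_sub_le (h : Setting Ω P f ε₀ C u u₀) {K : Set (EN N)}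
    (hK : K ⊆ Ω \ {P}) (hKc : IsCompact K) {σ : ℝ} (hσ : 0 < σ) :
    ∀ᶠ ε in 𝓝[>] (0 : ℝ), ∀ y ∈ K, y ∈ Ω \ closedBall P ε → |f (u ε y) - f (u₀ y)| ≤ σ := by
  obtain ⟨R, hR₀, hR⟩ := h.exists_abs_le
  obtain ⟨-, -, -, hf, hε₀, -, -, -, hconv⟩ := h
  have huc := (isCompact_Icc (a := -R) (b := R)).uniformContinuousOn_of_continuous
    hf.continuous.continuousOn
  obtain ⟨τ, hτ, huc⟩ := Metric.uniformContinuousOn_iff.1 huc σ hσ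
  filter_upwards [Metric.tendstoUniformlyOn_iff.1 (hconv K hK hKc).1 τ hτ,
    Ioo_mem_nhdsGT hε₀] with ε hε hε' y hyK hy
  rw [← Real.dist_eq, dist_comm]
  exact (huc _ (abs_le.1 (hR₀ y hy.1)) _ (abs_le.1 (hR ε hε' y hy)) (hε y hyK)).le

lemma Setting.eventually_setIntegral_abs_sub_le (h : Setting Ω P f ε₀ C u u₀) {τ : ℝ}
    (hτ : 0 < τ) :
    ∀ᶠ ε in 𝓝[>] (0 : ℝ), ∫ y in Ω \ closedBall P ε, |f (u ε y) - f (u₀ y)| ≤ τ := by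
  obtain ⟨M, hM0, hM⟩ := h.exists_abs_sub_le
  have hΩ : IsOpen Ω := h.1
  have hb : Bornology.IsBounded Ω := h.2.1
  have hε₀ : 0 < ε₀ := h.2.2.2.2.1
  have hΩP : MeasurableSet (Ω \ {P}) := hΩ.measurableSet.diff (measurableSet_singleton P)
  obtain ⟨K, hKΩ, hK, hKlt⟩ := hΩP.exists_isCompact_sdiff_lt
    (μ := (volume : Measure (EN N))) (hb.subset sdiff_subset).measure_lt_top.ne
    (ENNReal.ofReal_pos.2 (div_pos (half_pos hτ) hM0)).ne'
  have hV : (0 : ℝ) ≤ volume.real Ω := measureReal_nonneg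
  have hσ : 0 < τ / 2 / (volume.real Ω + 1) := by positivity
  filter_upwards [h.eventually_abs_sub_le hKΩ hK hσ, Ioo_mem_nhdsGT hε₀] with ε hε hε'
  have hDm : MeasurableSet (Ω \ closedBall P ε) := hΩ.measurableSet.diff measurableSet_closedBall
  have hDb : Bornology.IsBounded (Ω \ closedBall P ε) := hb.subset sdiff_subset
  have hfin : volume (Ω \ closedBall P ε) ≠ ⊤ := hDb.measure_lt_top.ne
  have hgi := integrableOn_abs_of_continuousOn hDb hDm (h.continuousOn_sub hε') (hM ε hε')
  have hKm := hΩP.diff hK.measurableSet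
  have hind : Integrable (((Ω \ {P}) \ K).indicator fun _ => M) :=
    (integrable_indicator_iff hKm).2
      (integrableOn_const (hb.subset (sdiff_subset.trans sdiff_subset)).measure_lt_top.ne)
  calc ∫ y in Ω \ closedBall P ε, |f (u ε y) - f (u₀ y)|
      ≤ ∫ y in Ω \ closedBall P ε, (τ / 2 / (volume.real Ω + 1) +
          ((Ω \ {P}) \ K).indicator (fun _ => M) y) := by
        refine setIntegral_mono_on hgi ((integrableOn_const hfin).add hind.integrableOn) hDm
          fun y hy => ?_
        by_cases hyK : y ∈ K
        · rw [indicator_of_notMem fun h => h.2 hyK, add_zero]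
          exact hε y hyK hy
        · have hyP : y ≠ P := by
            rintro rfl
            exact hy.2 (mem_closedBall_self hε'.1.le)
          rw [indicator_of_mem (show y ∈ (Ω \ {P}) \ K from ⟨⟨hy.1, hyP⟩, hyK⟩)]
          linarith [hM ε hε' y hy]
    _ = volume.real (Ω \ closedBall P ε) * (τ / 2 / (volume.real Ω + 1)) +
          ∫ y in Ω \ closedBall P ε, ((Ω \ {P}) \ K).indicator (fun _ => M) y := by
        rw [integral_add (integrableOn_const (μ := volume) hfin).integrable
          hind.integrableOn.integrable, setIntegral_const,
          smul_eq_mul]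
    _ ≤ volume.real Ω * (τ / 2 / (volume.real Ω + 1)) + volume.real ((Ω \ {P}) \ K) * M := by
        gcongr
        · exact hb.measure_lt_top.ne
        · exact sdiff_subset
        · refine (setIntegral_le_integral hind (Eventually.of_forall fun y =>
            indicator_nonneg (fun _ _ => hM0.le) y)).trans_eq ?_
          rw [integral_indicator hKm, setIntegral_const, smul_eq_mul]
    _ ≤ τ / 2 + τ / 2 := by
        refine add_le_add ?_ ?_
        · rw [mul_div_assoc', div_le_iff₀ (by positivity)]
          nlinarith
        · rw [← le_div_iff₀ hM0]
          exact ENNReal.toReal_le_of_le_ofReal (by positivity) hKlt.le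
    _ = τ := by ring

lemma Setting.eventually_setIntegral_mul_inv_pow_le (hN : 2 ≤ N) (h : Setting Ω P f ε₀ C u u₀)
    {τ : ℝ} (hτ : 0 < τ) :
    ∀ᶠ ε in 𝓝[>] (0 : ℝ), ∀ x : EN N,
      ∫ y in Ω \ closedBall P ε, |f (u ε y) - f (u₀ y)| * (‖x - y‖ ^ (N - 1))⁻¹ ≤ τ := by
  obtain ⟨M, hM0, hM⟩ := h.exists_abs_sub_le
  set V := (N : ℝ) * volume.real (ball (0 : EN N) 1)
  have hV : 0 ≤ V := mul_nonneg N.cast_nonneg measureReal_nonneg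
  set r := τ / 2 / (M * (V + 1))
  have hr : 0 < r := by positivity
  filter_upwards [h.eventually_setIntegral_abs_sub_le
      (show 0 < τ / 2 * r ^ (N - 1) by positivity), Ioo_mem_nhdsGT h.2.2.2.2.1] with ε hε hε' x
  refine (setIntegral_abs_mul_inv_pow_le hN (h.2.1.subset sdiff_subset)
    (h.1.measurableSet.diff measurableSet_closedBall) (h.continuousOn_sub hε') hM0.le
    (hM ε hε') hr x).trans ?_
  have h1 : M * (V * r) ≤ τ / 2 := by
    calc M * (V * r) ≤ M * ((V + 1) * r) := by gcongr; linarith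
      _ = τ / 2 := by
        simp only [r]
        field_simp
  have h2 : (r ^ (N - 1))⁻¹ * ∫ y in Ω \ closedBall P ε, |f (u ε y) - f (u₀ y)| ≤ τ / 2 := by
    rw [inv_mul_le_iff₀ (by positivity)]
    linarith
  linarith

end Setting

section GreenPotential

variable {N : ℕ} {Ω : Set (EN N)} {P : EN N} {b d ε M : ℝ} {H : EN N → EN N → ℝ} {g : EN N → ℝ}
  {x : EN N}

lemma HoleDomain.abs_green_le (h : HoleDomain Ω P b d) (hN : 2 ≤ N) :
    ∃ C > 0, ∀ ε, ∀ H, IsRegularPart (Ω \ closedBall P ε) (fundS N) H →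
      ∀ x ∈ Ω \ closedBall P ε, ∀ y ∈ Ω \ closedBall P ε, x ≠ y →
        |fundS N x y + H x y| ≤ C * (‖x - y‖ ^ (N - 1))⁻¹ := by
  obtain ⟨C, hC, hCb⟩ := abs_radialS_le hN h.d_pos
  have hS := constS_pos hN
  refine ⟨constS N * ((1 + |radialS N d|) * C), by positivity, fun ε H hH x hx y hy hxy => ?_⟩
  have h0 := hH.green_nonneg hN h.isOpen_diff h.isBounded_diff hy (subset_closure hx) hxy
  have h1 := h.regularPart_le hN hH hy (subset_closure hx)
  have ht : 0 < ‖x - y‖ := norm_sub_pos_iff.2 hxy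
  have h2 := hCb _ ht (h.norm_le x (subset_closure hx.1) y hy.1)
  rw [fundS_eq, abs_of_nonneg h0, mul_assoc, mul_assoc]
  calc constS N * radialS N ‖x - y‖ + H x y
      ≤ constS N * (radialS N ‖x - y‖ - radialS N d) := by linarith
    _ ≤ constS N * ((1 + |radialS N d|) * (|radialS N ‖x - y‖| + 1)) := by
        gcongr
        nlinarith [le_abs_self (radialS N ‖x - y‖), neg_abs_le (radialS N d),
          mul_nonneg (abs_nonneg (radialS N d)) (abs_nonneg (radialS N ‖x - y‖))]
    _ ≤ _ := by gcongr

lemma measurable_fundS (x : EN N) : Measurable (fundS N x) := by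
  unfold fundS
  split_ifs <;> fun_prop

lemma ae_ne_of_two_le (hN : 2 ≤ N) (x : EN N) (D : Set (EN N)) :
    ∀ᵐ y ∂(volume.restrict D), x ≠ y := by
  have : NeZero N := ⟨by omega⟩
  refine ae_restrict_of_ae ?_
  filter_upwards [compl_mem_ae_iff.2 (measure_singleton x)] with y hy h
  exact hy h.symm

lemma HoleDomain.exists_integrableOn_mul_green (h : HoleDomain Ω P b d) (hN : 2 ≤ N) :
    ∃ C > 0, ∀ ε, ∀ H, IsRegularPart (Ω \ closedBall P ε) (fundS N) H →
      ∀ g M, ContinuousOn g (Ω \ closedBall P ε) → (∀ y ∈ Ω \ closedBall P ε, |g y| ≤ M) →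
      ∀ x ∈ Ω \ closedBall P ε,
        IntegrableOn (fun y => g y * (fundS N x y + H x y)) (Ω \ closedBall P ε) ∧
        |∫ y in Ω \ closedBall P ε, g y * (fundS N x y + H x y)| ≤
          C * ∫ y in Ω \ closedBall P ε, |g y| * (‖x - y‖ ^ (N - 1))⁻¹ := by
  obtain ⟨C, hC, hG⟩ := h.abs_green_le hN
  refine ⟨C, hC, fun ε H hH g M hg hM x hx => ?_⟩
  have hDm : MeasurableSet (Ω \ closedBall P ε) := h.isOpen_diff.measurableSet
  have hI := (integrableOn_abs_mul_inv_pow hN h.isBounded_diff hDm hg hM x).integrable.const_mul C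
  have hmeas : AEStronglyMeasurable (fun y => g y * (fundS N x y + H x y))
      (volume.restrict (Ω \ closedBall P ε)) :=
    (hg.aestronglyMeasurable hDm).mul ((measurable_fundS x).aestronglyMeasurable.add
      ((hH.continuousOn_right hN h.isOpen_diff h.isBounded_diff
        (subset_closure hx)).aestronglyMeasurable hDm))
  have hb : ∀ᵐ y ∂(volume.restrict (Ω \ closedBall P ε)),
      ‖g y * (fundS N x y + H x y)‖ ≤ C * (|g y| * (‖x - y‖ ^ (N - 1))⁻¹) := by
    filter_upwards [ae_restrict_mem hDm, ae_ne_of_two_le hN x _] with y hy hxy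
    rw [Real.norm_eq_abs, abs_mul]
    calc |g y| * |fundS N x y + H x y| ≤ |g y| * (C * (‖x - y‖ ^ (N - 1))⁻¹) := by
          gcongr
          exact hG ε H hH x hx y hy hxy
      _ = _ := by ring
  refine ⟨hI.mono' hmeas hb, ?_⟩
  rw [← integral_const_mul, ← Real.norm_eq_abs]
  exact norm_integral_le_of_norm_le hI hb

/-- The growth rate of the gradient at distance `ρ` from the center of a hole of radius `ε`. -/
def gradWeight (N : ℕ) (ε ρ : ℝ) : ℝ :=
  if N = 2 then 1 + 1 / (ρ * |Real.log ε|) else 1 + ε ^ (N - 2) / ρ ^ (N - 1)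

lemma one_le_gradWeight {ε ρ : ℝ} (hε : 0 ≤ ε) (hρ : 0 ≤ ρ) : 1 ≤ gradWeight N ε ρ := by
  unfold gradWeight
  split_ifs <;> exact le_add_of_nonneg_right (by positivity)

lemma kernelWeight_le {ε ρ : ℝ} (hε : 0 < ε) (hε1 : ε < 1) (hρ : 0 < ρ) (t : ℝ) :
    kernelWeight N ε ρ t ≤ gradWeight N ε ρ * (1 + if t < √ε then |Real.log ε| else 0) := by
  have hlog : 0 < |Real.log ε| := abs_pos.2 (Real.log_neg hε hε1).ne
  have h0 : 0 ≤ gradWeight N ε ρ := zero_le_one.trans (one_le_gradWeight hε.le hρ.le)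
  by_cases hN : N = 2
  · simp only [kernelWeight, gradWeight, if_pos hN] at h0 ⊢
    split_ifs
    · have : 1 / ρ = 1 / (ρ * |Real.log ε|) * |Real.log ε| := by field_simp
      rw [this]
      nlinarith
    · simp
  · simp only [kernelWeight, gradWeight, if_neg hN] at h0 ⊢
    exact le_mul_of_one_le_right h0 (le_add_of_nonneg_right (by split_ifs <;> positivity))

lemma setIntegral_gradWeight_le (hN : 2 ≤ N) {D : Set (EN N)} (hD : Bornology.IsBounded D)
    (hDm : MeasurableSet D) (hg : ContinuousOn g D) (hM0 : 0 ≤ M) (hM : ∀ y ∈ D, |g y| ≤ M)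
    {ρ : ℝ} (hε : 0 < ε) (hρ : 0 < ρ) (P : EN N) :
    IntegrableOn (fun y => |g y| * ((‖y - P‖ ^ (N - 1))⁻¹ *
      (gradWeight N ε ρ * (1 + if ‖y - P‖ < √ε then |Real.log ε| else 0)))) D ∧
    ∫ y in D, |g y| * ((‖y - P‖ ^ (N - 1))⁻¹ *
        (gradWeight N ε ρ * (1 + if ‖y - P‖ < √ε then |Real.log ε| else 0))) ≤
      gradWeight N ε ρ * ((∫ y in D, |g y| * (‖P - y‖ ^ (N - 1))⁻¹) +
        M * (N * volume.real (ball (0 : EN N) 1)) * (√ε * |Real.log ε|)) := by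
  have h0 : 0 ≤ gradWeight N ε ρ := zero_le_one.trans (one_le_gradWeight hε.le hρ.le)
  have hI := (integrableOn_abs_mul_inv_pow hN hD hDm hg hM P).integrable
  have hball := integrableOn_ball_inv_pow hN P (√ε)
  rw [← integrable_indicator_iff measurableSet_ball] at hball
  have hmeas := hg.abs.aestronglyMeasurable hDm (μ := volume)
  have hbd : ∀ᵐ y ∂(volume.restrict D), ‖|g y|‖ ≤ M := by
    filter_upwards [ae_restrict_mem hDm] with y hy
    simpa using hM y hy
  have hgb : IntegrableOn
      (fun y => |g y| * (ball P √ε).indicator (fun y => (‖P - y‖ ^ (N - 1))⁻¹) y) D :=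
    hball.integrableOn.bdd_mul hmeas hbd
  have heq : ∀ y, |g y| * ((‖y - P‖ ^ (N - 1))⁻¹ *
      (gradWeight N ε ρ * (1 + if ‖y - P‖ < √ε then |Real.log ε| else 0))) =
      gradWeight N ε ρ * (|g y| * (‖P - y‖ ^ (N - 1))⁻¹ + |Real.log ε| *
        (|g y| * (ball P √ε).indicator (fun y => (‖P - y‖ ^ (N - 1))⁻¹) y)) := by
    intro y
    rw [norm_sub_rev y P]
    simp only [indicator, mem_ball_iff_norm, norm_sub_rev y P]
    split_ifs <;> ring
  simp_rw [heq]
  refine ⟨(hI.add (hgb.integrable.const_mul _)).const_mul _, ?_⟩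
  rw [integral_const_mul, integral_add hI (hgb.integrable.const_mul _), integral_const_mul]
  have hle : ∫ y in D, |g y| * (ball P √ε).indicator (fun y => (‖P - y‖ ^ (N - 1))⁻¹) y ≤
      M * (N * volume.real (ball (0 : EN N) 1) * √ε) := by
    rw [← setIntegral_ball_inv_pow hN P (Real.sqrt_nonneg ε),
      ← integral_indicator measurableSet_ball, ← integral_const_mul]
    have hnn : ∀ y, 0 ≤ (ball P √ε).indicator (fun y => (‖P - y‖ ^ (N - 1))⁻¹) y :=
      fun y => indicator_nonneg (fun _ _ => by positivity) y
    refine (setIntegral_mono_on hgb (hball.const_mul M).integrableOn hDm fun y hy =>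
      mul_le_mul_of_nonneg_right (hM y hy) (hnn y)).trans
      (setIntegral_le_integral (hball.const_mul M)
        (Eventually.of_forall fun y => mul_nonneg hM0 (hnn y)))
  calc _ ≤ gradWeight N ε ρ * ((∫ y in D, |g y| * (‖P - y‖ ^ (N - 1))⁻¹) +
        |Real.log ε| * (M * (N * volume.real (ball (0 : EN N) 1) * √ε))) := by gcongr
    _ = _ := by ring

lemma HoleDomain.abs_green_sub_le (h : HoleDomain Ω P b d) (hN : 2 ≤ N) :
    ∃ C > 0, ∃ ε₁ > 0, ∀ ε, 0 < ε → ε < ε₁ → ∀ H,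
      IsRegularPart (Ω \ closedBall P ε) (fundS N) H → ∀ y ∈ Ω \ closedBall P ε, ∀ x x',
      8 * ε ≤ ‖x - P‖ → 2 * ‖x - P‖ ≤ b → ‖x' - x‖ ≤ ‖x - P‖ / 4 → x ≠ y → x' ≠ y →
        |(fundS N x' y + H x' y) - (fundS N x y + H x y)| ≤
          C * ((‖x' - y‖ ^ (N - 1))⁻¹ + (‖x - y‖ ^ (N - 1))⁻¹ + (‖y - P‖ ^ (N - 1))⁻¹ *
            (gradWeight N ε ‖x - P‖ * (1 + if ‖y - P‖ < √ε then |Real.log ε| else 0))) *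
              ‖x' - x‖ := by
  obtain ⟨C, hC, ε₁, hε₁, hH⟩ := h.abs_regularPart_sub_le hN
  have hS := constS_pos hN
  refine ⟨constS N * N + C, by positivity, min ε₁ 1, by positivity,
    fun ε hε hεlt H hreg y hy x x' h8 h2 hx' hxy hxy' => ?_⟩
  have hρ : 0 < ‖x - P‖ := by linarith
  have hreg' := hH ε hε (hεlt.trans_le (min_le_left _ _)) H hreg y hy x x' x h8 h2 hx'
    (by simpa using by positivity)
  have hk := kernelWeight_le (N := N) hε (hεlt.trans_le (min_le_right _ _)) hρ ‖y - P‖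
  have hs : |fundS N x' y - fundS N x y| ≤ constS N * N *
      ((‖x' - y‖ ^ (N - 1))⁻¹ + (‖x - y‖ ^ (N - 1))⁻¹) * ‖x' - x‖ := by
    rw [fundS_eq, fundS_eq, ← mul_sub, abs_mul, abs_of_pos hS, mul_assoc, mul_assoc]
    refine mul_le_mul_of_nonneg_left ?_ hS.le
    refine (abs_radialS_sub_le hN (norm_sub_pos_iff.2 hxy') (norm_sub_pos_iff.2 hxy)).trans ?_
    rw [mul_assoc]
    gcongr
    simpa using abs_norm_sub_norm_le (x' - y) (x - y)
  set A := (‖x' - y‖ ^ (N - 1))⁻¹ + (‖x - y‖ ^ (N - 1))⁻¹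
  set B := (‖y - P‖ ^ (N - 1))⁻¹ *
    (gradWeight N ε ‖x - P‖ * (1 + if ‖y - P‖ < √ε then |Real.log ε| else 0)) with hB
  have hA0 : 0 ≤ A := by positivity
  have hB0 : 0 ≤ B := by
    have := one_le_gradWeight (N := N) hε.le hρ.le
    have h1 : (0 : ℝ) ≤ 1 + if ‖y - P‖ < √ε then |Real.log ε| else 0 := by
      split_ifs <;> positivity
    positivity
  have hBle : C * ((‖y - P‖ ^ (N - 1))⁻¹ * kernelWeight N ε ‖x - P‖ ‖y - P‖) * ‖x' - x‖ ≤
      C * B * ‖x' - x‖ := by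
    rw [hB]
    gcongr
  calc _ = |(fundS N x' y - fundS N x y) + (H x' y - H x y)| := by congr 1; ring
    _ ≤ constS N * N * A * ‖x' - x‖ + C * B * ‖x' - x‖ :=
        (abs_add_le _ _).trans (add_le_add hs (hreg'.trans hBle))
    _ ≤ (constS N * N + C) * (A + B) * ‖x' - x‖ := by
        rw [← add_mul]
        gcongr
        have := mul_nonneg (mul_nonneg hS.le N.cast_nonneg) hB0
        have := mul_nonneg hC.le hA0
        linarith

end GreenPotential

lemma HoleDomain.abs_setIntegral_green_sub_le {N : ℕ} {Ω : Set (EN N)} {P : EN N} {b d : ℝ}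
    (h : HoleDomain Ω P b d) (hN : 2 ≤ N) :
    ∃ C > 0, ∃ ε₁ > 0, ∀ ε, 0 < ε → ε < ε₁ → ∀ H,
      IsRegularPart (Ω \ closedBall P ε) (fundS N) H →
      ∀ g M, ContinuousOn g (Ω \ closedBall P ε) → 0 ≤ M →
      (∀ y ∈ Ω \ closedBall P ε, |g y| ≤ M) →
      ∀ x x', 8 * ε ≤ ‖x - P‖ → 2 * ‖x - P‖ ≤ b → ‖x' - x‖ ≤ ‖x - P‖ / 4 →
        |(∫ y in Ω \ closedBall P ε, g y * (fundS N x' y + H x' y)) -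
          ∫ y in Ω \ closedBall P ε, g y * (fundS N x y + H x y)| ≤
          C * ((∫ y in Ω \ closedBall P ε, |g y| * (‖x' - y‖ ^ (N - 1))⁻¹) +
            (∫ y in Ω \ closedBall P ε, |g y| * (‖x - y‖ ^ (N - 1))⁻¹) +
            gradWeight N ε ‖x - P‖ *
              ((∫ y in Ω \ closedBall P ε, |g y| * (‖P - y‖ ^ (N - 1))⁻¹) +
                M * (N * volume.real (ball (0 : EN N) 1)) * (√ε * |Real.log ε|))) *
            ‖x' - x‖ := by
  obtain ⟨C, hC, ε₁, hε₁, hG⟩ := h.abs_green_sub_le hN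
  obtain ⟨C', -, hint⟩ := h.exists_integrableOn_mul_green hN
  refine ⟨C, hC, ε₁, hε₁, fun ε hε hεlt H hH g M hg hM0 hM x x' h8 h2 hx' => ?_⟩
  have hρ : 0 < ‖x - P‖ := by linarith
  have hDm : MeasurableSet (Ω \ closedBall P ε) := h.isOpen_diff.measurableSet
  have hDb : Bornology.IsBounded (Ω \ closedBall P ε) := h.isBounded_diff
  have htri : ‖x - P‖ ≤ ‖x' - P‖ + ‖x' - x‖ := by
    rw [norm_sub_rev x' x, add_comm]
    exact norm_sub_le_norm_sub_add_norm_sub x x' P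
  have htri' : ‖x' - P‖ ≤ ‖x' - x‖ + ‖x - P‖ := norm_sub_le_norm_sub_add_norm_sub x' x P
  have hxD : x ∈ Ω \ closedBall P ε := h.mem_diff (by linarith) (by linarith [h.b_pos])
  have hxD' : x' ∈ Ω \ closedBall P ε := h.mem_diff (by linarith) (by linarith [h.b_pos])
  have hI := (hint ε H hH g M hg hM x hxD).1.integrable
  have hI' := (hint ε H hH g M hg hM x' hxD').1.integrable
  have hW := (integrableOn_abs_mul_inv_pow hN hDb hDm hg hM x).integrable
  have hW' := (integrableOn_abs_mul_inv_pow hN hDb hDm hg hM x').integrable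
  obtain ⟨hB, hBle⟩ := setIntegral_gradWeight_le hN hDb hDm hg hM0 hM hε hρ P
  rw [← integral_sub hI' hI, ← Real.norm_eq_abs]
  refine (norm_integral_le_of_norm_le
    ((((hW'.add hW).add hB.integrable).const_mul C).mul_const ‖x' - x‖) ?_).trans ?_
  · filter_upwards [ae_restrict_mem hDm, ae_ne_of_two_le hN x _, ae_ne_of_two_le hN x' _]
      with y hy hxy hxy'
    rw [← mul_sub, Real.norm_eq_abs, abs_mul]
    refine (mul_le_mul_of_nonneg_left (hG ε hε hεlt H hH y hy x x' h8 h2 hx' hxy hxy')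
      (abs_nonneg (g y))).trans_eq ?_
    simp only [Pi.add_apply]
    ring
  · rw [integral_mul_const, integral_const_mul, integral_add' (hW'.add hW) hB.integrable,
      integral_add' hW' hW]
    gcongr

lemma tendsto_sqrt_mul_abs_log :
    Tendsto (fun ε : ℝ => √ε * |Real.log ε|) (𝓝[>] 0) (𝓝 0) := by
  have h := (tendsto_log_mul_rpow_nhdsGT_zero (r := 1 / 2) (by norm_num)).abs
  rw [abs_zero] at h
  refine h.congr' ?_
  filter_upwards [self_mem_nhdsWithin] with ε _
  rw [abs_mul, ← Real.sqrt_eq_rpow, abs_of_nonneg (Real.sqrt_nonneg ε), mul_comm]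

/-- Lemma 3.3 of the paper: (i) `A_ε → 0` uniformly; (ii) the estimate for
`∂A_ε/∂x_i` in the regime `|x-P| → 0`, `|x-P|/ε → ∞`. -/
theorem stmt12
    {N : ℕ} (hN : 2 ≤ N)
    (Ω : Set (EN N)) (P : EN N) (f : ℝ → ℝ) (ε₀ C : ℝ)
    (u : ℝ → EN N → ℝ) (u₀ : EN N → ℝ)
    (hset : Setting Ω P f ε₀ C u u₀)
    (Heps : ℝ → EN N → EN N → ℝ)
    (hHeps : ∀ ε ∈ Ioo (0:ℝ) ε₀, IsRegularPart (Ω \ closedBall P ε) (fundS N) (Heps ε)) :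
    -- (i)
    (∀ δ > (0:ℝ), ∀ᶠ ε in 𝓝[>] (0:ℝ), ∀ x ∈ Ω \ closedBall P ε,
      |Aeps Ω P f u u₀ Heps ε x| ≤ δ) ∧
    -- (ii)
    (∀ δ > (0:ℝ), ∃ η > (0:ℝ), ∀ ε ∈ Ioo (0:ℝ) η, ∀ x ∈ Ω \ closedBall P ε,
      ‖x - P‖ ≤ η → ε ≤ η * ‖x - P‖ → ∀ i : Fin N,
        |pd (Aeps Ω P f u u₀ Heps ε) i x|
          ≤ if N = 2 then δ * (1 + 1 / (‖x - P‖ * |Real.log ε|))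
            else δ * (1 + ε ^ (N - 2) / ‖x - P‖ ^ (N - 1))) := by
  obtain ⟨b, d, hD⟩ := exists_holeDomain hset.1 hset.2.1 hset.2.2.1
  obtain ⟨M, hM0, hM⟩ := hset.exists_abs_sub_le
  have hε₀ : 0 < ε₀ := hset.2.2.2.2.1
  refine ⟨fun δ hδ => ?_, fun δ hδ => ?_⟩
  · obtain ⟨K, hK, hA⟩ := hD.exists_integrableOn_mul_green hN
    filter_upwards [hset.eventually_setIntegral_mul_inv_pow_le hN (div_pos hδ hK),
      Ioo_mem_nhdsGT hε₀] with ε hε hε' x hx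
    refine (hA ε (Heps ε) (hHeps ε hε') _ M (hset.continuousOn_sub hε') (hM ε hε') x hx).2.trans ?_
    rw [← le_div_iff₀' hK]
    exact hε x
  · obtain ⟨K, hK, ε₁, hε₁, hA⟩ := hD.abs_setIntegral_green_sub_le hN
    set V := (N : ℝ) * volume.real (ball (0 : EN N) 1)
    have hV : 0 ≤ V := mul_nonneg N.cast_nonneg measureReal_nonneg
    have hτ : 0 < δ / K / 4 := by positivity
    have hsqrt : ∀ᶠ ε : ℝ in 𝓝[>] 0, M * V * (√ε * |Real.log ε|) < δ / K / 4 := by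
      have h := tendsto_sqrt_mul_abs_log.const_mul (M * V)
      rw [mul_zero] at h
      exact h.eventually_lt_const hτ
    obtain ⟨η₁, hη₁, hη⟩ := mem_nhdsGT_iff_exists_Ioo_subset.1
      ((hset.eventually_setIntegral_mul_inv_pow_le hN hτ).and
        (hsqrt.and (inter_mem (Ioo_mem_nhdsGT hε₀) (Ioo_mem_nhdsGT hε₁))))
    have hη₁0 : (0 : ℝ) < η₁ := hη₁
    have hb := hD.b_pos
    refine ⟨min η₁ (min (1 / 8) (b / 2)), by positivity, fun ε hε x hx hxη hεx i => ?_⟩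
    obtain ⟨hI, hs, hε', hε''⟩ := hη ⟨hε.1, hε.2.trans_le (min_le_left _ _)⟩
    have hρ : 0 < ‖x - P‖ := hε.1.trans (lt_norm_of_mem_diff hx)
    have h8 : 8 * ε ≤ ‖x - P‖ := by
      have : min η₁ (min (1 / 8) (b / 2)) * ‖x - P‖ ≤ 1 / 8 * ‖x - P‖ := by
        gcongr
        exact (min_le_right _ _).trans (min_le_left _ _)
      linarith
    have h2 : 2 * ‖x - P‖ ≤ b := by
      linarith [hxη.trans ((min_le_right _ _).trans (min_le_right _ _))]
    have hw : 1 ≤ gradWeight N ε ‖x - P‖ := one_le_gradWeight hε.1.le hρ.le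
    suffices |pd (Aeps Ω P f u u₀ Heps ε) i x| ≤ δ * gradWeight N ε ‖x - P‖ by
      rwa [gradWeight, mul_ite] at this
    have hlip : ‖fderiv ℝ (Aeps Ω P f u u₀ Heps ε) x‖ ≤ δ * gradWeight N ε ‖x - P‖ := by
      refine norm_fderiv_le_of_lip' ℝ (by positivity) ?_
      filter_upwards [closedBall_mem_nhds x (by positivity : 0 < ‖x - P‖ / 4)] with x' hx'
      rw [mem_closedBall, dist_eq_norm] at hx'
      refine (hA ε hε.1 hε''.2 (Heps ε) (hHeps ε hε') _ M (hset.continuousOn_sub hε') hM0.le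
        (hM ε hε') x x' h8 h2 hx').trans ?_
      refine mul_le_mul_of_nonneg_right ?_ (norm_nonneg _)
      rw [← le_div_iff₀' hK]
      calc _ ≤ δ / K / 4 + δ / K / 4 + gradWeight N ε ‖x - P‖ * (δ / K / 4 + δ / K / 4) := by
            gcongr
            exacts [hI x', hI x, hI P]
        _ ≤ δ / K * gradWeight N ε ‖x - P‖ := by nlinarith
        _ = δ * gradWeight N ε ‖x - P‖ / K := by ring
    calc |pd (Aeps Ω P f u u₀ Heps ε) i x|
        ≤ ‖fderiv ℝ (Aeps Ω P f u u₀ Heps ε) x‖ * ‖(EuclideanSpace.single i 1 : EN N)‖ :=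
          (fderiv ℝ (Aeps Ω P f u u₀ Heps ε) x).le_opNorm _
      _ ≤ δ * gradWeight N ε ‖x - P‖ := by simpa using hlip
end
end

section
/- Let (x_ε) be a family of points of Ω_ε with |x_ε − P| → 0 and |x_ε − P|/ε → +∞ as ε → 0. If N ≥ 3, then u_ε(x_ε) − u_0(x_ε) → 0. If N = 2 and in addition log|x_ε − P| / log ε → 0, then u_ε(x_ε) − u_0(x_ε) → 0. -/
open Filter Set Topology Metric MeasureTheory

noncomputable section

/-- The second derivative at `0` of a function of one variable with a local maximum there is
nonpositive. -/
lemma second_deriv_nonpos_of_isLocalMax {h k : ℝ → ℝ} {c : ℝ} (hmax : IsLocalMax h 0)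
    (hk : ∀ᶠ t in 𝓝 (0:ℝ), HasDerivAt h (k t) t) (hc : HasDerivAt k c 0) : c ≤ 0 := by
  by_contra! hpos
  have hd : deriv h =ᶠ[𝓝 0] k := hk.mono fun t ht => ht.deriv
  have hdd : deriv (deriv h) 0 = c := by rw [hd.deriv_eq, hc.deriv]
  have hmin : IsLocalMin h 0 :=
    isLocalMin_of_deriv_deriv_pos (by simpa [hdd] using hpos) hmax.deriv_eq_zero
      hk.self_of_nhds.continuousAt
  have hconst : h =ᶠ[𝓝 0] fun _ => h 0 := by
    filter_upwards [hmax, hmin] with t h1 h2 using le_antisymm h1 h2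
  have hzero : deriv (deriv h) 0 = 0 := by
    rw [hconst.deriv.deriv_eq]
    simp
  linarith

lemma tendsto_line {N : ℕ} (x e : EN N) : Tendsto (fun t : ℝ => x + t • e) (𝓝 0) (𝓝 x) := by
  have : Continuous fun t : ℝ => x + t • e := by fun_prop
  simpa using this.tendsto 0

lemma hasDerivAt_line {N : ℕ} (x e : EN N) (t : ℝ) : HasDerivAt (fun t : ℝ => x + t • e) e t := by
  simpa using ((hasDerivAt_id t).smul_const e).const_add x

lemma eventually_hasDerivAt_line {N : ℕ} {u : EN N → ℝ} {x : EN N} (hu : ContDiffAt ℝ 2 u x)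
    (i : Fin N) :
    ∀ᶠ t in 𝓝 (0:ℝ), HasDerivAt (fun t : ℝ => u (x + t • EuclideanSpace.single i (1:ℝ)))
      (pd u i (x + t • EuclideanSpace.single i (1:ℝ))) t := by
  filter_upwards [(tendsto_line x (EuclideanSpace.single i (1:ℝ))).eventually
    (hu.eventually (by simp))] with t ht
  exact (ht.differentiableAt (by simp)).hasFDerivAt.comp_hasDerivAt t (hasDerivAt_line x _ t)

lemma hasDerivAt_pd_line {N : ℕ} {u : EN N → ℝ} {x : EN N} (hu : ContDiffAt ℝ 2 u x)
    (i : Fin N) :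
    HasDerivAt (fun t : ℝ => pd u i (x + t • EuclideanSpace.single i (1:ℝ))) (pd2 u i i x) 0 := by
  have h1 : ContDiffAt ℝ 1 (fderiv ℝ u) x := hu.fderiv_right (by norm_num)
  have h2 : DifferentiableAt ℝ (fun y => pd u i y) x :=
    (h1.differentiableAt (by simp)).clm_apply (differentiableAt_const _)
  have h3 : HasFDerivAt (fun y => pd u i y) (fderiv ℝ (fun y => pd u i y) x)
      (x + (0:ℝ) • EuclideanSpace.single i (1:ℝ)) := by
    simpa using h2.hasFDerivAt
  exact h3.comp_hasDerivAt (0:ℝ) (hasDerivAt_line x _ 0)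

lemma norm_sq_line {N : ℕ} (x P : EN N) (i : Fin N) (t : ℝ) :
    ‖x + t • EuclideanSpace.single i (1:ℝ) - P‖ ^ 2
      = ‖x - P‖ ^ 2 + 2 * t * (x - P) i + t ^ 2 := by
  rw [show x + t • EuclideanSpace.single i (1:ℝ) - P
    = (x - P) + t • EuclideanSpace.single i (1:ℝ) by abel, norm_add_sq_real]
  simp [inner_smul_right, EuclideanSpace.inner_single_right, norm_smul]
  ring

/-- At a local maximum of `a - b - G(|· - P|²)` the Laplacians are ordered; the Laplacian of the
radial function is written in terms of the derivatives `G₁`, `G₂` of the profile `G`. -/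
lemma lap_sub_le_of_isLocalMax {N : ℕ} {a b : EN N → ℝ} {x P : EN N} {G G₁ G₂ : ℝ → ℝ}
    (ha : ContDiffAt ℝ 2 a x) (hb : ContDiffAt ℝ 2 b x) (hxP : x ≠ P)
    (hG : ∀ s, 0 < s → HasDerivAt G (G₁ s) s) (hG₁ : ∀ s, 0 < s → HasDerivAt G₁ (G₂ s) s)
    (hmax : IsLocalMax (fun y => a y - b y - G (‖y - P‖ ^ 2)) x) :
    lap a x - lap b x ≤ 4 * ‖x - P‖ ^ 2 * G₂ (‖x - P‖ ^ 2) + 2 * N * G₁ (‖x - P‖ ^ 2) := by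
  have hs : 0 < ‖x - P‖ ^ 2 := by
    have : 0 < ‖x - P‖ := norm_pos_iff.2 (sub_ne_zero.2 hxP)
    positivity
  have key : ∀ i, pd2 a i i x - pd2 b i i x
      ≤ 4 * (x - P) i ^ 2 * G₂ (‖x - P‖ ^ 2) + 2 * G₁ (‖x - P‖ ^ 2) := by
    intro i
    set S : ℝ → ℝ := fun t => ‖x - P‖ ^ 2 + 2 * t * (x - P) i + t ^ 2 with hS
    have hS0 : S 0 = ‖x - P‖ ^ 2 := by simp [hS]
    have hSd : ∀ t, HasDerivAt S (2 * (x - P) i + 2 * t) t := by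
      intro t
      have h := ((((hasDerivAt_id t).const_mul 2).mul_const ((x - P) i)).const_add
        (‖x - P‖ ^ 2)).add ((hasDerivAt_id t).pow 2)
      exact h.congr_deriv (by simp)
    have hSpos : ∀ᶠ t in 𝓝 (0:ℝ), 0 < S t :=
      (hSd 0).continuousAt.eventually (lt_mem_nhds (hS0 ▸ hs))
    have hmax0 : IsLocalMax (fun t : ℝ => a (x + t • EuclideanSpace.single i (1:ℝ))
        - b (x + t • EuclideanSpace.single i (1:ℝ)) - G (S t)) 0 := by
      have := (tendsto_line x (EuclideanSpace.single i (1:ℝ))).eventually hmax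
      filter_upwards [this] with t ht
      rw [norm_sq_line] at ht
      simpa [hS] using ht
    have hd : ∀ᶠ t in 𝓝 (0:ℝ), HasDerivAt
        (fun t : ℝ => a (x + t • EuclideanSpace.single i (1:ℝ))
          - b (x + t • EuclideanSpace.single i (1:ℝ)) - G (S t))
        (pd a i (x + t • EuclideanSpace.single i (1:ℝ))
          - pd b i (x + t • EuclideanSpace.single i (1:ℝ))
          - G₁ (S t) * (2 * (x - P) i + 2 * t)) t := by
      filter_upwards [eventually_hasDerivAt_line ha i, eventually_hasDerivAt_line hb i, hSpos]
        with t h1 h2 h3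
      exact (h1.sub h2).sub ((hG _ h3).comp t (hSd t))
    have hlin : HasDerivAt (fun t : ℝ => 2 * (x - P) i + 2 * t) 2 0 := by
      simpa using ((hasDerivAt_id (0:ℝ)).const_mul 2).const_add (2 * (x - P) i)
    have hdd := ((hasDerivAt_pd_line ha i).sub (hasDerivAt_pd_line hb i)).sub
      (((hG₁ (S 0) (hS0 ▸ hs)).comp 0 (hSd 0)).mul hlin)
    have := second_deriv_nonpos_of_isLocalMax hmax0 hd hdd
    simp only [Function.comp_apply, hS0] at this
    linarith
  have hsum := Finset.sum_le_sum fun i (_ : i ∈ Finset.univ) => key i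
  have hnorm : ‖x - P‖ ^ 2 = ∑ i, (x - P) i ^ 2 := EuclideanSpace.real_norm_sq_eq _
  rw [Finset.sum_sub_distrib, Finset.sum_add_distrib, ← Finset.sum_mul, ← Finset.mul_sum,
    ← hnorm] at hsum
  simp only [Finset.sum_const, Finset.card_univ, Fintype.card_fin, nsmul_eq_mul] at hsum
  unfold lap
  linarith

/-- `g` (with derivatives `g₁`, `g₂`) is the profile, in the variable `|x|²`, of a radial
superharmonic function on `ℝ^N \ {0}` which is at least `1` for `|x| = ε` and nonnegative for
`|x| = R`. -/
structure IsBarrier (N : ℕ) (ε R : ℝ) (g g₁ g₂ : ℝ → ℝ) : Prop where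
  hasDerivAt : ∀ s, 0 < s → HasDerivAt g (g₁ s) s
  hasDerivAt_deriv : ∀ s, 0 < s → HasDerivAt g₁ (g₂ s) s
  superharmonic : ∀ s, 0 < s → 4 * s * g₂ s + 2 * N * g₁ s ≤ 0
  one_le : 1 ≤ g (ε ^ 2)
  nonneg : 0 ≤ g (R ^ 2)

/-- Comparison principle on the annulus `ε ≤ |x - P| ≤ R`. -/
lemma sub_le_of_isBarrier {N : ℕ} (hN : 2 ≤ N) {P : EN N} {ε R M B δ : ℝ} (hε : 0 < ε)
    (hεR : ε < R) (hM : 0 ≤ M) (hB : 0 ≤ B) (hδ : 0 ≤ δ) {a b : EN N → ℝ} {g g₁ g₂ : ℝ → ℝ}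
    (hg : IsBarrier N ε R g g₁ g₂)
    (ha : ∀ x, ε < ‖x - P‖ → ‖x - P‖ < R → ContDiffAt ℝ 2 a x)
    (hb : ∀ x, ε < ‖x - P‖ → ‖x - P‖ < R → ContDiffAt ℝ 2 b x)
    (hac : ContinuousOn a {x | ε ≤ ‖x - P‖ ∧ ‖x - P‖ ≤ R})
    (hbc : ContinuousOn b {x | ε ≤ ‖x - P‖ ∧ ‖x - P‖ ≤ R})
    (hlap : ∀ x, ε < ‖x - P‖ → ‖x - P‖ < R → -(2 * M) ≤ lap a x - lap b x)
    (hin : ∀ x, ‖x - P‖ = ε → a x - b x ≤ B) (hout : ∀ x, ‖x - P‖ = R → a x - b x ≤ δ)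
    {x : EN N} (hx1 : ε ≤ ‖x - P‖) (hx2 : ‖x - P‖ ≤ R) :
    a x - b x ≤ δ + B * g (‖x - P‖ ^ 2) + (M + 1) * (R ^ 2 - ‖x - P‖ ^ 2) := by
  set Z : Set (EN N) := {x | ε ≤ ‖x - P‖ ∧ ‖x - P‖ ≤ R} with hZ
  set G : ℝ → ℝ := fun s => δ + B * g s + (M + 1) * (R ^ 2 - s) with hGdef
  have hG : ∀ s, 0 < s → HasDerivAt G (B * g₁ s - (M + 1)) s := by
    intro s hs
    have h := (((hg.hasDerivAt s hs).const_mul B).const_add δ).add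
      (((hasDerivAt_id s).const_sub (R ^ 2)).const_mul (M + 1))
    exact h.congr_deriv (by ring)
  have hG₁ : ∀ s, 0 < s → HasDerivAt (fun s => B * g₁ s - (M + 1)) (B * g₂ s) s :=
    fun s hs => ((hg.hasDerivAt_deriv s hs).const_mul B).sub_const _
  have hZc : IsCompact Z := by
    refine (isCompact_closedBall P R).of_isClosed_subset ?_ ?_
    · have hc : Continuous fun y : EN N => ‖y - P‖ := by fun_prop
      exact (isClosed_le continuous_const hc).inter (isClosed_le hc continuous_const)
    · intro y hy
      simpa [dist_eq_norm] using hy.2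
  have hcont : ContinuousOn (fun y => a y - b y - G (‖y - P‖ ^ 2)) Z := by
    refine (hac.sub hbc).sub fun y hy => ?_
    have hpos : 0 < ‖y - P‖ ^ 2 := by
      have : 0 < ‖y - P‖ := hε.trans_le hy.1
      positivity
    have h1 : ContinuousAt (fun y : EN N => ‖y - P‖ ^ 2) y := by fun_prop
    exact (ContinuousAt.comp (f := fun y : EN N => ‖y - P‖ ^ 2) (g := G)
      (hG _ hpos).continuousAt h1).continuousWithinAt
  obtain ⟨z, hz, hzmax⟩ := hZc.exists_isMaxOn ⟨x, hx1, hx2⟩ hcont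
  have hx : a x - b x - G (‖x - P‖ ^ 2) ≤ a z - b z - G (‖z - P‖ ^ 2) := hzmax ⟨hx1, hx2⟩
  suffices h : a z - b z - G (‖z - P‖ ^ 2) ≤ 0 by
    have := hx.trans h
    simp only [hGdef] at this
    linarith
  rcases hz.1.eq_or_lt with h1 | h1
  · have h2 := hin z h1.symm
    have h3 : B ≤ B * g (ε ^ 2) := le_mul_of_one_le_right hB hg.one_le
    have h4 : 0 ≤ (M + 1) * (R ^ 2 - ε ^ 2) := by
      have : ε ^ 2 ≤ R ^ 2 := by gcongr
      exact mul_nonneg (by linarith) (by linarith)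
    rw [← h1]
    simp only [hGdef]
    linarith
  rcases hz.2.eq_or_lt with h2 | h2
  · have h3 := hout z h2
    have h4 : 0 ≤ B * g (R ^ 2) := mul_nonneg hB hg.nonneg
    rw [h2]
    simp only [hGdef]
    linarith
  · exfalso
    have hnhds : Z ∈ 𝓝 z := by
      have hc : ContinuousAt (fun y : EN N => ‖y - P‖) z := by fun_prop
      filter_upwards [hc.eventually (lt_mem_nhds h1), hc.eventually (gt_mem_nhds h2)]
        with y h3 h4 using ⟨h3.le, h4.le⟩
    have hzP : z ≠ P := by
      rintro rfl
      simp only [sub_self, norm_zero] at h1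
      linarith
    have hle := lap_sub_le_of_isLocalMax (ha z h1 h2) (hb z h1 h2) hzP hG hG₁
      (hzmax.isLocalMax hnhds)
    have hs : 0 < ‖z - P‖ ^ 2 := by
      have := hε.trans h1
      positivity
    have h3 := mul_nonpos_of_nonneg_of_nonpos hB (hg.superharmonic _ hs)
    have h4 := hlap z h1 h2
    have h5 : (2:ℝ) ≤ N := by exact_mod_cast hN
    nlinarith

/-- The bound `|u ε - u₀| → 0` along `x ε`, given barriers tending to `0` along `x ε`. -/
lemma tendsto_sub_of_isBarrier {N : ℕ} (hN : 2 ≤ N) {Ω : Set (EN N)} {P : EN N} {f : ℝ → ℝ}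
    {ε₀ C : ℝ} {u : ℝ → EN N → ℝ} {u₀ : EN N → ℝ} (hset : Setting Ω P f ε₀ C u u₀)
    {x : ℝ → EN N} (hx : ∀ᶠ ε in 𝓝[>] (0:ℝ), x ε ∈ Ω \ closedBall P ε)
    (h1 : Tendsto (fun ε => ‖x ε - P‖) (𝓝[>] (0:ℝ)) (𝓝 0))
    (hbar : ∀ R, 0 < R → ∃ g g₁ g₂ : ℝ → ℝ → ℝ,
      (∀ᶠ ε in 𝓝[>] (0:ℝ), IsBarrier N ε R (g ε) (g₁ ε) (g₂ ε)) ∧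
      Tendsto (fun ε => g ε (‖x ε - P‖ ^ 2)) (𝓝[>] (0:ℝ)) (𝓝 0)) :
    Tendsto (fun ε => u ε (x ε) - u₀ (x ε)) (𝓝[>] (0:ℝ)) (𝓝 0) := by
  obtain ⟨hΩ, -, hP, hf, hε₀, hsol, hbound, hsol₀, hconv⟩ := hset
  obtain ⟨hu₀, hlap₀, -, -, -⟩ := hsol₀
  have : NeZero N := ⟨by omega⟩
  have : Nontrivial (EN N) := inferInstance
  obtain ⟨R₀, hR₀, hball⟩ := nhds_basis_closedBall.mem_iff.1 (hΩ.mem_nhds hP)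
  obtain ⟨B, hB⟩ := (isCompact_closedBall P R₀).exists_bound_of_continuousOn
    (hu₀.continuousOn.mono hball)
  have hB0 : 0 ≤ B := (norm_nonneg _).trans (hB P (mem_closedBall_self hR₀.le))
  obtain ⟨M, hM⟩ := (isCompact_Icc (a := -max C B) (b := max C B)).exists_bound_of_continuousOn
    hf.continuous.continuousOn
  have hM0 : 0 ≤ M := (norm_nonneg _).trans (hM 0 (by
    have : 0 ≤ max C B := hB0.trans (le_max_right _ _)
    exact ⟨by linarith, this⟩))
  rw [Metric.tendsto_nhds]
  intro η hη
  obtain ⟨R, hR, hRR₀, hRη⟩ : ∃ R, 0 < R ∧ R ≤ R₀ ∧ (M + 1) * R ^ 2 < η / 3 := by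
    have ht : Tendsto (fun R : ℝ => (M + 1) * R ^ 2) (𝓝[>] 0) (𝓝 0) := by
      have hc : Continuous fun R : ℝ => (M + 1) * R ^ 2 := by fun_prop
      simpa using (hc.tendsto 0).mono_left nhdsWithin_le_nhds
    have := (ht.eventually (gt_mem_nhds (show (0:ℝ) < η / 3 by linarith))).and
      (Ioc_mem_nhdsGT hR₀)
    obtain ⟨R, h2, h3⟩ := this.exists
    exact ⟨R, h3.1, h3.2, h2⟩
  have hsphere : sphere P R ⊆ Ω \ {P} := by
    intro y hy
    refine ⟨hball (closedBall_subset_closedBall hRR₀ (sphere_subset_closedBall hy)), ?_⟩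
    rintro rfl
    simp at hy
    linarith
  obtain ⟨g, g₁, g₂, hg, hgx⟩ := hbar R hR
  have hunif := Metric.tendstoUniformlyOn_iff.1 (hconv _ hsphere (isCompact_sphere P R)).1
    (η / 3) (by linarith)
  have hBg : Tendsto (fun ε => B * g ε (‖x ε - P‖ ^ 2)) (𝓝[>] (0:ℝ)) (𝓝 0) := by
    simpa using hgx.const_mul B
  filter_upwards [hx, h1.eventually (gt_mem_nhds hR), hg, hunif,
    hBg.eventually (gt_mem_nhds (show (0:ℝ) < η / 3 by linarith)),
    Ioo_mem_nhdsGT (lt_min hε₀ hR)] with ε hxε hxR hgε huε hBε hε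
  have hεR : ε < R := hε.2.trans_le (min_le_right _ _)
  have hεpos : 0 < ε := hε.1
  have hεmem : ε ∈ Ioo 0 ε₀ := ⟨hε.1, hε.2.trans_le (min_le_left _ _)⟩
  obtain ⟨hu, hlap, -, hucont, hubd⟩ := hsol ε hεmem
  have hD : IsOpen (Ω \ closedBall P ε) := hΩ.sdiff isClosed_closedBall
  have hmemΩ : ∀ y, ‖y - P‖ ≤ R → y ∈ Ω := fun y hy =>
    hball (by simpa [dist_eq_norm] using hy.trans hRR₀)
  have hmemD : ∀ y, ε < ‖y - P‖ → ‖y - P‖ ≤ R → y ∈ Ω \ closedBall P ε := fun y h3 h4 =>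
    ⟨hmemΩ y h4, by simpa [dist_eq_norm] using h3⟩
  have hfront : ∀ y, ‖y - P‖ = ε → y ∈ frontier (Ω \ closedBall P ε) := by
    intro y hy
    have hyΩ : y ∈ Ω := hmemΩ y (hy.trans_lt hεR).le
    have hyc : y ∈ closedBall P ε := by simp [dist_eq_norm, hy]
    have hyf : y ∈ frontier (closedBall P ε) := by
      rw [frontier_closedBall P hεpos.ne']
      simp [hy]
    rw [hD.frontier_eq]
    refine ⟨?_, fun h => h.2 hyc⟩
    rw [frontier_eq_closure_inter_closure] at hyf
    exact hΩ.inter_closure ⟨hyΩ, hyf.2⟩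
  have hua : ∀ y, ε < ‖y - P‖ → ‖y - P‖ < R → ContDiffAt ℝ 2 (u ε) y := fun y h3 h4 =>
    hu.contDiffAt (hD.mem_nhds (hmemD y h3 h4.le))
  have hu₀a : ∀ y, ε < ‖y - P‖ → ‖y - P‖ < R → ContDiffAt ℝ 2 u₀ y := fun y _ h4 =>
    hu₀.contDiffAt (hΩ.mem_nhds (hmemΩ y h4.le))
  have huc : ContinuousOn (u ε) {y | ε ≤ ‖y - P‖ ∧ ‖y - P‖ ≤ R} := by
    refine hucont.mono fun y hy => ?_
    rcases hy.1.eq_or_lt with h3 | h3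
    · exact (hfront y h3.symm).1
    · exact subset_closure (hmemD y h3 hy.2)
  have hu₀c : ContinuousOn u₀ {y | ε ≤ ‖y - P‖ ∧ ‖y - P‖ ≤ R} :=
    hu₀.continuousOn.mono fun y hy => hmemΩ y hy.2
  have hfb : ∀ t, |t| ≤ max C B → |f t| ≤ M := fun t ht => hM t (abs_le.1 ht)
  have hu₀B : ∀ y, ‖y - P‖ ≤ R → |u₀ y| ≤ B := fun y hy =>
    hB y (by simpa [dist_eq_norm] using hy.trans hRR₀)
  have hlapb : ∀ y, ε < ‖y - P‖ → ‖y - P‖ < R → |lap (u ε) y - lap u₀ y| ≤ 2 * M := by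
    intro y h3 h4
    rw [hlap y (hmemD y h3 h4.le), hlap₀ y (hmemΩ y h4.le)]
    have h5 := abs_le.1 (hfb _ ((hbound ε hεmem y (hmemD y h3 h4.le)).trans (le_max_left _ _)))
    have h6 := abs_le.1 (hfb _ ((hu₀B y h4.le).trans (le_max_right _ _)))
    rw [abs_le]
    constructor <;> linarith
  have hinn : ∀ y, ‖y - P‖ = ε → |u ε y - u₀ y| ≤ B := by
    intro y hy
    rw [hubd y (hfront y hy), zero_sub, abs_neg]
    exact hu₀B y (hy.trans_lt hεR).le
  have hout : ∀ y, ‖y - P‖ = R → |u ε y - u₀ y| ≤ η / 3 := by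
    intro y hy
    have := huε y (by simpa [dist_eq_norm] using hy)
    rw [dist_comm, Real.dist_eq] at this
    exact this.le
  have hxε1 : ε ≤ ‖x ε - P‖ := by
    have := hxε.2
    simp only [mem_closedBall, dist_eq_norm, not_le] at this
    exact this.le
  have hη3 : 0 ≤ η / 3 := by linarith
  have hup := sub_le_of_isBarrier hN hεpos hεR hM0 hB0 hη3 hgε hua hu₀a huc hu₀c
    (fun y h3 h4 => (abs_le.1 (hlapb y h3 h4)).1)
    (fun y hy => (abs_le.1 (hinn y hy)).2) (fun y hy => (abs_le.1 (hout y hy)).2) hxε1 hxR.le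
  have hlow := sub_le_of_isBarrier hN hεpos hεR hM0 hB0 hη3 hgε hu₀a hua hu₀c huc
    (fun y h3 h4 => by linarith [(abs_le.1 (hlapb y h3 h4)).2])
    (fun y hy => by linarith [(abs_le.1 (hinn y hy)).1])
    (fun y hy => by linarith [(abs_le.1 (hout y hy)).1]) hxε1 hxR.le
  have hsq : 0 ≤ (M + 1) * ‖x ε - P‖ ^ 2 := by positivity
  rw [Real.dist_eq, sub_zero, abs_lt]
  constructor <;> linarith

/-- `ε / |x|` is superharmonic in dimension at least three. -/
lemma isBarrier_rpow {N : ℕ} (hN : 3 ≤ N) {ε R : ℝ} (hε : 0 < ε) :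
    IsBarrier N ε R (fun s => ε * s ^ (-(1 / 2) : ℝ))
      (fun s => ε * (-(1 / 2) * s ^ (-(1 / 2) - 1 : ℝ)))
      (fun s => ε * (-(1 / 2) * ((-(1 / 2) - 1) * s ^ (-(1 / 2) - 1 - 1 : ℝ)))) where
  hasDerivAt s hs := (Real.hasDerivAt_rpow_const (Or.inl hs.ne')).const_mul ε
  hasDerivAt_deriv s hs :=
    ((Real.hasDerivAt_rpow_const (Or.inl hs.ne')).const_mul (-(1 / 2))).const_mul ε
  superharmonic s hs := by
    have h : s * s ^ (-(1 / 2) - 1 - 1 : ℝ) = s ^ (-(1 / 2) - 1 : ℝ) := by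
      rw [Real.rpow_sub_one hs.ne' (-(1 / 2) - 1)]
      field_simp
    have hp : 0 < ε * s ^ (-(1 / 2) - 1 : ℝ) := by positivity
    have hN' : (3:ℝ) ≤ N := by exact_mod_cast hN
    calc _ = 3 * ε * (s * s ^ (-(1 / 2) - 1 - 1 : ℝ)) - N * (ε * s ^ (-(1 / 2) - 1 : ℝ)) := by
          ring
      _ = (3 - N) * (ε * s ^ (-(1 / 2) - 1 : ℝ)) := by rw [h]; ring
      _ ≤ 0 := mul_nonpos_of_nonpos_of_nonneg (by linarith) hp.le
  one_le := by
    rw [Real.rpow_neg (by positivity), ← Real.sqrt_eq_rpow, Real.sqrt_sq hε.le,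
      mul_inv_cancel₀ hε.ne']
  nonneg := by positivity

/-- The logarithm is harmonic in dimension two. -/
lemma isBarrier_log {ε R : ℝ} (hε : 0 < ε) (hεR : ε < R) :
    IsBarrier 2 ε R
      (fun s => (Real.log s - 2 * Real.log R) / (2 * (Real.log ε - Real.log R)))
      (fun s => s⁻¹ / (2 * (Real.log ε - Real.log R)))
      (fun s => -(s ^ 2)⁻¹ / (2 * (Real.log ε - Real.log R))) where
  hasDerivAt s hs := ((Real.hasDerivAt_log hs.ne').sub_const _).div_const _
  hasDerivAt_deriv s hs := (hasDerivAt_inv hs.ne').div_const _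
  superharmonic s hs := by
    refine le_of_eq ?_
    push_cast
    field_simp
    ring
  one_le := by
    have h : Real.log ε - Real.log R ≠ 0 := (sub_neg.2 (Real.log_lt_log hε hεR)).ne
    rw [Real.log_pow]
    refine le_of_eq ?_
    push_cast
    field_simp
  nonneg := by simp [Real.log_pow]

/-- Proposition 4.1 of the paper.  If `x ε ∈ Ω_ε`, `|x ε - P| → 0` and
`|x ε - P|/ε → ∞`, then `u ε (x ε) - u₀ (x ε) → 0` when `N ≥ 3`; when `N = 2` the same
holds under the extra assumption `log|x ε - P| / log ε → 0`. -/
theorem stmt13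
    {N : ℕ} (hN : 2 ≤ N)
    (Ω : Set (EN N)) (P : EN N) (f : ℝ → ℝ) (ε₀ C : ℝ)
    (u : ℝ → EN N → ℝ) (u₀ : EN N → ℝ)
    (hset : Setting Ω P f ε₀ C u u₀)
    (x : ℝ → EN N)
    (hx : ∀ᶠ ε in 𝓝[>] (0:ℝ), x ε ∈ Ω \ closedBall P ε)
    (h1 : Tendsto (fun ε => ‖x ε - P‖) (𝓝[>] (0:ℝ)) (𝓝 0))
    (h2 : Tendsto (fun ε => ‖x ε - P‖ / ε) (𝓝[>] (0:ℝ)) atTop) :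
    (3 ≤ N → Tendsto (fun ε => u ε (x ε) - u₀ (x ε)) (𝓝[>] (0:ℝ)) (𝓝 0)) ∧
    (N = 2 → Tendsto (fun ε => Real.log ‖x ε - P‖ / Real.log ε) (𝓝[>] (0:ℝ)) (𝓝 0) →
      Tendsto (fun ε => u ε (x ε) - u₀ (x ε)) (𝓝[>] (0:ℝ)) (𝓝 0)) := by
  constructor
  · intro hN3
    refine tendsto_sub_of_isBarrier hN hset hx h1 fun R hR =>
      ⟨fun ε s => ε * s ^ (-(1 / 2) : ℝ), _, _,
        eventually_mem_nhdsWithin.mono fun ε hε => isBarrier_rpow hN3 hε, ?_⟩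
    refine h2.inv_tendsto_atTop.congr fun ε => ?_
    beta_reduce
    rw [Real.rpow_neg (by positivity), ← Real.sqrt_eq_rpow, Real.sqrt_sq (norm_nonneg _)]
    simp [div_eq_mul_inv, mul_comm]
  · rintro rfl h3
    refine tendsto_sub_of_isBarrier hN hset hx h1 fun R hR =>
      ⟨fun ε s => (Real.log s - 2 * Real.log R) / (2 * (Real.log ε - Real.log R)), _, _,
        eventually_of_mem (Ioo_mem_nhdsGT hR) fun ε hε => isBarrier_log hε.1 hε.2, ?_⟩
    have hinv : Tendsto (fun ε => Real.log R / Real.log ε) (𝓝[>] (0:ℝ)) (𝓝 0) :=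
      Real.tendsto_log_nhdsGT_zero.const_div_atBot _
    have hlim := (h3.sub hinv).div ((tendsto_const_nhds (x := (1:ℝ))).sub hinv) (by simp)
    rw [sub_zero, zero_div] at hlim
    refine hlim.congr' ?_
    filter_upwards [Ioo_mem_nhdsGT (lt_min hR one_pos)] with ε hε
    have hlog : Real.log ε ≠ 0 :=
      (Real.log_neg hε.1 (hε.2.trans_le (min_le_right _ _))).ne
    have hne : Real.log ε - Real.log R ≠ 0 :=
      (sub_neg.2 (Real.log_lt_log hε.1 (hε.2.trans_le (min_le_left _ _)))).ne
    rw [Pi.div_apply, Real.log_pow, ← sub_div, one_sub_div hlog, div_div_div_cancel_right₀ hlog]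
    push_cast
    rw [← mul_sub, mul_div_mul_left _ _ two_ne_zero]
end
end
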